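/- arXiv:1705.07960 — 2 statements merged into one kernel-verified Lean document; each statement's English description precedes it below -/
import Mathlib

section
/- (Read's and Hoggar's conjectures, proved by Huh) Let G be a finite simple graph. There is a unique polynomial χ_G ∈ ℤ[t], the chromatic polynomial of G, such that for every natural number n, χ_G(n) equals the number of proper colorings of G with n colors, i.e., the number of functions f : V(G) → {1, …, n} with f(v) ≠ f(w) whenever v and w are adjacent. The sequence of absolute values of the coefficients of χ_G is log-concave: writing χ_G(t) = Σ_k a_k t^k, one has |a_k|² ≥ |a_{k−1}|·|a_{k+1}| for all 0 < k < deg χ_G; in particular this sequence is unimodal. -/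
namespace HRW
open Matrix

theorem bochner_normalized {I : Type*} [Fintype I] [DecidableEq I] (S : Matrix I I ℝ)
    (hS : S.IsSymm) (hoff : ∀ i j, i ≠ j → 0 ≤ S i j) (z : I → ℝ) (hz : ∀ i, 0 < z i)
    (hSz : S *ᵥ z = z)
    (hconn : ∀ w : I → ℝ, (∀ i j, i ≠ j → 0 < S i j → w i = w j) → ∀ i j, w i = w j)
    (hsq : ∀ w : I → ℝ, w ⬝ᵥ S *ᵥ w ≤ (S *ᵥ w) ⬝ᵥ (S *ᵥ w))
    (w : I → ℝ) (hw : w ⬝ᵥ z = 0) : w ⬝ᵥ S *ᵥ w ≤ 0 := by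
  have hH : S.IsHermitian := by
    rw [Matrix.IsHermitian, Matrix.conjTranspose_eq_transpose_of_trivial]; exact hS
  set e : I → I → ℝ := fun j => WithLp.ofLp (hH.eigenvectorBasis j) with he
  have hev : ∀ j, S *ᵥ e j = hH.eigenvalues j • e j := fun j => hH.mulVec_eigenvectorBasis j
  have hsymm : ∀ a b : I → ℝ, a ⬝ᵥ S *ᵥ b = (S *ᵥ a) ⬝ᵥ b := by
    intro a b
    rw [Matrix.dotProduct_mulVec, ← Matrix.mulVec_transpose, hS.eq]
  have hexp : ∀ a b : I → ℝ, ∑ j, (a ⬝ᵥ e j) * (e j ⬝ᵥ b) = a ⬝ᵥ b := by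
    intro a b
    have := hH.eigenvectorBasis.sum_inner_mul_inner (WithLp.toLp 2 a) (WithLp.toLp 2 b)
    simp only [PiLp.inner_apply, RCLike.inner_apply, conj_trivial] at this
    simp only [dotProduct, he]
    rw [show ∑ i, a i * b i = ∑ i, b i * a i from Finset.sum_congr rfl fun i _ => mul_comm _ _, ← this]
    refine Finset.sum_congr rfl fun j _ => ?_
    congr 1 <;> refine Finset.sum_congr rfl fun i _ => mul_comm _ _
  have hnorm : ∀ j, e j ⬝ᵥ e j = 1 := by
    intro j
    have := hH.eigenvectorBasis.orthonormal.1 j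
    have h2 : inner ℝ (hH.eigenvectorBasis j) (hH.eigenvectorBasis j) = (1 : ℝ) := by
      rw [real_inner_self_eq_norm_sq, this]; norm_num
    simpa only [PiLp.inner_apply, RCLike.inner_apply, conj_trivial, dotProduct, he] using h2
  rw [← hexp w (S *ᵥ w)]
  refine Finset.sum_nonpos fun j _ => ?_
  rw [hsymm (e j) w, hev j, smul_dotProduct, smul_eq_mul, dotProduct_comm (e j) w]
  by_cases hl : hH.eigenvalues j ≤ 0
  · have : w ⬝ᵥ e j * (hH.eigenvalues j * w ⬝ᵥ e j) = hH.eigenvalues j * (w ⬝ᵥ e j) ^ 2 := by ring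
    rw [this]
    exact mul_nonpos_of_nonpos_of_nonneg hl (sq_nonneg _)
  push Not at hl
  have h1 : 1 ≤ hH.eigenvalues j := by
    have := hsq (e j)
    rw [hev j, dotProduct_smul, smul_dotProduct, dotProduct_smul, hnorm j] at this
    simp only [smul_eq_mul, mul_one] at this
    by_contra hc; push Not at hc
    nlinarith
  -- Dirichlet form
  set x : I → ℝ := fun i => e j i / z i with hx
  have hxe : ∀ i, e j i = x i * z i := fun i => by simp [hx, (hz i).ne']
  have hD : ∑ i, ∑ k, S i k * z i * z k * (x i - x k) ^ 2 = 2 * (1 - hH.eigenvalues j) := by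
    have e1 : ∑ i, ∑ k, S i k * z i * z k * (x i) ^ 2 = 1 := by
      rw [← hnorm j, dotProduct]
      refine Finset.sum_congr rfl fun i _ => ?_
      have : ∑ k, S i k * z k = z i := congrFun hSz i
      calc _ = z i * x i ^ 2 * ∑ k, S i k * z k := by
            rw [Finset.mul_sum]; exact Finset.sum_congr rfl fun k _ => by ring
        _ = _ := by rw [this, hxe i]; ring
    have e2 : ∑ i, ∑ k, S i k * z i * z k * (x k) ^ 2 = 1 := by
      rw [Finset.sum_comm, ← e1]
      refine Finset.sum_congr rfl fun i _ => Finset.sum_congr rfl fun k _ => ?_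
      rw [hS.apply]; ring
    have e3 : ∑ i, ∑ k, S i k * z i * z k * (x i * x k) = hH.eigenvalues j := by
      have : e j ⬝ᵥ S *ᵥ e j = hH.eigenvalues j := by
        rw [hev j, dotProduct_smul, hnorm j]; simp
      rw [← this, dotProduct]
      refine Finset.sum_congr rfl fun i _ => ?_
      rw [Matrix.mulVec, dotProduct, Finset.mul_sum]
      refine Finset.sum_congr rfl fun k _ => ?_
      rw [hxe i, hxe k]; ring
    have : ∀ i k, S i k * z i * z k * (x i - x k) ^ 2 = S i k * z i * z k * (x i) ^ 2
        + S i k * z i * z k * (x k) ^ 2 - 2 * (S i k * z i * z k * (x i * x k)) := fun i k => by ring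
    simp only [this, Finset.sum_sub_distrib, Finset.sum_add_distrib, ← Finset.mul_sum, e1, e2, e3]
    ring
  have hnn : ∀ i k, 0 ≤ S i k * z i * z k * (x i - x k) ^ 2 := by
    intro i k
    by_cases h : i = k
    · subst h; simp
    · have := hoff i k h; have := (hz i).le; have := (hz k).le; positivity
  have hzero : ∀ i k, S i k * z i * z k * (x i - x k) ^ 2 = 0 := by
    have hle : ∑ i, ∑ k, S i k * z i * z k * (x i - x k) ^ 2 ≤ 0 := by rw [hD]; linarith
    intro i k
    refine le_antisymm ?_ (hnn i k)
    calc _ ≤ ∑ k, S i k * z i * z k * (x i - x k) ^ 2 :=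
          Finset.single_le_sum (f := fun k => S i k * z i * z k * (x i - x k) ^ 2) (fun k _ => hnn i k) (Finset.mem_univ k)
      _ ≤ ∑ i, ∑ k, S i k * z i * z k * (x i - x k) ^ 2 :=
          Finset.single_le_sum (f := fun i => ∑ k, S i k * z i * z k * (x i - x k) ^ 2)
            (fun i _ => Finset.sum_nonneg fun k _ => hnn i k) (Finset.mem_univ i)
      _ ≤ 0 := hle
  have hc := hconn x (by
    intro i k _ hpos
    have h := hzero i k
    have h2 : S i k * z i * z k ≠ 0 := by have := hz i; have := hz k; positivity
    rcases mul_eq_zero.1 h with h | h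
    · exact absurd h h2
    · exact sub_eq_zero.1 (pow_eq_zero_iff (two_ne_zero) |>.1 h))
  have : w ⬝ᵥ e j = 0 := by
    by_cases hI : Nonempty I
    · obtain ⟨i0⟩ := hI
      have : e j = x i0 • z := by
        ext i; rw [hxe i, hc i i0]; rfl
      rw [this, dotProduct_smul, hw, smul_zero]
    · have : IsEmpty I := not_nonempty_iff.1 hI
      simp [dotProduct]
  rw [this]; simp

theorem bochner {I : Type*} [Fintype I] [DecidableEq I] (A : Matrix I I ℝ)
    (hA : A.IsSymm) (hoff : ∀ i j, i ≠ j → 0 ≤ A i j) (y : I → ℝ) (hy : ∀ i, 0 < y i)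
    (hb : ∀ i, 0 < (A *ᵥ y) i)
    (hconn : ∀ w : I → ℝ, (∀ i j, i ≠ j → 0 < A i j → w i = w j) → ∀ i j, w i = w j)
    (hsq : ∀ u : I → ℝ, u ⬝ᵥ A *ᵥ u ≤ ∑ i, (A *ᵥ u) i ^ 2 * y i / (A *ᵥ y) i)
    (u : I → ℝ) (hu : u ⬝ᵥ A *ᵥ y = 0) : u ⬝ᵥ A *ᵥ u ≤ 0 := by
  set b := A *ᵥ y with hbdef
  set s : I → ℝ := fun i => Real.sqrt (b i / y i) with hs
  have hspos : ∀ i, 0 < s i := fun i => Real.sqrt_pos.2 (div_pos (hb i) (hy i))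
  have hs2 : ∀ i, s i * s i = b i / y i := fun i => Real.mul_self_sqrt (div_pos (hb i) (hy i)).le
  set S : Matrix I I ℝ := fun i j => A i j / (s i * s j) with hSdef
  have hSm : ∀ v : I → ℝ, ∀ i, (S *ᵥ v) i = (A *ᵥ (fun j => v j / s j)) i / s i := by
    intro v i
    simp only [Matrix.mulVec, dotProduct, hSdef, Finset.sum_div]
    refine Finset.sum_congr rfl fun j _ => ?_
    have := (hspos i).ne'; have := (hspos j).ne'
    field_simp
  have hback : ∀ v : I → ℝ, (fun j => (s j * v j) / s j) = v := by
    intro v; ext j; have := (hspos j).ne'; field_simp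
  have hform : ∀ v v' : I → ℝ, (fun j => s j * v j) ⬝ᵥ S *ᵥ (fun j => s j * v' j) = v ⬝ᵥ A *ᵥ v' := by
    intro v v'
    simp only [dotProduct]
    refine Finset.sum_congr rfl fun i _ => ?_
    rw [hSm, hback]
    have := (hspos i).ne'; field_simp
  rw [← hform u u]
  have hS' : S *ᵥ (fun j => s j * y j) = fun j => s j * y j := by
      ext i
      rw [hSm, hback, div_eq_iff (hspos i).ne']
      change b i = _
      have h := hs2 i
      rw [mul_right_comm, h, div_mul_cancel₀ _ (hy i).ne']
  refine bochner_normalized S ?_ ?_ (fun j => s j * y j) (fun j => mul_pos (hspos j) (hy j))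
    hS' ?_ ?_ _ ?_
  · ext i j
    change A j i / (s j * s i) = A i j / (s i * s j)
    rw [hA.apply i j, mul_comm (s j)]
  · intro i j hij
    exact div_nonneg (hoff i j hij) (mul_pos (hspos i) (hspos j)).le
  · intro w h
    exact hconn w fun i j hij hp => h i j hij (div_pos hp (mul_pos (hspos i) (hspos j)))
  · intro w
    have hwv : w = fun j => s j * (w j / s j) := by
      ext j; have := (hspos j).ne'; field_simp
    set v : I → ℝ := fun j => w j / s j with hv
    have : w = fun j => s j * v j := hwv
    rw [this, hform]
    refine (hsq v).trans (le_of_eq ?_)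
    simp only [dotProduct]
    refine Finset.sum_congr rfl fun i _ => ?_
    have h3 : (S *ᵥ fun j => s j * v j) i = (A *ᵥ v) i / s i := by rw [hSm, hback]
    rw [h3, div_mul_div_comm, hs2]
    have := (hy i).ne'; have := (hb i).ne'
    field_simp
  · have : (fun j => s j * u j) ⬝ᵥ S *ᵥ (fun j => s j * y j) = 0 := by rw [hform, hu]
    rwa [hS'] at this

/-- reverse Cauchy–Schwarz from one hyperbolic direction -/
theorem reverse_cs {X : Type*} [AddCommGroup X] [Module ℝ X] (Q : X → X → ℝ)
    (hadd : ∀ a b c, Q (a + b) c = Q a c + Q b c) (hsmul : ∀ (r : ℝ) a c, Q (r • a) c = r * Q a c)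
    (hsymm : ∀ a b, Q a b = Q b a) (z : X) (hz : ∀ w, Q w z = 0 → Q w w ≤ 0)
    (u y : X) (hy : 0 < Q y y) : Q u u * Q y y ≤ Q u y ^ 2 := by
  set a := Q y z
  set b := Q u z
  have hadd' : ∀ a b c, Q c (a + b) = Q c a + Q c b := fun a b c => by
    rw [hsymm, hadd, hsymm a, hsymm b]
  have hsmul' : ∀ (r : ℝ) a c, Q c (r • a) = r * Q c a := fun r a c => by
    rw [hsymm, hsmul, hsymm a]
  by_cases hu : Q u u ≤ 0
  · exact (mul_nonpos_of_nonpos_of_nonneg hu hy.le).trans (sq_nonneg _)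
  push Not at hu
  have ha : a ≠ 0 := fun h => absurd (hz y h) (not_le.2 hy)
  have h := hz (a • u + (-b) • y) (by rw [hadd, hsmul, hsmul]; change a * b + -b * a = 0; ring)
  simp only [hadd, hadd', hsmul, hsmul'] at h
  rw [hsymm y u] at h
  have ha2 : 0 < a ^ 2 := by positivity
  by_contra hc
  push Not at hc
  -- Q(u,u) * form = (a Q(u,u) - b Q(u,y))^2 + b^2 (Q u u Q y y - Q u y^2)
  have key : Q u u * (a * (a * Q u u) + a * (-b * Q u y) + (-b) * (a * Q u y) + (-b) * (-b * Q y y))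
    = (a * Q u u - b * Q u y) ^ 2 + b ^ 2 * (Q u u * Q y y - Q u y ^ 2) := by ring
  have h0 : (a * Q u u - b * Q u y) ^ 2 + b ^ 2 * (Q u u * Q y y - Q u y ^ 2) ≤ 0 := by
    rw [← key]; exact mul_nonpos_of_nonneg_of_nonpos hu.le (by nlinarith)
  have hb : b = 0 := by
    by_contra hb
    have : 0 < b ^ 2 := by positivity
    nlinarith [sq_nonneg (a * Q u u - b * Q u y), mul_pos this (sub_pos.2 hc)]
  rw [hb] at h0
  have : 0 < (a * Q u u) ^ 2 := by positivity
  nlinarith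

end HRW

namespace HRW
open Matrix

/-- A pure simplicial complex with a space of linear functions, balanced with weights one. -/
structure Fan (V : Type*) [Fintype V] [DecidableEq V] where
  d : ℕ
  Face : Finset V → Prop
  lin : Submodule ℝ (V → ℝ)
  down : ∀ {σ τ : Finset V}, Face σ → τ ⊆ σ → Face τ
  ext : ∀ {σ : Finset V}, Face σ → σ.card < d → ∃ F, F ∉ σ ∧ Face (insert F σ)
  interp : ∀ {σ : Finset V}, Face σ → ∀ F ∈ σ, ∃ l ∈ lin, l F = 1 ∧ ∀ G ∈ σ, G ≠ F → l G = 0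
  balance : ∀ {σ : Finset V}, Face σ → σ.card + 1 = d → ∀ l ∈ lin, (∀ F ∈ σ, l F = 0) →
    ∀ S : Finset V, (∀ F, F ∈ S ↔ F ∉ σ ∧ Face (insert F σ)) → ∑ F ∈ S, l F = 0

namespace Fan
variable {V : Type*} [Fintype V] [DecidableEq V] (X : Fan V)

open Classical in
noncomputable def link (σ : Finset V) : Finset V :=
  Finset.univ.filter fun F => F ∉ σ ∧ X.Face (insert F σ)

theorem mem_link {σ : Finset V} {F : V} : F ∈ X.link σ ↔ F ∉ σ ∧ X.Face (insert F σ) := by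
  simp [link]

open Classical in
noncomputable def ell (σ : Finset V) (F : V) : V → ℝ :=
  if h : X.Face σ ∧ F ∈ σ then (X.interp h.1 F h.2).choose else 0

theorem ell_mem (σ : Finset V) (F : V) : X.ell σ F ∈ X.lin := by
  unfold ell
  split_ifs with h
  · exact (X.interp h.1 F h.2).choose_spec.1
  · exact X.lin.zero_mem

theorem ell_self {σ : Finset V} {F : V} (hσ : X.Face σ) (hF : F ∈ σ) : X.ell σ F F = 1 := by
  unfold ell
  rw [dif_pos ⟨hσ, hF⟩]
  exact (X.interp hσ F hF).choose_spec.2.1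

theorem ell_of_ne {σ : Finset V} {F G : V} (hσ : X.Face σ) (hF : F ∈ σ) (hG : G ∈ σ)
    (h : G ≠ F) : X.ell σ F G = 0 := by
  unfold ell
  rw [dif_pos ⟨hσ, hF⟩]
  exact (X.interp hσ F hF).choose_spec.2.2 G hG h

noncomputable def proj (σ : Finset V) (y : V → ℝ) : V → ℝ := ∑ F ∈ σ, y F • X.ell σ F

theorem proj_mem (σ : Finset V) (y : V → ℝ) : X.proj σ y ∈ X.lin :=
  Submodule.sum_mem _ fun F _ => Submodule.smul_mem _ _ (X.ell_mem σ F)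

theorem proj_apply {σ : Finset V} (hσ : X.Face σ) (y : V → ℝ) {F : V} (hF : F ∈ σ) :
    X.proj σ y F = y F := by
  unfold proj
  rw [Finset.sum_apply, Finset.sum_eq_single F]
  · simp [X.ell_self hσ hF]
  · intro G hG hne
    simp [X.ell_of_ne hσ hG hF hne.symm]
  · exact fun h => absurd hF h

theorem proj_add (σ : Finset V) (y z : V → ℝ) : X.proj σ (y + z) = X.proj σ y + X.proj σ z := by
  simp [proj, add_smul, Finset.sum_add_distrib]

theorem proj_smul (σ : Finset V) (r : ℝ) (y : V → ℝ) : X.proj σ (r • y) = r • X.proj σ y := by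
  simp [proj, mul_smul, Finset.smul_sum]

theorem proj_congr {σ : Finset V} {y z : V → ℝ} (h : ∀ F ∈ σ, y F = z F) :
    X.proj σ y = X.proj σ z :=
  Finset.sum_congr rfl fun F hF => by rw [h F hF]

theorem proj_zero {σ : Finset V} {y : V → ℝ} (h : ∀ F ∈ σ, y F = 0) : X.proj σ y = 0 :=
  Finset.sum_eq_zero fun F hF => by rw [h F hF, zero_smul]

/-- mixed degrees -/
noncomputable def deg : List (V → ℝ) → Finset V → ℝ
  | [], _ => 1
  | y :: ys, σ => ∑ F ∈ X.link σ, (y F - X.proj σ y F) * deg ys (insert F σ)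

theorem deg_cons (y : V → ℝ) (ys : List (V → ℝ)) (σ : Finset V) :
    X.deg (y :: ys) σ = ∑ F ∈ X.link σ, (y F - X.proj σ y F) * X.deg ys (insert F σ) := rfl

theorem deg_vanish {y : V → ℝ} {σ : Finset V} (h : ∀ F ∈ σ, y F = 0) (ys : List (V → ℝ)) :
    X.deg (y :: ys) σ = ∑ F ∈ X.link σ, y F * X.deg ys (insert F σ) := by
  rw [deg_cons, X.proj_zero h]; simp

theorem deg_add (y z : V → ℝ) (ys : List (V → ℝ)) (σ : Finset V) :
    X.deg ((y + z) :: ys) σ = X.deg (y :: ys) σ + X.deg (z :: ys) σ := by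
  simp only [deg_cons, proj_add, ← Finset.sum_add_distrib, Pi.add_apply]
  exact Finset.sum_congr rfl fun F _ => by ring

theorem deg_smul (r : ℝ) (y : V → ℝ) (ys : List (V → ℝ)) (σ : Finset V) :
    X.deg ((r • y) :: ys) σ = r * X.deg (y :: ys) σ := by
  simp only [deg_cons, proj_smul, Finset.mul_sum, Pi.smul_apply, smul_eq_mul]
  exact Finset.sum_congr rfl fun F _ => by ring

theorem deg_sub (y z : V → ℝ) (ys : List (V → ℝ)) (σ : Finset V) :
    X.deg ((y - z) :: ys) σ = X.deg (y :: ys) σ - X.deg (z :: ys) σ := by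
  have h := X.deg_add (y - z) z ys σ
  rw [sub_add_cancel] at h
  linarith

theorem deg_sum {ι : Type*} (s : Finset ι) (c : ι → ℝ) (f : ι → V → ℝ) (ys : List (V → ℝ))
    (σ : Finset V) : X.deg ((∑ i ∈ s, c i • f i) :: ys) σ = ∑ i ∈ s, c i * X.deg (f i :: ys) σ := by
  classical
  induction s using Finset.induction_on with
  | empty =>
    simp only [Finset.sum_empty]
    have := X.deg_smul 0 0 ys σ
    simpa using this
  | insert a s ha ih => rw [Finset.sum_insert ha, Finset.sum_insert ha, deg_add, deg_smul, ih]

theorem deg_congr_on {y z : V → ℝ} {σ : Finset V} (h1 : ∀ F ∈ σ, y F = z F)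
    (h2 : ∀ F ∈ X.link σ, y F = z F) (ys : List (V → ℝ)) :
    X.deg (y :: ys) σ = X.deg (z :: ys) σ := by
  rw [deg_cons, deg_cons, X.proj_congr h1]
  exact Finset.sum_congr rfl fun F hF => by rw [h2 F hF]

theorem face_of_link {σ : Finset V} {F : V} (h : F ∈ X.link σ) : X.Face (insert F σ) :=
  (X.mem_link.1 h).2

theorem card_insert_link {σ : Finset V} {F : V} (h : F ∈ X.link σ) :
    (insert F σ).card = σ.card + 1 := Finset.card_insert_of_notMem (X.mem_link.1 h).1

theorem link_insert_subset {σ : Finset V} {F G : V} (h : G ∈ X.link (insert F σ)) :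
    G ∈ X.link σ := by
  rw [mem_link] at h ⊢
  refine ⟨fun hc => h.1 (Finset.mem_insert_of_mem hc), X.down h.2 ?_⟩
  exact Finset.insert_subset_insert _ (Finset.subset_insert _ _)

theorem link_swap {σ : Finset V} {F G : V} :
    (F ∈ X.link σ ∧ G ∈ X.link (insert F σ)) ↔ (F ∈ X.link (insert G σ) ∧ G ∈ X.link σ) := by
  have key : ∀ {F G : V}, F ∈ X.link σ → G ∈ X.link (insert F σ) → F ∈ X.link (insert G σ) := by
    intro F G hF hG
    have h1 := X.mem_link.1 hF
    have h2 := X.mem_link.1 hG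
    rw [mem_link]
    refine ⟨?_, by rw [Finset.insert_comm]; exact h2.2⟩
    intro hc
    rcases Finset.mem_insert.1 hc with h | h
    · exact h2.1 (by rw [h]; exact Finset.mem_insert_self _ _)
    · exact h1.1 h
  constructor
  · rintro ⟨h1, h2⟩
    exact ⟨key h1 h2, X.link_insert_subset h2⟩
  · rintro ⟨h1, h2⟩
    exact ⟨X.link_insert_subset h1, key h2 h1⟩

theorem deg_swap_aux {σ : Finset V} (hσ : X.Face σ) (ys : List (V → ℝ))
    (hB : ∀ F ∈ X.link σ, ∀ l ∈ X.lin, X.deg (l :: ys) (insert F σ) = 0) (y z : V → ℝ) :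
    X.deg (y :: z :: ys) σ = ∑ F ∈ X.link σ, ∑ G ∈ X.link (insert F σ),
      (y - X.proj σ y) F * (z - X.proj σ z) G * X.deg ys (insert G (insert F σ))
      - ∑ F ∈ X.link σ, (y - X.proj σ y) F * (z - X.proj σ z) F *
        ∑ G ∈ X.link (insert F σ), X.ell (insert F σ) F G * X.deg ys (insert G (insert F σ)) := by
  rw [deg_cons, ← Finset.sum_sub_distrib]
  refine Finset.sum_congr rfl fun F hF => ?_
  have h1 : X.deg (z :: ys) (insert F σ) = X.deg ((z - X.proj σ z) :: ys) (insert F σ) := by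
    rw [deg_sub, hB F hF _ (X.proj_mem σ z), sub_zero]
  have hFσ := (X.mem_link.1 hF).1
  set z' := z - X.proj σ z with hz'
  have hz0 : ∀ G ∈ σ, z' G = 0 := fun G hG => by
    simp [hz', X.proj_apply hσ z hG]
  have h2 : X.proj (insert F σ) z' = z' F • X.ell (insert F σ) F := by
    unfold proj
    rw [Finset.sum_insert hFσ, Finset.sum_eq_zero, add_zero]
    intro G hG
    rw [hz0 G hG, zero_smul]
  rw [h1, deg_cons, h2, Finset.mul_sum, Finset.mul_sum, ← Finset.sum_sub_distrib]
  refine Finset.sum_congr rfl fun G _ => ?_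
  simp only [Pi.sub_apply, Pi.smul_apply, smul_eq_mul]
  ring

theorem deg_swap' {σ : Finset V} (hσ : X.Face σ) (ys : List (V → ℝ))
    (hB : ∀ F ∈ X.link σ, ∀ l ∈ X.lin, X.deg (l :: ys) (insert F σ) = 0) (y z : V → ℝ) :
    X.deg (y :: z :: ys) σ = X.deg (z :: y :: ys) σ := by
  rw [X.deg_swap_aux hσ ys hB, X.deg_swap_aux hσ ys hB]
  congr 1
  · rw [Finset.sum_comm' (t' := X.link σ) (s' := fun G => X.link (insert G σ))
      (fun F G => X.link_swap)]
    refine Finset.sum_congr rfl fun F _ => Finset.sum_congr rfl fun G _ => ?_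
    rw [Finset.insert_comm, mul_comm ((y - _) G)]
  · refine Finset.sum_congr rfl fun F _ => ?_
    rw [mul_comm ((y - _) F)]

theorem deg_lin (n : ℕ) : ∀ (ys : List (V → ℝ)), ys.length = n → ∀ σ : Finset V, X.Face σ →
    σ.card + n + 1 = X.d → ∀ l ∈ X.lin, X.deg (l :: ys) σ = 0 := by
  induction n with
  | zero =>
    intro ys hys σ hσ hc l hl
    rw [List.length_eq_zero_iff] at hys
    subst hys
    rw [deg_cons]
    have := X.balance hσ (by omega) (l - X.proj σ l) (X.lin.sub_mem hl (X.proj_mem σ l))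
      (fun F hF => by simp [X.proj_apply hσ l hF]) (X.link σ) (fun F => X.mem_link)
    rw [← this]
    exact Finset.sum_congr rfl fun F _ => by simp [deg]
  | succ n ih =>
    intro ys hys σ hσ hc l hl
    match ys, hys with
    | y :: ys, hys =>
      have hys' : ys.length = n := by simpa using hys
      have hB : ∀ F ∈ X.link σ, ∀ l ∈ X.lin, X.deg (l :: ys) (insert F σ) = 0 := fun F hF l hl =>
        ih ys hys' _ (X.face_of_link hF) (by rw [X.card_insert_link hF]; omega) l hl
      rw [X.deg_swap' hσ ys hB, deg_cons]
      exact Finset.sum_eq_zero fun F hF => by rw [hB F hF l hl, mul_zero]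

theorem deg_perm {ys zs : List (V → ℝ)} (h : ys.Perm zs) : ∀ {σ : Finset V}, X.Face σ →
    σ.card + ys.length = X.d → X.deg ys σ = X.deg zs σ := by
  induction h with
  | nil => intros; rfl
  | cons x h ih =>
    intro σ hσ hc
    rw [deg_cons, deg_cons]
    refine Finset.sum_congr rfl fun F hF => ?_
    rw [ih (X.face_of_link hF) (by rw [X.card_insert_link hF]; simp at hc; omega)]
  | swap x y l =>
    intro σ hσ hc
    refine X.deg_swap' hσ l (fun F hF m hm => ?_) _ _
    exact X.deg_lin _ l rfl _ (X.face_of_link hF)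
      (by rw [X.card_insert_link hF]; simp at hc; omega) m hm
  | trans h1 h2 ih1 ih2 =>
    intro σ hσ hc
    rw [ih1 hσ hc, ih2 hσ (by rw [← h1.length_eq]; exact hc)]

theorem deg_congr_lin {y z : V → ℝ} (h : y - z ∈ X.lin) {ys : List (V → ℝ)} {σ : Finset V}
    (hσ : X.Face σ) (hc : σ.card + ys.length + 1 = X.d) :
    X.deg (y :: ys) σ = X.deg (z :: ys) σ := by
  have := X.deg_lin _ ys rfl σ hσ hc _ h
  rw [deg_sub] at this
  linarith

theorem continuous_deg (fs : List (ℝ → V → ℝ)) (hfs : ∀ f ∈ fs, Continuous f) :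
    ∀ σ, Continuous fun t => X.deg (fs.map fun f => f t) σ := by
  induction fs with
  | nil => intro σ; exact continuous_const
  | cons f fs ih =>
    intro σ
    have hf : ∀ F, Continuous fun t => f t F := fun F =>
      (continuous_apply F).comp (hfs f (by simp))
    simp only [List.map_cons, deg_cons, proj, Finset.sum_apply, Pi.smul_apply, smul_eq_mul]
    refine continuous_finsetSum _ fun F _ => ?_
    refine Continuous.mul (Continuous.sub (hf F) ?_) (ih (fun g hg => hfs g (by simp [hg])) _)
    exact continuous_finsetSum _ fun G _ => (hf G).mul continuous_const

def Ample (y : V → ℝ) : Prop := ∀ σ, X.Face σ → ∃ l ∈ X.lin, (∀ F ∈ σ, y F = l F) ∧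
  ∀ F ∈ X.link σ, l F < y F

def Nef (y : V → ℝ) : Prop := ∀ σ, X.Face σ → ∃ l ∈ X.lin, (∀ F ∈ σ, y F = l F) ∧
  ∀ F ∈ X.link σ, l F ≤ y F

theorem Nef.add_ample {y a : V → ℝ} (hy : X.Nef y) (ha : X.Ample a) {t : ℝ} (ht : 0 < t) :
    X.Ample (y + t • a) := by
  intro σ hσ
  obtain ⟨l, hl, h1, h2⟩ := hy σ hσ
  obtain ⟨m, hm, h3, h4⟩ := ha σ hσ
  refine ⟨l + t • m, X.lin.add_mem hl (X.lin.smul_mem t hm), fun F hF => ?_, fun F hF => ?_⟩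
  · simp [h1 F hF, h3 F hF]
  · simp only [Pi.add_apply, Pi.smul_apply, smul_eq_mul]
    have := h2 F hF
    have := mul_lt_mul_of_pos_left (h4 F hF) ht
    linarith

theorem deg_pos (ys : List (V → ℝ)) : (∀ y ∈ ys, X.Ample y) → ∀ σ, X.Face σ →
    σ.card + ys.length = X.d → 0 < X.deg ys σ := by
  induction ys with
  | nil => intros; simp [deg]
  | cons y ys ih =>
    intro hys σ hσ hc
    simp only [List.length_cons] at hc
    obtain ⟨l, hl, h1, h2⟩ := hys y (by simp) σ hσ
    rw [X.deg_congr_lin (z := y - l) (by simpa using hl) hσ (by omega),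
      X.deg_vanish (fun F hF => by simp [h1 F hF])]
    refine Finset.sum_pos (fun F hF => mul_pos (by simpa using h2 F hF) ?_) ?_
    · exact ih (fun y hy => hys y (by simp [hy])) _ (X.face_of_link hF)
        (by rw [X.card_insert_link hF]; omega)
    · obtain ⟨F, hF⟩ := X.ext hσ (by omega)
      exact ⟨F, X.mem_link.2 hF⟩

def Lor (σ : Finset V) (ys : List (V → ℝ)) : Prop :=
  ∀ u y : V → ℝ, 0 < X.deg (y :: y :: ys) σ →
    X.deg (u :: u :: ys) σ * X.deg (y :: y :: ys) σ ≤ X.deg (u :: y :: ys) σ ^ 2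

theorem lor_of_dir {σ : Finset V} (hσ : X.Face σ) {ys : List (V → ℝ)}
    (hc : σ.card + ys.length + 2 = X.d) (z : V → ℝ)
    (hz : ∀ w, X.deg (w :: z :: ys) σ = 0 → X.deg (w :: w :: ys) σ ≤ 0) : X.Lor σ ys := by
  intro u y hy
  refine reverse_cs (fun a b => X.deg (a :: b :: ys) σ) (fun a b c => X.deg_add _ _ _ _)
    (fun r a c => X.deg_smul _ _ _ _) (fun a b => ?_) z hz u y hy
  exact X.deg_perm (List.Perm.swap _ _ _) hσ (by simp; omega)

theorem lor_step {σ : Finset V} (hσ : X.Face σ) (y₃ : V → ℝ) (ys : List (V → ℝ))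
    (hc : σ.card + ys.length + 3 = X.d) (h3 : X.Ample y₃) (hys : ∀ y ∈ ys, X.Ample y)
    (hconn : ∀ w : V → ℝ, (∀ F ∈ X.link σ, ∀ G ∈ X.link (insert F σ), w F = w G) →
      ∀ F ∈ X.link σ, ∀ G ∈ X.link σ, w F = w G)
    (ih : ∀ F ∈ X.link σ, X.Lor (insert F σ) ys) : X.Lor σ (y₃ :: ys) := by
  classical
  obtain ⟨l, hl, hl1, hl2⟩ := h3 σ hσ
  set y : V → ℝ := y₃ - l with hy
  have hy0 : ∀ F ∈ σ, y F = 0 := fun F hF => by simp [hy, hl1 F hF]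
  have hypos : ∀ F ∈ X.link σ, 0 < y F := fun F hF => by simpa [hy] using hl2 F hF
  let I := {F // F ∈ X.link σ}
  let dl : V → V → ℝ := fun G => Pi.single G 1
  let ex : (I → ℝ) → V → ℝ := fun u => ∑ i : I, u i • dl i
  have ex_link : ∀ u (i : I), ex u i = u i := by
    intro u i
    simp only [ex, dl, Finset.sum_apply, Pi.smul_apply, smul_eq_mul, Pi.single_apply]
    rw [Finset.sum_eq_single i]
    · simp
    · intro j _ hj
      rw [if_neg (fun h => hj (Subtype.ext h.symm)), mul_zero]
    · simp
  have ex_σ : ∀ u, ∀ F ∈ σ, ex u F = 0 := by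
    intro u F hF
    simp only [ex, dl, Finset.sum_apply, Pi.smul_apply, smul_eq_mul, Pi.single_apply]
    refine Finset.sum_eq_zero fun j _ => ?_
    rw [if_neg (fun h : F = j.1 => (X.mem_link.1 j.2).1 (h ▸ hF)), mul_zero]
  have hcard : ∀ i : I, (insert i.1 σ).card = σ.card + 1 := fun i => X.card_insert_link i.2
  have hface : ∀ i : I, X.Face (insert i.1 σ) := fun i => X.face_of_link i.2
  let A : Matrix I I ℝ := fun i j => X.deg (dl j :: y₃ :: ys) (insert i.1 σ)
  have hAv : ∀ (v : I → ℝ) (i : I), (A *ᵥ v) i = X.deg (ex v :: y₃ :: ys) (insert i.1 σ) := by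
    intro v i
    simp only [ex]
    rw [deg_sum]
    simp only [Matrix.mulVec, dotProduct, A]
    exact Finset.sum_congr rfl fun j _ => mul_comm _ _
  have hQ : ∀ (u : I → ℝ) (v : V → ℝ), X.deg (ex u :: v :: y₃ :: ys) σ =
      ∑ i : I, u i * X.deg (v :: y₃ :: ys) (insert i.1 σ) := by
    intro u v
    rw [X.deg_vanish (ex_σ u), ← Finset.sum_coe_sort]
    exact Finset.sum_congr rfl fun i _ => by rw [ex_link]
  have hQA : ∀ u v : I → ℝ, X.deg (ex u :: ex v :: y₃ :: ys) σ = u ⬝ᵥ A *ᵥ v := by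
    intro u v
    rw [hQ, dotProduct]
    exact Finset.sum_congr rfl fun i _ => by rw [hAv]
  have hex1 : ∀ i : I, ex (Pi.single i 1) = dl i := by
    intro i
    simp only [ex]
    rw [Finset.sum_eq_single i]
    · simp
    · intro j _ hj; simp [hj]
    · simp
  have hAQ : ∀ i j : I, A i j = X.deg (dl i :: dl j :: y₃ :: ys) σ := by
    intro i j
    rw [← hex1 i, ← hex1 j, hQA]
    simp
  have hAsymm : A.IsSymm := by
    ext i j
    rw [Matrix.transpose_apply, hAQ, hAQ]
    exact X.deg_perm (List.Perm.swap _ _ _) hσ (by simp; omega)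
  have hAoff : ∀ i j : I, i ≠ j → A i j =
      if j.1 ∈ X.link (insert i.1 σ) then X.deg (y₃ :: ys) (insert j.1 (insert i.1 σ)) else 0 := by
    intro i j hij
    simp only [A, dl]
    rw [X.deg_vanish]
    · simp [Pi.single_apply]
    · intro F hF
      rw [Pi.single_apply, if_neg]
      rintro rfl
      rcases Finset.mem_insert.1 hF with h | h
      · exact hij (Subtype.ext h.symm)
      · exact (X.mem_link.1 j.2).1 h
  have hApos : ∀ i j : I, j.1 ∈ X.link (insert i.1 σ) →
      0 < X.deg (y₃ :: ys) (insert j.1 (insert i.1 σ)) := by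
    intro i j hj
    refine X.deg_pos _ ?_ _ (X.face_of_link hj) ?_
    · intro z hz
      rcases List.mem_cons.1 hz with rfl | hz
      · exact h3
      · exact hys z hz
    · rw [X.card_insert_link hj, hcard]; simp; omega
  let yI : I → ℝ := fun i => y i
  have hAy : ∀ i : I, (A *ᵥ yI) i = X.deg (y₃ :: y₃ :: ys) (insert i.1 σ) := by
    intro i
    rw [hAv]
    have h1 : X.deg (ex yI :: y₃ :: ys) (insert i.1 σ) = X.deg (y :: y₃ :: ys) (insert i.1 σ) := by
      refine X.deg_congr_on ?_ ?_ _
      · intro F hF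
        rcases Finset.mem_insert.1 hF with rfl | h
        · exact ex_link yI i
        · rw [ex_σ _ F h, hy0 F h]
      · intro F hF
        exact ex_link yI ⟨F, X.link_insert_subset hF⟩
    rw [h1]
    refine X.deg_congr_lin ?_ (hface i) ?_
    · have : y - y₃ = -l := by rw [hy]; abel
      rw [this]; exact X.lin.neg_mem hl
    · rw [hcard]; simp; omega
  have hAypos : ∀ i : I, 0 < (A *ᵥ yI) i := by
    intro i
    rw [hAy]
    refine X.deg_pos _ ?_ _ (hface i) ?_
    · intro z hz
      simp only [List.mem_cons] at hz
      rcases hz with rfl | rfl | hz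
      · exact h3
      · exact h3
      · exact hys z hz
    · rw [hcard]; simp; omega
  have hb := bochner A hAsymm (fun i j hij => by
      rw [hAoff i j hij]; split_ifs with h
      · exact (hApos i j h).le
      · exact le_rfl) yI (fun i => hypos i i.2) hAypos
    (by
      intro w hw i j
      have := hconn (fun F => if h : F ∈ X.link σ then w ⟨F, h⟩ else 0) (by
        intro F hF G hG
        have hG' := X.link_insert_subset hG
        simp only [hF, hG', dif_pos]
        have hne : (⟨F, hF⟩ : I) ≠ ⟨G, hG'⟩ := by
          intro h
          have : F = G := congrArg Subtype.val h
          subst this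
          exact (X.mem_link.1 hG).1 (Finset.mem_insert_self _ _)
        refine hw ⟨F, hF⟩ ⟨G, hG'⟩ hne ?_
        rw [hAoff _ _ hne, if_pos hG]
        exact hApos ⟨F, hF⟩ ⟨G, hG'⟩ hG) i i.2 j j.2
      simpa using this)
    (by
      intro u
      have e1 : u ⬝ᵥ A *ᵥ u = X.deg (y₃ :: ex u :: ex u :: ys) σ := by
        rw [← hQA]
        refine X.deg_perm ?_ hσ (by simp; omega)
        exact ((List.Perm.swap _ _ _).cons _).trans (List.Perm.swap _ _ _)
      have e2 : X.deg (y₃ :: ex u :: ex u :: ys) σ = X.deg (y :: ex u :: ex u :: ys) σ := by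
        refine X.deg_congr_lin ?_ hσ (by simp; omega)
        have : y₃ - y = l := by rw [hy]; abel
        rw [this]; exact hl
      rw [e1, e2, X.deg_vanish hy0, ← Finset.sum_coe_sort]
      refine Finset.sum_le_sum fun i _ => ?_
      have hp := hAypos i
      rw [le_div_iff₀ hp]
      have hL := ih i i.2 (ex u) y₃ (by rw [← hAy]; exact hp)
      rw [hAy, hAv]
      have := mul_le_mul_of_nonneg_left hL (hypos i i.2).le
      change y i * _ * _ ≤ _ * y i
      linarith)
  refine X.lor_of_dir hσ (by simp; omega) y₃ ?_
  intro w hw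
  set w' := w - X.proj σ w with hw'
  let u : I → ℝ := fun i => w' i
  have hwl : w - w' ∈ X.lin := by
    have : w - w' = X.proj σ w := by rw [hw']; abel
    rw [this]; exact X.proj_mem _ _
  have r1 : ∀ v, X.deg (w :: v :: y₃ :: ys) σ = X.deg (ex u :: v :: y₃ :: ys) σ := by
    intro v
    rw [X.deg_congr_lin hwl hσ (by simp; omega)]
    refine X.deg_congr_on ?_ ?_ _
    · intro F hF
      rw [ex_σ _ F hF]; simp [hw', X.proj_apply hσ w hF]
    · intro F hF
      exact (ex_link u ⟨F, hF⟩).symm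
  have r2 : X.deg (w :: w :: y₃ :: ys) σ = u ⬝ᵥ A *ᵥ u := by
    rw [r1, X.deg_perm (List.Perm.swap _ _ _) hσ (by simp; omega), r1, hQA]
  rw [r2]
  refine hb u ?_
  rw [← hw, r1, hQ, dotProduct]
  exact Finset.sum_congr rfl fun i _ => by rw [hAy]

theorem lor (hbase : ∀ σ, X.Face σ → σ.card + 2 = X.d → X.Lor σ [])
    (hconn : ∀ σ, X.Face σ → σ.card + 3 ≤ X.d → ∀ w : V → ℝ,
      (∀ F ∈ X.link σ, ∀ G ∈ X.link (insert F σ), w F = w G) →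
      ∀ F ∈ X.link σ, ∀ G ∈ X.link σ, w F = w G)
    (ys : List (V → ℝ)) : (∀ y ∈ ys, X.Ample y) → ∀ σ, X.Face σ →
      σ.card + ys.length + 2 = X.d → X.Lor σ ys := by
  induction ys with
  | nil => intro _ σ hσ hc; exact hbase σ hσ (by simpa using hc)
  | cons y ys ih =>
    intro h σ hσ hc
    simp only [List.length_cons] at hc
    refine X.lor_step hσ y ys (by omega) (h y (by simp)) (fun z hz => h z (by simp [hz]))
      (hconn σ hσ (by omega)) fun F hF => ?_
    exact ih (fun z hz => h z (by simp [hz])) _ (X.face_of_link hF)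
      (by rw [X.card_insert_link hF]; omega)

/-- Log-concavity for nef classes. -/
theorem nef_log_concave (hbase : ∀ σ, X.Face σ → σ.card + 2 = X.d → X.Lor σ [])
    (hconn : ∀ σ, X.Face σ → σ.card + 3 ≤ X.d → ∀ w : V → ℝ,
      (∀ F ∈ X.link σ, ∀ G ∈ X.link (insert F σ), w F = w G) →
      ∀ F ∈ X.link σ, ∀ G ∈ X.link σ, w F = w G)
    (h0 : X.Face ∅) {a : V → ℝ} (ha : X.Ample a) {u v : V → ℝ} (hv : X.Nef v)
    (ys : List (V → ℝ)) (hys : ∀ y ∈ ys, X.Nef y) (hlen : ys.length + 2 = X.d) :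
    X.deg (u :: u :: ys) ∅ * X.deg (v :: v :: ys) ∅ ≤ X.deg (u :: v :: ys) ∅ ^ 2 := by
  let p : (V → ℝ) → ℝ → V → ℝ := fun y t => y + t • a
  have hp : ∀ y, Continuous (p y) := fun y => by fun_prop
  let D : List (V → ℝ) → ℝ → ℝ := fun zs t => X.deg ((zs.map p).map fun f => f t) ∅
  have hD : ∀ zs, Continuous (D zs) := fun zs => X.continuous_deg _ (by
    intro f hf
    obtain ⟨y, _, rfl⟩ := List.mem_map.1 hf
    exact hp y) ∅
  have hD0 : ∀ zs, D zs 0 = X.deg zs ∅ := by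
    intro zs
    simp only [D, List.map_map]
    congr 1
    conv_rhs => rw [← List.map_id zs]
    refine List.map_congr_left fun y _ => ?_
    simp [p]
  have hineq : ∀ t : ℝ, 0 < t → D (u :: u :: ys) t * D (v :: v :: ys) t ≤ D (u :: v :: ys) t ^ 2 := by
    intro t ht
    have hA : ∀ y ∈ (ys.map p).map (fun f => f t), X.Ample y := by
      intro y hy
      rw [List.map_map] at hy
      obtain ⟨z, hz, rfl⟩ := List.mem_map.1 hy
      exact Nef.add_ample X (hys z hz) ha ht
    have hL := X.lor hbase hconn ((ys.map p).map fun f => f t) hA ∅ h0 (by simpa using hlen)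
    refine hL (p u t) (p v t) ?_
    refine X.deg_pos _ ?_ ∅ h0 (by simpa using hlen)
    intro y hy
    simp only [List.mem_cons] at hy
    rcases hy with rfl | rfl | hy
    · exact Nef.add_ample X hv ha ht
    · exact Nef.add_ample X hv ha ht
    · exact hA y hy
  rw [← hD0, ← hD0, ← hD0]
  have l1 : Filter.Tendsto (fun t => D (u :: u :: ys) t * D (v :: v :: ys) t)
      (nhdsWithin 0 (Set.Ioi 0)) (nhds (D (u :: u :: ys) 0 * D (v :: v :: ys) 0)) :=
    (((hD _).mul (hD _)).tendsto 0).mono_left nhdsWithin_le_nhds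
  have l2 : Filter.Tendsto (fun t => D (u :: v :: ys) t ^ 2)
      (nhdsWithin 0 (Set.Ioi 0)) (nhds (D (u :: v :: ys) 0 ^ 2)) :=
    (((hD _).pow 2).tendsto 0).mono_left nhdsWithin_le_nhds
  refine le_of_tendsto_of_tendsto l1 l2 ?_
  filter_upwards [self_mem_nhdsWithin] with t ht using hineq t ht

end Fan
end HRW

namespace HRW

/-- The flats of a loopless matroid, together with the rank function. -/
structure Flats (E : Type*) [Fintype E] [DecidableEq E] where
  IsFlat : Finset E → Prop
  rk : Finset E → ℕ
  empty_flat : IsFlat ∅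
  univ_flat : IsFlat Finset.univ
  inter : ∀ {F G}, IsFlat F → IsFlat G → IsFlat (F ∩ G)
  rk_empty : rk ∅ = 0
  rk_lt : ∀ {F G}, IsFlat F → IsFlat G → F ⊂ G → rk F < rk G
  cover : ∀ {F}, IsFlat F → ∀ e ∉ F, ∃ G, IsFlat G ∧ F ⊆ G ∧ e ∈ G ∧ rk G = rk F + 1

namespace Flats
variable {E : Type*} [Fintype E] [DecidableEq E] (M : Flats E)

theorem rk_le {F G : Finset E} (hF : M.IsFlat F) (hG : M.IsFlat G) (h : F ⊆ G) :
    M.rk F ≤ M.rk G := by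
  rcases h.eq_or_ssubset with rfl | h
  · exact le_rfl
  · exact (M.rk_lt hF hG h).le

theorem eq_of_rk {F G : Finset E} (hF : M.IsFlat F) (hG : M.IsFlat G) (h : F ⊆ G)
    (hr : M.rk G ≤ M.rk F) : F = G := by
  rcases h.eq_or_ssubset with rfl | h
  · rfl
  · exact absurd (M.rk_lt hF hG h) (by omega)

theorem cover_sub {F G H : Finset E} {e : E} (hF : M.IsFlat F) (hG : M.IsFlat G)
    (hH : M.IsFlat H) (hFG : F ⊆ G) (hr : M.rk G = M.rk F + 1) (heF : e ∉ F) (heG : e ∈ G)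
    (hFH : F ⊆ H) (heH : e ∈ H) : G ⊆ H := by
  have hI := M.inter hG hH
  have h1 : F ⊂ G ∩ H := by
    refine (Finset.ssubset_iff_of_subset (Finset.subset_inter hFG hFH)).2 ⟨e, ?_, heF⟩
    simp [heG, heH]
  have h2 := M.rk_lt hF hI h1
  have h3 := M.eq_of_rk hI hG Finset.inter_subset_left (by omega)
  rw [← h3]; exact Finset.inter_subset_right

theorem cover_unique {F G H : Finset E} {e : E} (hF : M.IsFlat F) (hG : M.IsFlat G)
    (hH : M.IsFlat H) (hFG : F ⊆ G) (hr : M.rk G = M.rk F + 1) (heF : e ∉ F) (heG : e ∈ G)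
    (hFH : F ⊆ H) (hr' : M.rk H = M.rk F + 1) (heH : e ∈ H) : G = H :=
  (M.cover_sub hF hG hH hFG hr heF heG hFH heH).antisymm
    (M.cover_sub hF hH hG hFH hr' heF heH hFG heG)

theorem cover_in {F B : Finset E} {e : E} (hF : M.IsFlat F) (hB : M.IsFlat B) (hFB : F ⊆ B)
    (heF : e ∉ F) (heB : e ∈ B) :
    ∃ G, M.IsFlat G ∧ F ⊆ G ∧ G ⊆ B ∧ e ∈ G ∧ M.rk G = M.rk F + 1 := by
  obtain ⟨G, hG, h1, h2, h3⟩ := M.cover hF e heF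
  exact ⟨G, hG, h1, M.cover_sub hF hG hB h1 h3 heF h2 hFB heB, h2, h3⟩

theorem between {A B : Finset E} (hA : M.IsFlat A) (hB : M.IsFlat B) (h : A ⊆ B) (j : ℕ)
    (h1 : M.rk A ≤ j) (h2 : j ≤ M.rk B) : ∃ F, M.IsFlat F ∧ A ⊆ F ∧ F ⊆ B ∧ M.rk F = j := by
  induction j, h1 using Nat.le_induction with
  | base => exact ⟨A, hA, subset_rfl, h, rfl⟩
  | succ j hj ih =>
    obtain ⟨F, hF, hAF, hFB, hr⟩ := ih (by omega)
    have : F ⊂ B := hFB.ssubset_of_ne (by rintro rfl; omega)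
    obtain ⟨e, heB, heF⟩ := Finset.exists_of_ssubset this
    obtain ⟨G, hG, h3, h4, h5, h6⟩ := M.cover_in hF hB hFB heF heB
    exact ⟨G, hG, hAF.trans h3, h4, by omega⟩

theorem avoid {A B : Finset E} {i : E} (hA : M.IsFlat A) (hB : M.IsFlat B) (h : A ⊆ B)
    (hiA : i ∉ A) (hiB : i ∈ B) (j : ℕ) (h1 : M.rk A ≤ j) (h2 : j < M.rk B) :
    ∃ F, M.IsFlat F ∧ A ⊆ F ∧ F ⊆ B ∧ M.rk F = j ∧ i ∉ F := by
  induction j, h1 using Nat.le_induction with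
  | base => exact ⟨A, hA, subset_rfl, h, rfl, hiA⟩
  | succ j hj ih =>
    obtain ⟨F, hF, hAF, hFB, hr, hiF⟩ := ih (by omega)
    obtain ⟨C, hC, c1, c2, c3, c4⟩ := M.cover_in hF hB hFB hiF hiB
    have : C ⊂ B := c2.ssubset_of_ne (by rintro rfl; omega)
    obtain ⟨e, heB, heC⟩ := Finset.exists_of_ssubset this
    have heF : e ∉ F := fun h => heC (c1 h)
    obtain ⟨G, hG, h3, h4, h5, h6⟩ := M.cover_in hF hB hFB heF heB
    refine ⟨G, hG, hAF.trans h3, h4, by omega, fun hiG => heC ?_⟩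
    rw [M.cover_unique hF hC hG c1 c4 hiF c3 h3 h6 hiG]
    exact h5

open Classical in
/-- covers of `A` inside `B` -/
noncomputable def cov (A B : Finset E) : Finset (Finset E) :=
  Finset.univ.filter fun F => M.IsFlat F ∧ A ⊆ F ∧ F ⊆ B ∧ M.rk F = M.rk A + 1

theorem mem_cov {A B F : Finset E} :
    F ∈ M.cov A B ↔ M.IsFlat F ∧ A ⊆ F ∧ F ⊆ B ∧ M.rk F = M.rk A + 1 := by
  simp [cov]

theorem sum_cov {A B : Finset E} (hA : M.IsFlat A) (hB : M.IsFlat B) (h : A ⊆ B) (c : E → ℝ) :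
    ∑ F ∈ M.cov A B, ∑ e ∈ F \ A, c e = ∑ e ∈ B \ A, c e := by
  rw [← Finset.sum_biUnion]
  · congr 1
    ext e
    simp only [Finset.mem_biUnion, Finset.mem_sdiff, mem_cov]
    constructor
    · rintro ⟨F, ⟨_, _, h3, _⟩, h5, h6⟩
      exact ⟨h3 h5, h6⟩
    · rintro ⟨h1, h2⟩
      obtain ⟨G, hG, g1, g2, g3, g4⟩ := M.cover_in hA hB h h2 h1
      exact ⟨G, ⟨hG, g1, g2, g4⟩, g3, h2⟩
  · intro F hF G hG hne
    rw [Finset.mem_coe, mem_cov] at hF hG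
    rw [Function.onFun, Finset.disjoint_left]
    intro e he he'
    rw [Finset.mem_sdiff] at he he'
    exact hne (M.cover_unique hA hF.1 hG.1 hF.2.1 hF.2.2.2 he.2 he.1 hG.2.1 hG.2.2.2 he'.1)

/-- linear functions -/
def lin (E : Type*) [Fintype E] [DecidableEq E] : Submodule ℝ (Finset E → ℝ) where
  carrier := {y | ∃ c : E → ℝ, ∑ e, c e = 0 ∧ ∀ S, y S = ∑ e ∈ S, c e}
  add_mem' := by
    rintro y z ⟨c, h1, h2⟩ ⟨c', h3, h4⟩
    exact ⟨c + c', by simp [Finset.sum_add_distrib, h1, h3],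
      fun S => by simp [Finset.sum_add_distrib, h2, h4]⟩
  zero_mem' := ⟨0, by simp, by simp⟩
  smul_mem' := by
    rintro r y ⟨c, h1, h2⟩
    exact ⟨r • c, by simp [← Finset.mul_sum, h1], fun S => by simp [← Finset.mul_sum, h2]⟩

theorem mem_lin {y : Finset E → ℝ} :
    y ∈ lin E ↔ ∃ c : E → ℝ, ∑ e, c e = 0 ∧ ∀ S, y S = ∑ e ∈ S, c e := Iff.rfl

theorem lin_empty {y : Finset E → ℝ} (h : y ∈ lin E) : y ∅ = 0 := by
  obtain ⟨c, _, h2⟩ := h; simp [h2]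

theorem lin_univ {y : Finset E → ℝ} (h : y ∈ lin E) : y Finset.univ = 0 := by
  obtain ⟨c, h1, h2⟩ := h; rw [h2, h1]

theorem sum_cov_lin {A B : Finset E} (hA : M.IsFlat A) (hB : M.IsFlat B) (h : A ⊆ B)
    {y : Finset E → ℝ} (hy : y ∈ lin E) (h0 : y A = 0) : ∑ F ∈ M.cov A B, y F = y B := by
  obtain ⟨c, _, h2⟩ := hy
  have key : ∀ F, A ⊆ F → y F = ∑ e ∈ F \ A, c e := by
    intro F hF
    have hA0 : ∑ e ∈ A, c e = 0 := by rw [← h2]; exact h0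
    rw [h2 F, ← Finset.sum_sdiff hF, hA0, add_zero]
  rw [key B h, ← M.sum_cov hA hB h]
  exact Finset.sum_congr rfl fun F hF => key F (M.mem_cov.1 hF).2.1

/-- chains of proper flats -/
def Face (σ : Finset (Finset E)) : Prop :=
  (∀ F ∈ σ, M.IsFlat F ∧ F ≠ ∅ ∧ F ≠ Finset.univ) ∧ ∀ F ∈ σ, ∀ G ∈ σ, F ⊆ G ∨ G ⊆ F

variable {M}

theorem Face.flat {σ : Finset (Finset E)} (hσ : M.Face σ) {F} (hF : F ∈ σ) : M.IsFlat F :=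
  (hσ.1 F hF).1

theorem Face.rk_pos {σ : Finset (Finset E)} (hσ : M.Face σ) {F} (hF : F ∈ σ) : 0 < M.rk F := by
  have h := M.rk_lt M.empty_flat (hσ.flat hF) (Finset.empty_ssubset.2
    (Finset.nonempty_iff_ne_empty.2 (hσ.1 F hF).2.1))
  omega

theorem Face.rk_lt_top {σ : Finset (Finset E)} (hσ : M.Face σ) {F} (hF : F ∈ σ) :
    M.rk F < M.rk Finset.univ :=
  M.rk_lt (hσ.flat hF) M.univ_flat (Finset.ssubset_univ_iff.2 (hσ.1 F hF).2.2)

theorem Face.sub_of_rk_le {σ : Finset (Finset E)} (hσ : M.Face σ) {F G} (hF : F ∈ σ) (hG : G ∈ σ)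
    (h : M.rk F ≤ M.rk G) : F ⊆ G := by
  rcases hσ.2 F hF G hG with h' | h'
  · exact h'
  · rw [M.eq_of_rk (hσ.flat hG) (hσ.flat hF) h' h]

theorem Face.rk_inj {σ : Finset (Finset E)} (hσ : M.Face σ) {F G} (hF : F ∈ σ) (hG : G ∈ σ)
    (h : M.rk F = M.rk G) : F = G :=
  (hσ.sub_of_rk_le hF hG h.le).antisymm (hσ.sub_of_rk_le hG hF h.ge)

/-- The gap around the rank `j`. -/
theorem Face.gap {σ : Finset (Finset E)} (hσ : M.Face σ) (j : ℕ) (hj : 0 < j)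
    (hj' : j < M.rk Finset.univ) : ∃ A B, M.IsFlat A ∧ M.IsFlat B ∧ A ⊆ B ∧ M.rk A < j ∧
      j < M.rk B ∧ (A = ∅ ∨ A ∈ σ) ∧ (B = Finset.univ ∨ B ∈ σ) ∧
      (∀ S ∈ σ, M.rk S < j → S ⊆ A) ∧ (∀ S ∈ σ, j < M.rk S → B ⊆ S) := by
  have hA : ∃ A, M.IsFlat A ∧ M.rk A < j ∧ (A = ∅ ∨ A ∈ σ) ∧ (∀ S ∈ σ, M.rk S < j → S ⊆ A) := by
    by_cases h : (σ.filter fun S => M.rk S < j).Nonempty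
    · obtain ⟨A, hA, hmax⟩ := Finset.exists_max_image _ M.rk h
      rw [Finset.mem_filter] at hA
      refine ⟨A, hσ.flat hA.1, hA.2, Or.inr hA.1, fun S hS hr => ?_⟩
      exact hσ.sub_of_rk_le hS hA.1 (hmax S (by simp [hS, hr]))
    · refine ⟨∅, M.empty_flat, by rw [M.rk_empty]; exact hj, Or.inl rfl, fun S hS hr => ?_⟩
      exact absurd ⟨S, by simp [hS, hr]⟩ h
  have hB : ∃ B, M.IsFlat B ∧ j < M.rk B ∧ (B = Finset.univ ∨ B ∈ σ) ∧
      (∀ S ∈ σ, j < M.rk S → B ⊆ S) := by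
    by_cases h : (σ.filter fun S => j < M.rk S).Nonempty
    · obtain ⟨A, hA, hmin⟩ := Finset.exists_min_image _ M.rk h
      rw [Finset.mem_filter] at hA
      refine ⟨A, hσ.flat hA.1, hA.2, Or.inr hA.1, fun S hS hr => ?_⟩
      exact hσ.sub_of_rk_le hA.1 hS (hmin S (by simp [hS, hr]))
    · refine ⟨Finset.univ, M.univ_flat, hj', Or.inl rfl, fun S hS hr => ?_⟩
      exact absurd ⟨S, by simp [hS, hr]⟩ h
  obtain ⟨A, a1, a2, a3, a4⟩ := hA
  obtain ⟨B, b1, b2, b3, b4⟩ := hB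
  refine ⟨A, B, a1, b1, ?_, a2, b2, a3, b3, a4, b4⟩
  rcases a3 with rfl | a3
  · simp
  rcases b3 with rfl | b3
  · simp
  exact hσ.sub_of_rk_le a3 b3 (by omega)

/-- being in the link -/
theorem Face.insert_iff {σ : Finset (Finset E)} (hσ : M.Face σ) {F : Finset E} :
    M.Face (insert F σ) ↔ (M.IsFlat F ∧ F ≠ ∅ ∧ F ≠ Finset.univ) ∧ ∀ S ∈ σ, F ⊆ S ∨ S ⊆ F := by
  constructor
  · intro h
    exact ⟨h.1 F (Finset.mem_insert_self _ _), fun S hS => h.2 F (Finset.mem_insert_self _ _) S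
      (Finset.mem_insert_of_mem hS)⟩
  · rintro ⟨h1, h2⟩
    refine ⟨fun G hG => ?_, fun G hG H hH => ?_⟩
    · rcases Finset.mem_insert.1 hG with rfl | hG
      · exact h1
      · exact hσ.1 G hG
    · rcases Finset.mem_insert.1 hG with hG' | hG' <;> rcases Finset.mem_insert.1 hH with hH' | hH'
      · exact Or.inl (by rw [hG', hH'])
      · rw [hG']; exact h2 H hH'
      · rw [hH']; exact (h2 G hG').symm
      · exact hσ.2 G hG' H hH'

theorem Face.insert_of_gap {σ : Finset (Finset E)} (hσ : M.Face σ) {F A B : Finset E}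
    (hF : M.IsFlat F) (h0 : 0 < M.rk F) (h1 : M.rk F < M.rk Finset.univ)
    (hne : ∀ S ∈ σ, M.rk S ≠ M.rk F) (hA : ∀ S ∈ σ, M.rk S < M.rk F → S ⊆ A)
    (hB : ∀ S ∈ σ, M.rk F < M.rk S → B ⊆ S) (hAF : A ⊆ F) (hFB : F ⊆ B) :
    F ∉ σ ∧ M.Face (insert F σ) := by
  refine ⟨fun h => hne F h rfl, hσ.insert_iff.2 ⟨⟨hF, ?_, ?_⟩, fun S hS => ?_⟩⟩
  · rintro rfl; rw [M.rk_empty] at h0; omega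
  · rintro rfl; omega
  · rcases lt_or_gt_of_ne (hne S hS) with h | h
    · exact Or.inr ((hA S hS h).trans hAF)
    · exact Or.inl (hFB.trans (hB S hS h))

/-- missing ranks -/
def miss (M : Flats E) (σ : Finset (Finset E)) : Finset ℕ :=
  Finset.Ico 1 (M.rk Finset.univ) \ σ.image M.rk

theorem mem_miss {σ : Finset (Finset E)} {j : ℕ} :
    j ∈ M.miss σ ↔ (1 ≤ j ∧ j < M.rk Finset.univ) ∧ ∀ S ∈ σ, M.rk S ≠ j := by
  simp [miss]

theorem Face.card_miss {σ : Finset (Finset E)} (hσ : M.Face σ) :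
    (M.miss σ).card + σ.card = M.rk Finset.univ - 1 := by
  have h1 : σ.image M.rk ⊆ Finset.Ico 1 (M.rk Finset.univ) := by
    intro j hj
    obtain ⟨F, hF, rfl⟩ := Finset.mem_image.1 hj
    exact Finset.mem_Ico.2 ⟨hσ.rk_pos hF, hσ.rk_lt_top hF⟩
  have h2 : (σ.image M.rk).card = σ.card :=
    Finset.card_image_of_injOn fun F hF G hG h => hσ.rk_inj hF hG h
  have h3 := Finset.card_sdiff_add_card_eq_card h1
  rw [h2, Nat.card_Ico] at h3
  exact h3

theorem Face.mem_miss_of_insert {σ : Finset (Finset E)} (_hσ : M.Face σ) {F : Finset E}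
    (hF : F ∉ σ) (h : M.Face (insert F σ)) : M.rk F ∈ M.miss σ := by
  rw [mem_miss]
  have hm := Finset.mem_insert_self F σ
  refine ⟨⟨h.rk_pos hm, h.rk_lt_top hm⟩, fun S hS he => hF ?_⟩
  rw [← h.rk_inj (Finset.mem_insert_of_mem hS) hm he]; exact hS

theorem exists_of_not_miss {σ : Finset (Finset E)} {j : ℕ} (h1 : 1 ≤ j)
    (h2 : j < M.rk Finset.univ) (h : j ∉ M.miss σ) : ∃ S ∈ σ, M.rk S = j := by
  rw [mem_miss] at h
  by_contra hc
  push Not at hc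
  exact h ⟨⟨h1, h2⟩, hc⟩

/-- The data of a gap. -/
structure Gap (M : Flats E) (σ : Finset (Finset E)) (j : ℕ) (A B : Finset E) : Prop where
  fA : M.IsFlat A
  fB : M.IsFlat B
  sub : A ⊆ B
  rA : M.rk A < j
  rB : j < M.rk B
  A_mem : A = ∅ ∨ A ∈ σ
  B_mem : B = Finset.univ ∨ B ∈ σ
  le_A : ∀ S ∈ σ, M.rk S < j → S ⊆ A
  B_le : ∀ S ∈ σ, j < M.rk S → B ⊆ S

theorem Face.exists_gap {σ : Finset (Finset E)} (hσ : M.Face σ) {j : ℕ} (hj : j ∈ M.miss σ) :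
    ∃ A B, M.Gap σ j A B := by
  rw [mem_miss] at hj
  obtain ⟨A, B, h1, h2, h3, h4, h5, h6, h7, h8, h9⟩ := hσ.gap j (by omega) hj.1.2
  exact ⟨A, B, h1, h2, h3, h4, h5, h6, h7, h8, h9⟩

theorem Gap.lin_A {σ : Finset (Finset E)} {j : ℕ} {A B : Finset E} (g : M.Gap σ j A B)
    {l : Finset E → ℝ} (hl : l ∈ lin E) (h : ∀ F ∈ σ, l F = 0) : l A = 0 := by
  rcases g.A_mem with rfl | hA
  · exact lin_empty hl
  · exact h A hA

theorem Gap.lin_B {σ : Finset (Finset E)} {j : ℕ} {A B : Finset E} (g : M.Gap σ j A B)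
    {l : Finset E → ℝ} (hl : l ∈ lin E) (h : ∀ F ∈ σ, l F = 0) : l B = 0 := by
  rcases g.B_mem with rfl | hA
  · exact lin_univ hl
  · exact h B hA

theorem Gap.mem_iff {σ : Finset (Finset E)} {j : ℕ} {A B : Finset E} (g : M.Gap σ j A B)
    (hσ : M.Face σ) (hj : j ∈ M.miss σ) {F : Finset E} (hr : M.rk F = j) :
    (F ∉ σ ∧ M.Face (insert F σ)) ↔ M.IsFlat F ∧ A ⊆ F ∧ F ⊆ B := by
  rw [mem_miss] at hj
  constructor
  · rintro ⟨_, h⟩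
    have hm := Finset.mem_insert_self F σ
    refine ⟨h.flat hm, ?_, ?_⟩
    · rcases g.A_mem with rfl | hA
      · simp
      · exact h.sub_of_rk_le (Finset.mem_insert_of_mem hA) hm (by have := g.rA; omega)
    · rcases g.B_mem with rfl | hB
      · simp
      · exact h.sub_of_rk_le hm (Finset.mem_insert_of_mem hB) (by have := g.rB; omega)
  · rintro ⟨hF, h1, h2⟩
    subst hr
    exact hσ.insert_of_gap hF (by omega) hj.1.2 hj.2 g.le_A g.B_le h1 h2

theorem Gap.rk_A_eq {σ : Finset (Finset E)} {j : ℕ} {A B : Finset E} (g : M.Gap σ j A B)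
    (hσ : M.Face σ) (hj : j ∈ M.miss σ) (h : j - 1 ∉ M.miss σ) : M.rk A + 1 = j := by
  rw [mem_miss] at hj
  have := g.rA
  by_cases h1 : j = 1
  · omega
  obtain ⟨S, hS, hr⟩ := exists_of_not_miss (by omega) (by omega) h
  have := M.rk_le (hσ.flat hS) g.fA (g.le_A S hS (by omega))
  omega

theorem Gap.rk_B_eq {σ : Finset (Finset E)} {j : ℕ} {A B : Finset E} (g : M.Gap σ j A B)
    (hσ : M.Face σ) (hj : j ∈ M.miss σ) (h : j + 1 ∉ M.miss σ) : M.rk B = j + 1 := by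
  rw [mem_miss] at hj
  have := g.rB
  have h3 := M.rk_le g.fB M.univ_flat (Finset.subset_univ _)
  by_cases h1 : j + 1 = M.rk Finset.univ
  · omega
  obtain ⟨S, hS, hr⟩ := exists_of_not_miss (by omega) (by omega) h
  have := M.rk_le g.fB (hσ.flat hS) (g.B_le S hS (by omega))
  omega

/-- balancing in a gap of rank two -/
theorem Gap.sum_eq_zero {σ : Finset (Finset E)} {j : ℕ} {A B : Finset E} (g : M.Gap σ j A B)
    {l : Finset E → ℝ} (hl : l ∈ lin E)
    (h : ∀ F ∈ σ, l F = 0) : ∑ F ∈ M.cov A B, l F = 0 := by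
  rw [M.sum_cov_lin g.fA g.fB g.sub hl (g.lin_A hl h), g.lin_B hl h]

variable (M)

noncomputable def fan : Fan (Finset E) where
  d := M.rk Finset.univ - 1
  Face := M.Face
  lin := lin E
  down := fun h hs => ⟨fun F hF => h.1 F (hs hF), fun F hF G hG => h.2 F (hs hF) G (hs hG)⟩
  ext := by
    intro σ hσ hc
    have h1 := hσ.card_miss
    obtain ⟨j, hj⟩ : (M.miss σ).Nonempty := Finset.card_pos.1 (by omega)
    obtain ⟨A, B, g⟩ := hσ.exists_gap hj
    obtain ⟨F, hF, h1, h2, h3⟩ := M.between g.fA g.fB g.sub j g.rA.le g.rB.le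
    exact ⟨F, (g.mem_iff hσ hj h3).2 ⟨hF, h1, h2⟩⟩
  interp := by
    intro σ hσ F hF
    obtain ⟨A, B, fA, fB, hAB, rA, rB, mA, mB, hA, hB⟩ := hσ.gap (M.rk F) (hσ.rk_pos hF)
      (hσ.rk_lt_top hF)
    have hAF : A ⊆ F := by
      rcases mA with rfl | mA
      · simp
      · exact hσ.sub_of_rk_le mA hF rA.le
    have hFB : F ⊆ B := by
      rcases mB with rfl | mB
      · simp
      · exact hσ.sub_of_rk_le hF mB rB.le
    obtain ⟨e, heF, heA⟩ := Finset.exists_of_ssubset (hAF.ssubset_of_ne (by rintro rfl; omega))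
    obtain ⟨f, hfB, hfF⟩ := Finset.exists_of_ssubset (hFB.ssubset_of_ne (by rintro rfl; omega))
    refine ⟨fun S => ∑ x ∈ S, ((Pi.single e 1 : E → ℝ) x - (Pi.single f 1 : E → ℝ) x),
      ⟨_, ?_, fun S => rfl⟩, ?_, ?_⟩
    · simp [Finset.sum_sub_distrib]
    · simp [Finset.sum_sub_distrib, heF, hfF]
    · intro G hG hne
      rcases lt_or_gt_of_ne (fun h => hne (hσ.rk_inj hG hF h)) with h | h
      · have := hA G hG h
        have h1 : e ∉ G := fun h => heA (this h)
        have h2 : f ∉ G := fun h => hfF (hAF (this h))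
        simp [Finset.sum_sub_distrib, h1, h2]
      · have := hB G hG h
        have h1 : e ∈ G := this (hFB heF)
        have h2 : f ∈ G := this hfB
        simp [Finset.sum_sub_distrib, h1, h2]
  balance := by
    intro σ hσ hc l hl h0 S hS
    have h1 := hσ.card_miss
    obtain ⟨j, hj⟩ : ∃ j, M.miss σ = {j} := Finset.card_eq_one.1 (by omega)
    have hjm : j ∈ M.miss σ := by simp [hj]
    obtain ⟨A, B, g⟩ := hσ.exists_gap hjm
    have hj1 := (mem_miss.1 hjm).1
    have rA := g.rk_A_eq hσ hjm (by rw [hj, Finset.mem_singleton]; omega)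
    have : S = M.cov A B := by
      ext F
      rw [hS, mem_cov]
      constructor
      · rintro ⟨h1, h2⟩
        have hr : M.rk F = j := by
          have := hσ.mem_miss_of_insert h1 h2
          simpa [hj] using this
        obtain ⟨q1, q2, q3⟩ := (g.mem_iff hσ hjm hr).1 ⟨h1, h2⟩
        exact ⟨q1, q2, q3, by omega⟩
      · rintro ⟨q1, q2, q3, q4⟩
        exact (g.mem_iff hσ hjm (by omega)).2 ⟨q1, q2, q3⟩
    rw [this]
    exact g.sum_eq_zero hl h0

/-- the ample function -/
def amp : Finset E → ℝ := fun S => ∑ _e ∈ S, ∑ _f ∈ Sᶜ, (1 : ℝ)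

theorem amp_ample : M.fan.Ample (amp (E := E)) := by
  classical
  intro σ hσ
  have hσ' : M.Face σ := hσ
  let p : E → E → Prop := fun e f => ∃ S ∈ σ, e ∈ S ∧ f ∉ S
  let s : E → E → ℝ := fun e f => (if p e f then 1 else 0) - (if p f e then 1 else 0)
  have hanti : ∀ e f, s e f = - s f e := fun e f => by simp [s]
  have hzero : ∀ S : Finset E, ∑ e ∈ S, ∑ f ∈ S, s e f = 0 := by
    intro S
    have h : ∑ e ∈ S, ∑ f ∈ S, s e f = - ∑ e ∈ S, ∑ f ∈ S, s e f := by
      conv_lhs => rw [Finset.sum_comm]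
      rw [← Finset.sum_neg_distrib]
      refine Finset.sum_congr rfl fun e _ => ?_
      rw [← Finset.sum_neg_distrib]
      exact Finset.sum_congr rfl fun f _ => hanti f e
    linarith
  let c : E → ℝ := fun e => ∑ f, s e f
  have hc : ∀ S : Finset E, ∑ e ∈ S, c e = ∑ e ∈ S, ∑ f ∈ Sᶜ, s e f := by
    intro S
    have : ∀ e, c e = ∑ f ∈ S, s e f + ∑ f ∈ Sᶜ, s e f := fun e =>
      (Finset.sum_add_sum_compl S _).symm
    simp only [this, Finset.sum_add_distrib, hzero S, zero_add]
  have hle : ∀ e f, s e f ≤ 1 := by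
    intro e f; simp only [s]; split_ifs <;> norm_num
  refine ⟨fun S => ∑ e ∈ S, c e, ⟨c, hzero Finset.univ, fun S => rfl⟩, fun F hF => ?_, fun F hF => ?_⟩
  · simp only [amp]
    rw [hc]
    refine Finset.sum_congr rfl fun e he => Finset.sum_congr rfl fun f hf => ?_
    have hf' : f ∉ F := by simpa using hf
    have h1 : p e f := ⟨F, hF, he, hf'⟩
    have h2 : ¬ p f e := by
      rintro ⟨S, hS, h3, h4⟩
      rcases hσ'.2 S hS F hF with h | h
      · exact hf' (h h3)
      · exact h4 (h he)
    simp [s, h1, h2]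
  · obtain ⟨hFσ, hFf⟩ := M.fan.mem_link.1 hF
    have hFf' : M.Face (insert F σ) := hFf
    have hjm := hσ'.mem_miss_of_insert hFσ hFf
    obtain ⟨A, B, g⟩ := hσ'.exists_gap hjm
    obtain ⟨q1, q2, q3⟩ := (g.mem_iff hσ' hjm rfl).1 ⟨hFσ, hFf⟩
    have gA := g.rA
    have gB := g.rB
    obtain ⟨e, heF, heA⟩ := Finset.exists_of_ssubset (q2.ssubset_of_ne (by rintro rfl; omega))
    obtain ⟨f, hfB, hfF⟩ := Finset.exists_of_ssubset (q3.ssubset_of_ne (by rintro rfl; omega))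
    simp only [amp]
    rw [hc]
    refine Finset.sum_lt_sum (fun e _ => Finset.sum_le_sum fun f _ => hle e f) ⟨e, heF, ?_⟩
    refine Finset.sum_lt_sum (fun f _ => hle e f) ⟨f, by simpa using hfF, ?_⟩
    have h1 : ¬ p e f := by
      rintro ⟨S, hS, h3, h4⟩
      rcases lt_or_gt_of_ne ((mem_miss.1 hjm).2 S hS) with h | h
      · exact heA (g.le_A S hS h h3)
      · exact h4 (g.B_le S hS h hfB)
    simp only [s, if_neg h1]
    split_ifs <;> norm_num

def al (i : E) : Finset E → ℝ := fun S => if i ∈ S then 1 else 0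
def be (i : E) : Finset E → ℝ := fun S => if i ∈ S then 0 else 1

theorem al_lin (i j : E) : al i - al j ∈ lin E :=
  ⟨fun e => (Pi.single i 1 : E → ℝ) e - (Pi.single j 1 : E → ℝ) e, by simp,
    fun S => by simp [al, Finset.sum_sub_distrib]⟩

theorem be_lin (i j : E) : be i - be j ∈ lin E := by
  have : be i - be j = al j - al i := by
    ext S; simp only [be, al, Pi.sub_apply]; split_ifs <;> norm_num
  rw [this]; exact al_lin j i

variable {M} in
theorem Face.exists_notMem [Nonempty E] {σ : Finset (Finset E)} (hσ : M.Face σ) :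
    ∃ i, ∀ S ∈ σ, i ∉ S := by
  by_cases h : σ.Nonempty
  · obtain ⟨T, hT, hmax⟩ := Finset.exists_max_image σ M.rk h
    obtain ⟨i, _, hi⟩ := Finset.exists_of_ssubset (Finset.ssubset_univ_iff.2 (hσ.1 T hT).2.2)
    exact ⟨i, fun S hS hc => hi (hσ.sub_of_rk_le hS hT (hmax S hS) hc)⟩
  · rw [Finset.not_nonempty_iff_eq_empty] at h
    subst h
    exact ⟨Classical.arbitrary E, by simp⟩

variable {M} in
theorem Face.exists_mem [Nonempty E] {σ : Finset (Finset E)} (hσ : M.Face σ) :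
    ∃ i, ∀ S ∈ σ, i ∈ S := by
  by_cases h : σ.Nonempty
  · obtain ⟨T, hT, hmin⟩ := Finset.exists_min_image σ M.rk h
    obtain ⟨i, hi⟩ := Finset.nonempty_iff_ne_empty.2 (hσ.1 T hT).2.1
    exact ⟨i, fun S hS => hσ.sub_of_rk_le hT hS (hmin S hS) hi⟩
  · rw [Finset.not_nonempty_iff_eq_empty] at h
    subst h
    exact ⟨Classical.arbitrary E, by simp⟩

theorem al_nef [Nonempty E] (i : E) : M.fan.Nef (al i) := by
  intro σ hσ
  obtain ⟨j, hj⟩ := Face.exists_notMem (M := M) hσ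
  refine ⟨al i - al j, al_lin i j, fun F hF => ?_, fun F hF => ?_⟩
  · simp [al, hj F hF]
  · simp only [Pi.sub_apply, al]; split_ifs <;> norm_num

theorem be_nef [Nonempty E] (i : E) : M.fan.Nef (be i) := by
  intro σ hσ
  obtain ⟨j, hj⟩ := Face.exists_mem (M := M) hσ
  refine ⟨be i - be j, be_lin i j, fun F hF => ?_, fun F hF => ?_⟩
  · simp [be, hj F hF]
  · simp only [Pi.sub_apply, be]; split_ifs <;> norm_num

end Flats
end HRW

namespace HRW
namespace Flats
variable {E : Type*} [Fintype E] [DecidableEq E] {M : Flats E}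

theorem link_iff {σ : Finset (Finset E)} {F : Finset E} :
    F ∈ M.fan.link σ ↔ F ∉ σ ∧ M.Face (insert F σ) := M.fan.mem_link

theorem Face.link_rk {σ : Finset (Finset E)} (hσ : M.Face σ) {F : Finset E}
    (hF : F ∈ M.fan.link σ) : M.rk F ∈ M.miss σ :=
  hσ.mem_miss_of_insert (link_iff.1 hF).1 (link_iff.1 hF).2

theorem link_flat {σ : Finset (Finset E)} {F : Finset E}
    (hF : F ∈ M.fan.link σ) : M.IsFlat F :=
  (link_iff.1 hF).2.flat (Finset.mem_insert_self _ _)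

theorem link_sub {σ : Finset (Finset E)} {F S : Finset E}
    (hF : F ∈ M.fan.link σ) (hS : S ∈ σ) (h : M.rk F ≤ M.rk S) : F ⊆ S :=
  (link_iff.1 hF).2.sub_of_rk_le (Finset.mem_insert_self _ _) (Finset.mem_insert_of_mem hS) h

theorem link_sup {σ : Finset (Finset E)} {F S : Finset E}
    (hF : F ∈ M.fan.link σ) (hS : S ∈ σ) (h : M.rk S ≤ M.rk F) : S ⊆ F :=
  (link_iff.1 hF).2.sub_of_rk_le (Finset.mem_insert_of_mem hS) (Finset.mem_insert_self _ _) h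

theorem Face.link_insert {σ : Finset (Finset E)} (hσ : M.Face σ) {F G : Finset E}
    (hF : F ∈ M.fan.link σ) (hG : G ∈ M.fan.link σ) (hne : F ≠ G) (h : F ⊆ G ∨ G ⊆ F) :
    G ∈ M.fan.link (insert F σ) := by
  rw [link_iff] at *
  have h1 := (hσ.insert_iff.1 hG.2)
  refine ⟨?_, hF.2.insert_iff.2 ⟨h1.1, fun S hS => ?_⟩⟩
  · intro hc
    rcases Finset.mem_insert.1 hc with h | h
    · exact hne h.symm
    · exact hG.1 h
  · rcases Finset.mem_insert.1 hS with rfl | hS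
    · exact h.symm
    · exact h1.2 S hS

theorem Gap.mem_link {σ : Finset (Finset E)} {j : ℕ} {A B : Finset E} (g : M.Gap σ j A B)
    (hσ : M.Face σ) (hj : j ∈ M.miss σ) {H : Finset E} (hH : M.IsFlat H) (hAH : A ⊆ H)
    (hHB : H ⊆ B) (h1 : M.rk A < M.rk H) (h2 : M.rk H < M.rk B) : H ∈ M.fan.link σ := by
  rw [mem_miss] at hj
  have hBu := M.rk_le g.fB M.univ_flat (Finset.subset_univ _)
  have key : ∀ S ∈ σ, (S ⊆ A ∧ M.rk S ≤ M.rk A) ∨ (B ⊆ S ∧ M.rk B ≤ M.rk S) := by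
    intro S hS
    rcases lt_or_gt_of_ne (hj.2 S hS) with h | h
    · have := g.le_A S hS h
      exact Or.inl ⟨this, M.rk_le (hσ.flat hS) g.fA this⟩
    · have := g.B_le S hS h
      exact Or.inr ⟨this, M.rk_le g.fB (hσ.flat hS) this⟩
  rw [link_iff]
  refine hσ.insert_of_gap (A := A) (B := B) hH (by omega) (by omega) ?_ ?_ ?_ hAH hHB
  · intro S hS
    rcases key S hS with h | h <;> omega
  · intro S hS hr
    rcases key S hS with h | h
    · exact h.1
    · omega
  · intro S hS hr
    rcases key S hS with h | h
    · omega
    · exact h.1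

theorem conn (σ : Finset (Finset E)) (hσ : M.fan.Face σ) (hc : σ.card + 3 ≤ M.fan.d)
    (w : Finset E → ℝ)
    (hw : ∀ F ∈ M.fan.link σ, ∀ G ∈ M.fan.link (insert F σ), w F = w G) :
    ∀ F ∈ M.fan.link σ, ∀ G ∈ M.fan.link σ, w F = w G := by
  have hσ : M.Face σ := hσ
  have hcomp : ∀ F ∈ M.fan.link σ, ∀ G ∈ M.fan.link σ, (F ⊆ G ∨ G ⊆ F) → w F = w G := by
    intro F hF G hG h
    by_cases hne : F = G
    · rw [hne]
    · exact hw F hF G (hσ.link_insert hF hG hne h)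
  have main : ∀ F ∈ M.fan.link σ, ∀ G ∈ M.fan.link σ, M.rk F ≤ M.rk G → w F = w G := by
    intro F hF G hG hFG
    by_cases hS : ∃ S ∈ σ, M.rk F < M.rk S ∧ M.rk S < M.rk G
    · obtain ⟨S, hS, h1, h2⟩ := hS
      exact hcomp F hF G hG (Or.inl ((link_sub hF hS h1.le).trans (link_sup hG hS h2.le)))
    push Not at hS
    have hj := hσ.link_rk hF
    have hjG := hσ.link_rk hG
    obtain ⟨A, B, g⟩ := hσ.exists_gap hj
    have fF := link_flat hF
    have fG := link_flat hG
    obtain ⟨_, hAF, hFB⟩ := (g.mem_iff hσ hj rfl).1 (link_iff.1 hF)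
    have gA := g.rA
    have gB := g.rB
    have hAG : A ⊆ G := by
      rcases g.A_mem with rfl | hA
      · simp
      · exact link_sup hG hA (by omega)
    have hGB : G ⊆ B := by
      rcases g.B_mem with rfl | hB
      · simp
      · have := hS B hB gB
        exact link_sub hG hB this
    have rGB : M.rk G < M.rk B := by
      refine M.rk_lt fG g.fB (hGB.ssubset_of_ne ?_)
      rintro rfl
      rcases g.B_mem with h | h
      · rw [mem_miss] at hjG; rw [h] at hjG; omega
      · exact (link_iff.1 hG).1 h
    by_cases h3 : M.rk A + 3 ≤ M.rk B
    · obtain ⟨e, heF, heA⟩ := Finset.exists_of_ssubset (hAF.ssubset_of_ne (by rintro rfl; omega))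
      obtain ⟨f, hfG, hfA⟩ := Finset.exists_of_ssubset (hAG.ssubset_of_ne (by rintro rfl; omega))
      obtain ⟨p, fp, p1, p2, p3, p4⟩ := M.cover_in g.fA fF hAF heA heF
      obtain ⟨q, fq, q1, q2, q3, q4⟩ := M.cover_in g.fA fG hAG hfA hfG
      have hL : ∃ L, M.IsFlat L ∧ p ⊆ L ∧ L ⊆ B ∧ f ∈ L ∧ M.rk L ≤ M.rk A + 2 := by
        by_cases hf : f ∈ p
        · exact ⟨p, fp, subset_rfl, p2.trans hFB, hf, by omega⟩
        · obtain ⟨L, l1, l2, l3, l4, l5⟩ := M.cover_in fp g.fB (p2.trans hFB) hf (hGB hfG)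
          exact ⟨L, l1, l2, l3, l4, by omega⟩
      obtain ⟨L, fL, l2, l3, l4, l5⟩ := hL
      have hqL := M.cover_sub g.fA fq fL q1 q4 hfA q3 (p1.trans l2) l4
      have rpL := M.rk_le fp fL l2
      have lp := g.mem_link hσ hj fp p1 (p2.trans hFB) (by omega) (by omega)
      have lq := g.mem_link hσ hj fq q1 (q2.trans hGB) (by omega) (by omega)
      have lL := g.mem_link hσ hj fL (p1.trans l2) l3 (by omega) (by omega)
      rw [hcomp F hF p lp (Or.inr p2), hcomp p lp L lL (Or.inl l2), hcomp L lL q lq (Or.inr hqL),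
        hcomp q lq G hG (Or.inl q2)]
    · have hcm := hσ.card_miss
      have hd : M.fan.d = M.rk Finset.univ - 1 := rfl
      obtain ⟨j, hjm, hne⟩ := Finset.exists_mem_ne (s := M.miss σ) (by omega) (M.rk F)
      obtain ⟨A', B', g'⟩ := hσ.exists_gap hjm
      obtain ⟨H, fH, h4, h5, h6⟩ := M.between g'.fA g'.fB g'.sub j g'.rA.le g'.rB.le
      have lH : H ∈ M.fan.link σ := link_iff.2 ((g'.mem_iff hσ hjm h6).2 ⟨fH, h4, h5⟩)
      rw [mem_miss] at hjm
      have hcase : H ⊆ A ∨ B ⊆ H := by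
        rcases lt_or_gt_of_ne hne with h | h
        · left
          have : j ≤ M.rk A := by omega
          rcases g.A_mem with h0 | hA
          · rw [h0, M.rk_empty] at this; omega
          · exact link_sub lH hA (by omega)
        · right
          have : M.rk B ≤ j := by omega
          rcases g.B_mem with h0 | hB
          · rw [h0] at this; omega
          · exact link_sup lH hB (by omega)
      rcases hcase with h | h
      · rw [hcomp F hF H lH (Or.inr (h.trans hAF)), hcomp H lH G hG (Or.inl (h.trans hAG))]
      · rw [hcomp F hF H lH (Or.inl (hFB.trans h)), hcomp H lH G hG (Or.inr (hGB.trans h))]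
  intro F hF G hG
  rcases le_total (M.rk F) (M.rk G) with h | h
  · exact main F hF G hG h
  · exact (main G hG F hF h).symm

/-- two separate gaps -/
theorem base_two {σ : Finset (Finset E)} (hσ : M.Face σ) (hc : σ.card + 2 = M.fan.d) {i j : ℕ}
    (hij : i + 1 < j) (hm : ∀ k, k ∈ M.miss σ ↔ k = i ∨ k = j) : M.fan.Lor σ [] := by
  have him : i ∈ M.miss σ := (hm i).2 (Or.inl rfl)
  have hjm : j ∈ M.miss σ := (hm j).2 (Or.inr rfl)
  have hi1 := (mem_miss.1 him).1
  have hj1 := (mem_miss.1 hjm).1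
  obtain ⟨A₁, B₁, g₁⟩ := hσ.exists_gap him
  obtain ⟨A₂, B₂, g₂⟩ := hσ.exists_gap hjm
  have rA₁ := g₁.rk_A_eq hσ him (by rw [hm]; omega)
  have rB₁ := g₁.rk_B_eq hσ him (by rw [hm]; omega)
  have rA₂ := g₂.rk_A_eq hσ hjm (by rw [hm]; omega)
  have hB₁ : B₁ ∈ σ := by
    rcases g₁.B_mem with h | h
    · rw [h] at rB₁; omega
    · exact h
  set C₁ := M.cov A₁ B₁ with hC₁
  set C₂ := M.cov A₂ B₂ with hC₂
  have mC₁ : ∀ F, F ∈ C₁ ↔ F ∈ M.fan.link σ ∧ M.rk F = i := by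
    intro F
    rw [hC₁, mem_cov, link_iff]
    constructor
    · rintro ⟨h1, h2, h3, h4⟩
      exact ⟨(g₁.mem_iff hσ him (by omega)).2 ⟨h1, h2, h3⟩, by omega⟩
    · rintro ⟨h1, h2⟩
      obtain ⟨h3, h4, h5⟩ := (g₁.mem_iff hσ him h2).1 h1
      exact ⟨h3, h4, h5, by omega⟩
  have mC₂ : ∀ F, F ∈ C₂ ↔ F ∈ M.fan.link σ ∧ M.rk F = j := by
    intro F
    rw [hC₂, mem_cov, link_iff]
    constructor
    · rintro ⟨h1, h2, h3, h4⟩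
      exact ⟨(g₂.mem_iff hσ hjm (by omega)).2 ⟨h1, h2, h3⟩, by omega⟩
    · rintro ⟨h1, h2⟩
      obtain ⟨h3, h4, h5⟩ := (g₂.mem_iff hσ hjm h2).1 h1
      exact ⟨h3, h4, h5, by omega⟩
  have hlink : M.fan.link σ = C₁ ∪ C₂ := by
    ext F
    rw [Finset.mem_union, mC₁, mC₂]
    constructor
    · intro h
      rcases (hm _).1 (hσ.link_rk h) with h' | h'
      · exact Or.inl ⟨h, h'⟩
      · exact Or.inr ⟨h, h'⟩
    · rintro (h | h)
      · exact h.1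
      · exact h.1
  have hdisj : Disjoint C₁ C₂ := by
    rw [Finset.disjoint_left]
    intro F h1 h2
    have := ((mC₁ F).1 h1).2
    have := ((mC₂ F).1 h2).2
    omega
  have hadj : ∀ F ∈ C₁, ∀ G ∈ C₂, G ∈ M.fan.link (insert F σ) := by
    intro F hF G hG
    have h1 := (mC₁ F).1 hF
    have h2 := (mC₂ G).1 hG
    refine hσ.link_insert h1.1 h2.1 (by rintro rfl; omega) (Or.inl ?_)
    exact (link_sub h1.1 hB₁ (by omega)).trans (link_sup h2.1 hB₁ (by omega))
  have hl₁ : ∀ F ∈ C₁, M.fan.link (insert F σ) = C₂ := by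
    intro F hF
    have h1 := (mC₁ F).1 hF
    ext G
    refine ⟨fun hG => ?_, fun hG => hadj F hF G hG⟩
    have h2 := M.fan.link_insert_subset hG
    have h3 := (link_iff.1 h1.1).2.link_rk hG
    rw [mC₂]
    refine ⟨h2, ?_⟩
    rcases (hm _).1 (hσ.link_rk h2) with h | h
    · exact absurd (h1.2.trans h.symm) ((mem_miss.1 h3).2 F (Finset.mem_insert_self _ _))
    · exact h
  have hl₂ : ∀ F ∈ C₂, M.fan.link (insert F σ) = C₁ := by
    intro F hF
    have h1 := (mC₂ F).1 hF
    ext G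
    refine ⟨fun hG => ?_, fun hG => ?_⟩
    · have h2 := M.fan.link_insert_subset hG
      have h3 := (link_iff.1 h1.1).2.link_rk hG
      rw [mC₁]
      refine ⟨h2, ?_⟩
      rcases (hm _).1 (hσ.link_rk h2) with h | h
      · exact h
      · exact absurd (h1.2.trans h.symm) ((mem_miss.1 h3).2 F (Finset.mem_insert_self _ _))
    · exact (M.fan.link_swap.1 ⟨((mC₁ G).1 hG).1, hadj G hG F hF⟩).1
  let r : (Finset E → ℝ) → Finset E → ℝ := fun v => v - M.fan.proj σ v
  have hr0 : ∀ v, ∀ F ∈ σ, r v F = 0 := fun v F hF => by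
    simp [r, M.fan.proj_apply hσ v hF]
  have hdeg : ∀ v, ∀ F ∈ M.fan.link σ, ∀ C : Finset (Finset E), M.fan.link (insert F σ) = C →
      (∀ l ∈ lin E, (∀ F ∈ σ, l F = 0) → ∑ G ∈ C, l G = 0) →
      M.fan.deg [v] (insert F σ) = ∑ G ∈ C, r v G := by
    intro v F hF C hC hbal
    have hFf := M.fan.face_of_link hF
    rw [M.fan.deg_congr_lin (z := r v) (by simp only [r, sub_sub_cancel]; exact M.fan.proj_mem _ _)
      hFf (by rw [M.fan.card_insert_link hF]; simp; omega), M.fan.deg_cons, hC]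
    have := hbal (M.fan.proj (insert F σ) (r v)) (M.fan.proj_mem _ _) (fun G hG => by
      rw [M.fan.proj_apply hFf _ (Finset.mem_insert_of_mem hG), hr0 v G hG])
    simp only [Fan.deg, mul_one, Finset.sum_sub_distrib, this, sub_zero]
  have hQ : ∀ u v, M.fan.deg [u, v] σ = (∑ F ∈ C₁, r u F) * (∑ F ∈ C₂, r v F)
      + (∑ F ∈ C₂, r u F) * (∑ F ∈ C₁, r v F) := by
    intro u v
    rw [M.fan.deg_cons, hlink, Finset.sum_union hdisj, Finset.sum_mul, Finset.sum_mul]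
    congr 1
    · refine Finset.sum_congr rfl fun F hF => ?_
      rw [hdeg v F ((mC₁ F).1 hF).1 C₂ (hl₁ F hF) fun l hl h => g₂.sum_eq_zero hl h]
      rfl
    · refine Finset.sum_congr rfl fun F hF => ?_
      rw [hdeg v F ((mC₂ F).1 hF).1 C₁ (hl₂ F hF) fun l hl h => g₁.sum_eq_zero hl h]
      rfl
  intro u y _
  rw [hQ, hQ, hQ]
  set a := ∑ F ∈ C₁, r u F
  set b := ∑ F ∈ C₂, r u F
  set c := ∑ F ∈ C₁, r y F
  set e := ∑ F ∈ C₂, r y F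
  nlinarith [sq_nonneg (a * e - b * c)]

/-- one gap of rank three -/
theorem base_one {σ : Finset (Finset E)} (hσ : M.Face σ) (hc : σ.card + 2 = M.fan.d) {i : ℕ}
    (hm : ∀ k, k ∈ M.miss σ ↔ k = i ∨ k = i + 1) : M.fan.Lor σ [] := by
  classical
  have him : i ∈ M.miss σ := (hm i).2 (Or.inl rfl)
  have hjm : i + 1 ∈ M.miss σ := (hm _).2 (Or.inr rfl)
  have hi1 := (mem_miss.1 him).1
  have hj1 := mem_miss.1 hjm
  obtain ⟨A, B, g⟩ := hσ.exists_gap him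
  have rA := g.rk_A_eq hσ him (by rw [hm]; omega)
  have rB : M.rk B = i + 2 := by
    have h1 := g.rB
    have h2 : M.rk B ≠ i + 1 := by
      rcases g.B_mem with h | h
      · rw [h]; omega
      · exact hj1.2 B h
    have h3 := M.rk_le g.fB M.univ_flat (Finset.subset_univ _)
    by_cases h4 : i + 2 = M.rk Finset.univ
    · omega
    obtain ⟨S, hS, hr⟩ := exists_of_not_miss (M := M) (σ := σ) (j := i + 2) (by omega) (by omega)
      (by rw [hm]; omega)
    have := M.rk_le g.fB (hσ.flat hS) (g.B_le S hS (by omega))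
    omega
  have hAF : ∀ F ∈ M.fan.link σ, A ⊆ F := by
    intro F hF
    have := (hm _).1 (hσ.link_rk hF)
    rcases g.A_mem with rfl | hA
    · simp
    · exact link_sup hF hA (by omega)
  have hFB : ∀ F ∈ M.fan.link σ, F ⊆ B := by
    intro F hF
    have := (hm _).1 (hσ.link_rk hF)
    rcases g.B_mem with rfl | hB
    · simp
    · exact link_sub hF hB (by omega)
  have hσAB : ∀ S ∈ σ, (S ⊆ A ∧ M.rk S < i) ∨ (B ⊆ S ∧ i + 1 < M.rk S) := by
    intro S hS
    have h1 := hj1.2 S hS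
    rcases lt_or_gt_of_ne ((mem_miss.1 him).2 S hS) with h | h
    · exact Or.inl ⟨g.le_A S hS h, h⟩
    · exact Or.inr ⟨g.B_le S hS h, by omega⟩
  set P := M.cov A B with hP
  have mP : ∀ F, F ∈ P ↔ F ∈ M.fan.link σ ∧ M.rk F = i := by
    intro F
    rw [hP, mem_cov, link_iff]
    constructor
    · rintro ⟨h1, h2, h3, h4⟩
      exact ⟨(g.mem_iff hσ him (by omega)).2 ⟨h1, h2, h3⟩, by omega⟩
    · rintro ⟨h1, h2⟩
      obtain ⟨h3, h4, h5⟩ := (g.mem_iff hσ him h2).1 h1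
      exact ⟨h3, h4, h5, by omega⟩
  set L := (M.fan.link σ).filter (fun F => M.rk F = i + 1) with hL
  -- link of a line
  have hlinkL : ∀ F ∈ L, M.fan.link (insert F σ) = M.cov A F := by
    intro F hF
    rw [hL, Finset.mem_filter] at hF
    ext G
    rw [mem_cov]
    constructor
    · intro hG
      have h2 := M.fan.link_insert_subset hG
      have h3 := (link_iff.1 hF.1).2.link_rk hG
      have h4 : M.rk G = i := by
        rcases (hm _).1 (hσ.link_rk h2) with h | h
        · exact h
        · exact absurd (hF.2.trans h.symm) ((mem_miss.1 h3).2 F (Finset.mem_insert_self _ _))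
      exact ⟨link_flat hG, hAF G h2, link_sub hG (Finset.mem_insert_self _ _) (by omega), by omega⟩
    · rintro ⟨h1, h2, h3, h4⟩
      have hG := g.mem_link hσ him h1 h2 (h3.trans (hFB F hF.1)) (by omega) (by omega)
      exact hσ.link_insert hF.1 hG (by rintro rfl; omega) (Or.inr h3)
  have hLsum : ∀ w x : Finset E → ℝ, (∀ F ∈ σ, w F = 0) → (∀ F ∈ P, w F = 0) →
      M.fan.deg [w, x] σ = ∑ F ∈ L, w F * M.fan.deg [x] (insert F σ) := by
    intro w x h1 h2
    rw [M.fan.deg_vanish h1]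
    symm
    refine Finset.sum_subset (Finset.filter_subset _ _) fun F hF hFL => ?_
    rw [h2 F, zero_mul]
    rw [mP]
    refine ⟨hF, ?_⟩
    rcases (hm _).1 (hσ.link_rk hF) with h | h
    · exact h
    · exact absurd (by rw [hL, Finset.mem_filter]; exact ⟨hF, h⟩) hFL
  let z : E → Finset E → ℝ := fun e S => if (i ≤ M.rk S ∧ M.rk S ≤ i + 1) ∧ e ∈ S then 1 else 0
  have hzσ : ∀ e, ∀ S ∈ σ, z e S = 0 := by
    intro e S hS
    simp only [z]
    rw [if_neg]
    rintro ⟨h1, _⟩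
    rcases hσAB S hS with h | h <;> omega
  have hzl : ∀ e, ∀ S ∈ M.fan.link σ, z e S = al e S := by
    intro e S hS
    have := (hm _).1 (hσ.link_rk hS)
    have h2 : i ≤ M.rk S ∧ M.rk S ≤ i + 1 := by omega
    simp [z, al, h2]
  obtain ⟨e₀, he₀B, he₀A⟩ := Finset.exists_of_ssubset (g.sub.ssubset_of_ne (by rintro rfl; omega))
  have hcardL : ∀ F ∈ L, (insert F σ).card = σ.card + 1 := fun F hF =>
    M.fan.card_insert_link (Finset.mem_filter.1 hF).1
  have hzL : ∀ F ∈ L, M.fan.deg [z e₀] (insert F σ) = 0 := by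
    intro F hF
    have hF' := Finset.mem_filter.1 hF
    obtain ⟨f, hfB, hfF⟩ := Finset.exists_of_ssubset ((hFB F hF'.1).ssubset_of_ne
      (by rintro rfl; omega))
    have hfA : f ∉ A := fun h => hfF (hAF F hF'.1 h)
    have e1 : M.fan.deg [z e₀] (insert F σ) = M.fan.deg [z f + (al e₀ - al f)] (insert F σ) := by
      have hl : ∀ S ∈ M.fan.link σ, z e₀ S = (z f + (al e₀ - al f)) S := fun S hS => by
        simp [hzl _ S hS]
      refine M.fan.deg_congr_on ?_ ?_ _
      · intro S hS
        rcases Finset.mem_insert.1 hS with rfl | hS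
        · exact hl S hF'.1
        · simp only [Pi.add_apply, Pi.sub_apply, hzσ _ S hS, al]
          rcases hσAB S hS with h | h
          · rw [if_neg fun h' => he₀A (h.1 h'), if_neg fun h' => hfA (h.1 h')]; norm_num
          · rw [if_pos (h.1 he₀B), if_pos (h.1 hfB)]; norm_num
      · intro S hS
        exact hl S (M.fan.link_insert_subset hS)
    rw [e1, M.fan.deg_congr_lin (z := z f) (by rw [add_sub_cancel_left]; exact al_lin e₀ f)
      (M.fan.face_of_link hF'.1) (by rw [hcardL F hF]; simp; omega), M.fan.deg_vanish]
    · refine Finset.sum_eq_zero fun G hG => ?_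
      rw [hlinkL F hF, mem_cov] at hG
      have : z f G = 0 := by
        simp only [z]
        rw [if_neg]
        rintro ⟨_, h⟩
        exact hfF (hG.2.2.1 h)
      rw [this, zero_mul]
    · intro S hS
      rcases Finset.mem_insert.1 hS with rfl | hS
      · simp [z, hfF]
      · exact hzσ f S hS
  refine M.fan.lor_of_dir hσ (by simpa using hc) (z e₀) ?_
  intro w hw
  set w₁ := w - M.fan.proj σ w with hw₁
  have hw₁σ : ∀ F ∈ σ, w₁ F = 0 := fun F hF => by simp [hw₁, M.fan.proj_apply hσ w hF]
  set t := ∑ p ∈ P, w₁ p with ht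
  set v := w₁ - t • z e₀ with hv
  have hvσ : ∀ F ∈ σ, v F = 0 := fun F hF => by simp [hv, hw₁σ F hF, hzσ e₀ F hF]
  have hzP : ∑ p ∈ P, z e₀ p = 1 := by
    obtain ⟨p, p1, p2, p3, p4, p5⟩ := M.cover_in g.fA g.fB g.sub he₀A he₀B
    have hpP : p ∈ P := by rw [hP, mem_cov]; exact ⟨p1, p2, p3, p5⟩
    rw [Finset.sum_eq_single p]
    · rw [hzl _ p ((mP p).1 hpP).1]; simp [al, p4]
    · intro q hq hne
      rw [hzl _ q ((mP q).1 hq).1]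
      simp only [al]
      rw [if_neg]
      intro h
      rw [hP, mem_cov] at hq
      exact hne (M.cover_unique g.fA hq.1 p1 hq.2.1 hq.2.2.2 he₀A h p2 p5 p4)
    · exact fun h => absurd hpP h
  have hvP : ∑ p ∈ P, v p = 0 := by
    simp only [hv, Pi.sub_apply, Pi.smul_apply, smul_eq_mul, Finset.sum_sub_distrib,
      ← Finset.mul_sum, hzP]
    rw [← ht]; ring
  -- representatives
  have hrep : ∀ p ∈ P, ∃ e, e ∈ p ∧ e ∉ A := by
    intro p hp
    rw [hP, mem_cov] at hp
    obtain ⟨e, h1, h2⟩ := Finset.exists_of_ssubset (hp.2.1.ssubset_of_ne (by rintro rfl; omega))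
    exact ⟨e, h1, h2⟩
  have hrep' : ∀ p, ∃ e, p ∈ P → e ∈ p ∧ e ∉ A := by
    intro p
    by_cases hp : p ∈ P
    · obtain ⟨e, he⟩ := hrep p hp
      exact ⟨e, fun _ => he⟩
    · exact ⟨e₀, fun h => absurd h hp⟩
  choose rep hrepP using hrep'
  let c : Finset E → ℝ := fun S => ∑ p ∈ P, v p * al (rep p) S
  have hclin : c ∈ lin E := by
    refine ⟨fun e => ∑ p ∈ P, v p * (Pi.single (rep p) 1 : E → ℝ) e, ?_, fun S => ?_⟩
    · rw [Finset.sum_comm, ← hvP]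
      refine Finset.sum_congr rfl fun p _ => ?_
      rw [← Finset.mul_sum]; simp
    · simp only [c]
      rw [Finset.sum_comm]
      refine Finset.sum_congr rfl fun p _ => ?_
      rw [← Finset.mul_sum]; simp [al]
  have hcσ : ∀ S ∈ σ, c S = 0 := by
    intro S hS
    simp only [c]
    rcases hσAB S hS with h | h
    · refine Finset.sum_eq_zero fun p hp => ?_
      simp only [al]
      rw [if_neg fun h' => (hrepP p hp).2 (h.1 h'), mul_zero]
    · rw [← hvP]
      refine Finset.sum_congr rfl fun p hp => ?_
      simp only [al]
      rw [if_pos (h.1 (hFB p ((mP p).1 hp).1 (hrepP p hp).1)), mul_one]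
  have hcP : ∀ q ∈ P, c q = v q := by
    intro q hq
    simp only [c]
    rw [Finset.sum_eq_single q]
    · simp [al, (hrepP q hq).1]
    · intro p hp hne
      simp only [al]
      rw [if_neg, mul_zero]
      intro h
      have hp' := hp
      rw [hP, mem_cov] at hp' hq
      exact hne (M.cover_unique g.fA hp'.1 hq.1 hp'.2.1 hp'.2.2.2 (hrepP p hp).2 (hrepP p hp).1
        hq.2.1 hq.2.2.2 h)
    · exact fun h => absurd hq h
  set w₂ := v - c with hw₂
  have hw₂σ : ∀ F ∈ σ, w₂ F = 0 := fun F hF => by simp [hw₂, hvσ F hF, hcσ F hF]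
  have hw₂P : ∀ F ∈ P, w₂ F = 0 := fun F hF => by simp [hw₂, hcP F hF]
  have hdec : ∀ x, M.fan.deg [w, x] σ = t * M.fan.deg [z e₀, x] σ + M.fan.deg [w₂, x] σ := by
    intro x
    rw [← M.fan.deg_smul, ← M.fan.deg_add]
    refine M.fan.deg_congr_lin ?_ hσ (by simpa using hc)
    have : w - (t • z e₀ + w₂) = M.fan.proj σ w + c := by
      rw [hw₂, hv, hw₁]; abel
    rw [this]
    exact Submodule.add_mem _ (M.fan.proj_mem _ _) hclin
  have hsymm : ∀ x y, M.fan.deg [x, y] σ = M.fan.deg [y, x] σ := fun x y =>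
    M.fan.deg_perm (List.Perm.swap _ _ _) hσ (by simpa using hc)
  have hw₂z : M.fan.deg [w₂, z e₀] σ = 0 := by
    rw [hLsum _ _ hw₂σ hw₂P]
    exact Finset.sum_eq_zero fun F hF => by rw [hzL F hF, mul_zero]
  have hw₂w₂ : M.fan.deg [w₂, w₂] σ ≤ 0 := by
    rw [hLsum _ _ hw₂σ hw₂P]
    refine Finset.sum_nonpos fun F hF => ?_
    have hF' := Finset.mem_filter.1 hF
    have hFf := M.fan.face_of_link hF'.1
    have : M.fan.deg [w₂] (insert F σ) = - w₂ F := by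
      rw [M.fan.deg_cons, hlinkL F hF]
      set m := M.fan.proj (insert F σ) w₂ with hmdef
      have hml : m ∈ lin E := M.fan.proj_mem _ _
      have hmA : m A = 0 := g.lin_A hml fun S hS => by
        rw [hmdef, M.fan.proj_apply hFf _ (Finset.mem_insert_of_mem hS), hw₂σ S hS]
      have hmF : m F = w₂ F := by
        rw [hmdef, M.fan.proj_apply hFf _ (Finset.mem_insert_self _ _)]
      have hs := M.sum_cov_lin g.fA (link_flat hF'.1) (hAF F hF'.1) hml hmA
      rw [← hmF, ← hs, ← Finset.sum_neg_distrib]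
      refine Finset.sum_congr rfl fun G hG => ?_
      have hGP : G ∈ P := by
        rw [hP]
        rw [mem_cov] at hG ⊢
        exact ⟨hG.1, hG.2.1, hG.2.2.1.trans (hFB F hF'.1), hG.2.2.2⟩
      rw [hw₂P G hGP]
      simp [Fan.deg]
    rw [this]
    nlinarith [sq_nonneg (w₂ F)]
  rw [hdec, hw₂z] at hw
  rw [hdec, hsymm (z e₀) w, hdec, hw₂z, hsymm w₂ w, hdec, hsymm (z e₀) w₂, hw₂z, hw]
  simpa using hw₂w₂

theorem base (σ : Finset (Finset E)) (hσ : M.fan.Face σ) (hc : σ.card + 2 = M.fan.d) :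
    M.fan.Lor σ [] := by
  have hσ : M.Face σ := hσ
  have hcm := hσ.card_miss
  have hd : M.fan.d = M.rk Finset.univ - 1 := rfl
  obtain ⟨i, j, hne, hij⟩ := Finset.card_eq_two.1 (show (M.miss σ).card = 2 by omega)
  wlog hlt : i < j generalizing i j
  · exact this j i hne.symm (by rw [hij, Finset.pair_comm]) (by omega)
  have hm : ∀ k, k ∈ M.miss σ ↔ k = i ∨ k = j := by intro k; rw [hij]; simp
  by_cases h : j = i + 1
  · subst h
    exact base_one hσ hc hm
  · exact base_two hσ hc (by omega) hm

theorem face_empty : M.Face ∅ := ⟨by simp, by simp⟩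

theorem log_concave_aux [Nonempty E] (i : E) (a b : ℕ) (h : a + b + 2 = M.fan.d) :
    M.fan.deg (al i :: al i :: (List.replicate a (al i) ++ List.replicate b (be i))) ∅ *
      M.fan.deg (be i :: be i :: (List.replicate a (al i) ++ List.replicate b (be i))) ∅ ≤
    M.fan.deg (al i :: be i :: (List.replicate a (al i) ++ List.replicate b (be i))) ∅ ^ 2 := by
  refine M.fan.nef_log_concave base conn face_empty M.amp_ample (M.be_nef i) _ ?_ ?_
  · intro y hy
    rw [List.mem_append, List.mem_replicate, List.mem_replicate] at hy
    rcases hy with h | h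
    · rw [h.2]; exact M.al_nef i
    · rw [h.2]; exact M.be_nef i
  · simp; omega

end Flats
end HRW

namespace HRW
namespace Flats
variable {E : Type*} [Fintype E] [DecidableEq E] (M : Flats E)

open Classical in
/-- Moebius function of the lattice of flats -/
noncomputable def mu (F : Finset E) : ℤ :=
  if F = ∅ then 1 else - ∑ G : {G : Finset E // G ⊂ F}, if M.IsFlat G.1 then mu G.1 else 0
termination_by F.card
decreasing_by exact Finset.card_lt_card G.2

open Classical in
noncomputable def fl (p : Finset E → Prop) : Finset (Finset E) :=
  Finset.univ.filter fun F => M.IsFlat F ∧ p F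

theorem mem_fl {p : Finset E → Prop} {F : Finset E} : F ∈ M.fl p ↔ M.IsFlat F ∧ p F := by
  simp [fl]

theorem mu_empty : M.mu ∅ = 1 := by rw [mu]; simp

theorem mu_sum {F : Finset E} (hF : M.IsFlat F) :
    ∑ G ∈ M.fl (fun G => G ⊆ F), M.mu G = if F = ∅ then 1 else 0 := by
  classical
  by_cases h : F = ∅
  · subst h
    have : M.fl (fun G => G ⊆ ∅) = {∅} := by
      ext G; simp only [mem_fl, Finset.subset_empty, Finset.mem_singleton]
      exact ⟨fun h => h.2, fun h => ⟨h ▸ M.empty_flat, h⟩⟩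
    rw [this]; simp [mu_empty]
  · rw [if_neg h]
    have h1 : M.fl (fun G => G ⊆ F) = insert F (M.fl fun G => G ⊂ F) := by
      ext G
      simp only [mem_fl, Finset.mem_insert, subset_iff_ssubset_or_eq]
      constructor
      · rintro ⟨a, b | b⟩
        · exact Or.inr ⟨a, b⟩
        · exact Or.inl b
      · rintro (rfl | ⟨a, b⟩)
        · exact ⟨hF, Or.inr rfl⟩
        · exact ⟨a, Or.inl b⟩
    rw [h1, Finset.sum_insert (by simp [mem_fl]), mu, if_neg h]
    have : ∑ G : {G : Finset E // G ⊂ F}, (if M.IsFlat G.1 then M.mu G.1 else 0)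
        = ∑ G ∈ M.fl (fun G => G ⊂ F), M.mu G := by
      rw [← Finset.sum_subtype (Finset.univ.filter fun G => G ⊂ F) (by simp)
        (fun G => if M.IsFlat G then M.mu G else 0), Finset.sum_filter, fl, Finset.sum_filter]
      refine Finset.sum_congr rfl fun G _ => ?_
      by_cases a : G ⊂ F <;> by_cases b : M.IsFlat G <;> simp [a, b]
    rw [this]; ring

/-- lower covers avoiding `i` -/
noncomputable def low (i : E) (F : Finset E) : Finset (Finset E) :=
  M.fl fun H => H ⊆ F ∧ i ∉ H ∧ M.rk H + 1 = M.rk F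

theorem weisner (i : E) : ∀ n, ∀ F : Finset E, F.card = n → M.IsFlat F → i ∈ F →
    M.mu F + ∑ H ∈ M.low i F, M.mu H = 0 := by
  classical
  intro n
  induction n using Nat.strong_induction_on with
  | _ n ih =>
  intro F hn hF hi
  have hne : F ≠ ∅ := by rintro rfl; simp at hi
  have h0 := M.mu_sum hF
  rw [if_neg hne] at h0
  let P := M.fl fun G => G ⊆ F ∧ i ∈ G
  let Q := M.fl fun G => G ⊆ F ∧ i ∉ G
  have hPQ : ∑ G ∈ M.fl (fun G => G ⊆ F), M.mu G = ∑ G ∈ P, M.mu G + ∑ G ∈ Q, M.mu G := by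
    rw [← Finset.sum_filter_add_sum_filter_not _ (fun G => i ∈ G)]
    congr 1
    · refine Finset.sum_congr ?_ fun _ _ => rfl
      ext G; simp [P, mem_fl, and_assoc]
    · refine Finset.sum_congr ?_ fun _ _ => rfl
      ext G; simp [Q, mem_fl, and_assoc]
  have hQ : ∑ K ∈ P, ∑ H ∈ M.low i K, M.mu H = ∑ G ∈ Q, M.mu G := by
    rw [← Finset.sum_biUnion]
    · refine Finset.sum_congr ?_ fun _ _ => rfl
      ext G
      simp only [Finset.mem_biUnion, P, Q, low, mem_fl]
      constructor
      · rintro ⟨K, ⟨_, k1, k2⟩, g1, g2, g3, g4⟩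
        exact ⟨g1, g2.trans k1, g3⟩
      · rintro ⟨g1, g2, g3⟩
        obtain ⟨K, hK, k1, k2, k3, k4⟩ := M.cover_in g1 hF g2 g3 hi
        exact ⟨K, ⟨hK, k2, k3⟩, g1, k1, g3, k4.symm⟩
    · intro K hK L hL hne
      rw [Function.onFun, Finset.disjoint_left]
      intro G hG hG'
      simp only [Finset.mem_coe, P, low, mem_fl] at hK hL hG hG'
      exact hne (M.cover_unique hG.1 hK.1 hL.1 hG.2.1 hG.2.2.2.symm hG.2.2.1 hK.2.2 hG'.2.1
        hG'.2.2.2.symm hL.2.2)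
  have hT : ∑ K ∈ P, (M.mu K + ∑ H ∈ M.low i K, M.mu H) = 0 := by
    rw [Finset.sum_add_distrib, hQ, ← hPQ, h0]
  rw [Finset.sum_eq_single F] at hT
  · exact hT
  · intro K hK hKF
    simp only [P, mem_fl] at hK
    exact ih _ (by rw [← hn]; exact Finset.card_lt_card (hK.2.1.ssubset_of_ne hKF)) K rfl hK.1 hK.2.2
  · intro h
    exact absurd (by simp [P, mem_fl, hF, hi]) h

noncomputable def w (F : Finset E) : ℝ := (-1) ^ M.rk F * M.mu F

theorem w_empty : M.w ∅ = 1 := by simp [w, M.rk_empty, mu_empty]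

theorem w_eq {i : E} {F : Finset E} (hF : M.IsFlat F) (hi : i ∈ F) :
    M.w F = ∑ H ∈ M.low i F, M.w H := by
  have h := M.weisner i _ F rfl hF hi
  have h' : (M.mu F : ℝ) = - ∑ H ∈ M.low i F, (M.mu H : ℝ) := by
    have : ((M.mu F + ∑ H ∈ M.low i F, M.mu H : ℤ) : ℝ) = 0 := by rw [h]; simp
    push_cast at this; linarith
  rw [w, h', mul_neg, Finset.mul_sum, ← Finset.sum_neg_distrib]
  refine Finset.sum_congr rfl fun H hH => ?_
  rw [low, mem_fl] at hH
  rw [w, ← hH.2.2.2, pow_succ]; ring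

theorem w_pos : ∀ n, ∀ F : Finset E, F.card = n → M.IsFlat F → 0 < M.w F := by
  intro n
  induction n using Nat.strong_induction_on with
  | _ n ih =>
  intro F hn hF
  rcases F.eq_empty_or_nonempty with rfl | ⟨i, hi⟩
  · rw [w_empty]; norm_num
  rw [M.w_eq hF hi]
  refine Finset.sum_pos ?_ ?_
  · intro H hH
    rw [low, mem_fl] at hH
    refine ih _ ?_ H rfl hH.1
    rw [← hn]
    exact Finset.card_lt_card (hH.2.1.ssubset_of_ne (by rintro rfl; omega))
  · have h1 := M.rk_lt M.empty_flat hF (Finset.empty_ssubset.2 ⟨i, hi⟩)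
    rw [M.rk_empty] at h1
    obtain ⟨H, h2, _, h3, h4, h5⟩ := M.avoid M.empty_flat hF (by simp) (by simp) hi (M.rk F - 1)
      (by rw [M.rk_empty]; omega) (by omega)
    exact ⟨H, by rw [low, mem_fl]; exact ⟨h2, h3, h5, by omega⟩⟩

theorem w_one {F : Finset E} (hF : M.IsFlat F) (h : M.rk F = 1) : M.w F = 1 := by
  have hne : F.Nonempty := by
    rw [Finset.nonempty_iff_ne_empty]; rintro rfl; rw [M.rk_empty] at h; omega
  obtain ⟨i, hi⟩ := hne
  rw [M.w_eq hF hi, ← M.w_empty]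
  have : M.low i F = {∅} := by
    ext H
    rw [low, mem_fl, Finset.mem_singleton]
    constructor
    · rintro ⟨h1, h2, h3, h4⟩
      exact (M.eq_of_rk M.empty_flat h1 (by simp) (by rw [M.rk_empty]; omega)).symm
    · rintro rfl
      exact ⟨M.empty_flat, by simp, by simp, by rw [M.rk_empty, h]⟩
  rw [this, Finset.sum_singleton]

theorem d_eq : M.fan.d = M.rk Finset.univ - 1 := rfl

variable {M} in
theorem Face.full {σ : Finset (Finset E)} (hσ : M.Face σ) {lo hi : ℕ}
    (h : ∀ S ∈ σ, lo ≤ M.rk S ∧ M.rk S < hi) (hc : hi ≤ lo + σ.card) {j : ℕ} (h1 : lo ≤ j)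
    (h2 : j < hi) : ∃ S ∈ σ, M.rk S = j := by
  have hsub : σ.image M.rk ⊆ Finset.Ico lo hi := by
    intro j hj
    obtain ⟨F, hF, rfl⟩ := Finset.mem_image.1 hj
    exact Finset.mem_Ico.2 (h F hF)
  have hcard : (σ.image M.rk).card = σ.card :=
    Finset.card_image_of_injOn fun F hF G hG h => hσ.rk_inj hF hG h
  have := Finset.eq_of_subset_of_card_le hsub (by rw [hcard, Nat.card_Ico]; omega)
  have hj : j ∈ σ.image M.rk := by rw [this, Finset.mem_Ico]; exact ⟨h1, h2⟩
  simpa using hj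

variable {M} in
theorem Face.min_rk {σ : Finset (Finset E)} (hσ : M.Face σ) {lo hi : ℕ} {F : Finset E}
    (hF : F ∈ σ) (hmin : ∀ S ∈ σ, F ⊆ S)
    (h : ∀ S ∈ σ, lo ≤ M.rk S ∧ M.rk S < hi) (hc : hi ≤ lo + σ.card) : M.rk F = lo := by
  obtain ⟨S, hS, hr⟩ := hσ.full h hc le_rfl (by have := h F hF; omega)
  have := M.rk_le (hσ.flat hF) (hσ.flat hS) (hmin S hS)
  have := h F hF
  omega

open Classical in
theorem deg_formula_be [Nonempty E] (i : E) (b : ℕ) : ∀ (σ : Finset (Finset E)) (F : Finset E),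
    M.Face σ → F ∈ σ → (∀ S ∈ σ, F ⊆ S) → σ.card + b = M.fan.d →
    M.fan.deg (List.replicate b (be i)) σ = if ∀ S ∈ σ, b + 1 ≤ M.rk S then M.w F else 0 := by
  induction b with
  | zero =>
    intro σ F hσ hF hmin hc
    have hp : ∀ S ∈ σ, 0 + 1 ≤ M.rk S := fun S hS => by have := hσ.rk_pos hS; omega
    rw [if_pos hp, M.w_one (hσ.flat hF)]
    · rfl
    · refine hσ.min_rk hF hmin (lo := 1) (hi := M.rk Finset.univ) (fun S hS => ⟨hσ.rk_pos hS, hσ.rk_lt_top hS⟩) ?_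
      rw [d_eq] at hc
      omega
  | succ b ih =>
    intro σ F hσ hF hmin hc
    have hd := M.d_eq
    obtain ⟨j, hj⟩ := Finset.nonempty_iff_ne_empty.2 (hσ.1 F hF).2.1
    rw [List.replicate_succ, M.fan.deg_congr_lin (z := be j) (be_lin i j) hσ (by simp; omega),
      M.fan.deg_vanish (fun S hS => by rw [be, if_pos (hmin S hS hj)])]
    have key : ∀ G ∈ M.fan.link σ, be j G * M.fan.deg (List.replicate b (be i)) (insert G σ) =
        if (∀ S ∈ σ, b + 1 + 1 ≤ M.rk S) ∧ G ∈ M.low j F then M.w G else 0 := by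
      intro G hG
      have hG' := M.fan.mem_link.1 hG
      have hf : M.Face (insert G σ) := hG'.2
      have hGm := Finset.mem_insert_self G σ
      have hcard := M.fan.card_insert_link hG
      by_cases hjG : j ∈ G
      · rw [be, if_pos hjG, if_neg (by simp [low, mem_fl, hjG]), zero_mul]
      have hlt : ∀ S ∈ σ, G ⊆ S := by
        intro S hS
        rcases hf.2 G hGm S (Finset.mem_insert_of_mem hS) with h | h
        · exact h
        · exact absurd (h (hmin S hS hj)) hjG
      have hltr : ∀ S ∈ σ, M.rk G < M.rk S := fun S hS =>
        M.rk_lt (hf.flat hGm) (hσ.flat hS) ((hlt S hS).ssubset_of_ne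
          (by rintro rfl; exact hG'.1 hS))
      rw [be, if_neg hjG, one_mul, ih (insert G σ) G hf hGm (by simpa using hlt) (by omega)]
      congr 1
      rw [eq_iff_iff]
      constructor
      · intro h
        have h1 : ∀ S ∈ σ, b + 1 + 1 ≤ M.rk S := fun S hS => by
          have := hltr S hS; have := h G hGm; omega
        refine ⟨h1, ?_⟩
        have h2 := hσ.min_rk hF hmin (lo := b + 1 + 1) (hi := M.rk Finset.univ)
          (fun S hS => ⟨h1 S hS, hσ.rk_lt_top hS⟩) (by omega)
        have h3 := hltr F hF
        have h4 := h G hGm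
        rw [low, mem_fl]
        exact ⟨hf.flat hGm, hlt F hF, hjG, by omega⟩
      · rintro ⟨h1, h2⟩ S hS
        rw [low, mem_fl] at h2
        rcases Finset.mem_insert.1 hS with rfl | hS
        · have := h1 F hF; omega
        · have := h1 S hS; omega
    rw [Finset.sum_congr rfl key]
    by_cases hOK : ∀ S ∈ σ, b + 1 + 1 ≤ M.rk S
    · rw [if_pos hOK, M.w_eq (hσ.flat hF) hj, ← Finset.sum_filter]
      refine Finset.sum_congr ?_ fun _ _ => rfl
      ext G
      simp only [Finset.mem_filter, and_iff_right hOK]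
      refine ⟨fun h => h.2, fun h => ⟨?_, h⟩⟩
      rw [low, mem_fl] at h
      have := hOK F hF
      have := hσ.rk_lt_top hF
      refine M.fan.mem_link.2 ⟨fun hm => h.2.2.1 (hmin G hm hj), hσ.insert_iff.2 ⟨⟨h.1, ?_, ?_⟩, ?_⟩⟩
      · rintro rfl; rw [M.rk_empty] at h; omega
      · rintro rfl; omega
      · exact fun S hS => Or.inl (h.2.1.trans (hmin S hS))
    · rw [if_neg hOK]
      exact Finset.sum_eq_zero fun G _ => if_neg fun h => hOK h.1

open Classical in
theorem deg_formula [Nonempty E] (i : E) (b a : ℕ) : ∀ (σ : Finset (Finset E)) (F : Finset E),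
    M.Face σ → F ∈ σ → (∀ S ∈ σ, F ⊆ S) → σ.card + a + b = M.fan.d →
    M.fan.deg (List.replicate a (al i) ++ List.replicate b (be i)) σ =
      if ∀ S ∈ σ, b + 1 ≤ M.rk S ∧ M.rk S + a ≤ M.fan.d then M.w F else 0 := by
  induction a with
  | zero =>
    intro σ F hσ hF hmin hc
    rw [List.replicate_zero, List.nil_append, M.deg_formula_be i b σ F hσ hF hmin (by omega)]
    congr 1
    rw [eq_iff_iff]
    refine ⟨fun h S hS => ⟨h S hS, ?_⟩, fun h S hS => (h S hS).1⟩
    have := hσ.rk_lt_top hS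
    rw [d_eq]; omega
  | succ a ih =>
    intro σ F hσ hF hmin hc
    have hd := M.d_eq
    obtain ⟨j, hj⟩ := hσ.exists_notMem
    rw [List.replicate_succ, List.cons_append, M.fan.deg_congr_lin (z := al j) (al_lin i j) hσ
      (by simp; omega), M.fan.deg_vanish (fun S hS => by rw [al, if_neg (hj S hS)])]
    have hsub : ∀ G ∈ M.fan.link σ, j ∈ G → ∀ S ∈ σ, S ⊆ G ∧ M.rk S < M.rk G := by
      intro G hG hjG S hS
      have hG' := M.fan.mem_link.1 hG
      have hf : M.Face (insert G σ) := hG'.2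
      have hGm := Finset.mem_insert_self G σ
      have h1 : S ⊆ G := by
        rcases hf.2 G hGm S (Finset.mem_insert_of_mem hS) with h | h
        · exact absurd (h hjG) (hj S hS)
        · exact h
      exact ⟨h1, M.rk_lt (hσ.flat hS) (hf.flat hGm) (h1.ssubset_of_ne
          (by rintro rfl; exact hG'.1 hS))⟩
    have key : ∀ G ∈ M.fan.link σ, al j G * M.fan.deg (List.replicate a (al i) ++
        List.replicate b (be i)) (insert G σ) =
        if (∀ S ∈ σ, b + 1 ≤ M.rk S ∧ M.rk S + (a + 1) ≤ M.fan.d) ∧ j ∈ G ∧ M.rk G + a = M.fan.d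
          then M.w F else 0 := by
      intro G hG
      have hG' := M.fan.mem_link.1 hG
      have hf : M.Face (insert G σ) := hG'.2
      have hGm := Finset.mem_insert_self G σ
      have hcard := M.fan.card_insert_link hG
      by_cases hjG : j ∈ G
      swap
      · rw [al, if_neg hjG, if_neg (by simp [hjG]), zero_mul]
      have hs := hsub G hG hjG
      rw [al, if_pos hjG, one_mul, ih (insert G σ) F hf (Finset.mem_insert_of_mem hF) (by
        intro S hS
        rcases Finset.mem_insert.1 hS with rfl | hS
        · exact (hs F hF).1
        · exact hmin S hS) (by omega)]
      congr 1
      rw [eq_iff_iff]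
      constructor
      · intro h
        have h1 : ∀ S ∈ σ, b + 1 ≤ M.rk S ∧ M.rk S + (a + 1) ≤ M.fan.d := fun S hS => by
          have := hs S hS; have := h G hGm; have := h S (Finset.mem_insert_of_mem hS); omega
        refine ⟨h1, hjG, ?_⟩
        have := h G hGm
        obtain ⟨S, hS, hr⟩ := hf.full (lo := b + 1) (hi := M.fan.d - a + 1)
          (fun S hS => by have := h S hS; omega) (by omega) (j := M.fan.d - a) (by omega) (by omega)
        have h3 : M.rk S ≤ M.rk G := by
          rcases Finset.mem_insert.1 hS with rfl | hS
          · exact le_rfl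
          · exact (hs S hS).2.le
        omega
      · rintro ⟨h1, _, h2⟩ S hS
        rcases Finset.mem_insert.1 hS with rfl | hS
        · have := h1 F hF; have := hs F hF; omega
        · have := h1 S hS; omega
    rw [Finset.sum_congr rfl key]
    by_cases hOK : ∀ S ∈ σ, b + 1 ≤ M.rk S ∧ M.rk S + (a + 1) ≤ M.fan.d
    · rw [if_pos hOK]
      have hFO := hOK F hF
      obtain ⟨T, hT, hTr⟩ := hσ.full (lo := b + 1) (hi := M.fan.d - a)
          (fun S hS => by have := hOK S hS; omega) (by omega) (j := M.fan.d - a - 1)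
          (by omega) (by omega)
      have hTmax : ∀ S ∈ σ, S ⊆ T := fun S hS => hσ.sub_of_rk_le hS hT (by
        have := hOK S hS; omega)
      obtain ⟨C, hC, c1, c2, c3⟩ := M.cover (hσ.flat hT) j (hj T hT)
      have hCl : C ∈ M.fan.link σ := by
        refine M.fan.mem_link.2 ⟨fun hm => hj C hm c2, hσ.insert_iff.2 ⟨⟨hC, ?_, ?_⟩, ?_⟩⟩
        · rintro rfl; simp at c2
        · rintro rfl; omega
        · exact fun S hS => Or.inr ((hTmax S hS).trans c1)
      rw [Finset.sum_eq_single C]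
      · rw [if_pos ⟨hOK, c2, by omega⟩]
      · intro G hG hne
        rw [if_neg]
        rintro ⟨_, g1, g2⟩
        have hG' := M.fan.mem_link.1 hG
        have hf : M.Face (insert G σ) := hG'.2
        exact hne (M.cover_unique (hσ.flat hT) (hf.flat (Finset.mem_insert_self G σ)) hC
          (hsub G hG g1 T hT).1 (by omega) (hj T hT) g1 c1 c3 c2)
      · exact fun h => absurd hCl h
    · rw [if_neg hOK]
      exact Finset.sum_eq_zero fun G _ => if_neg fun h => hOK h.1

/-- reduced Whitney numbers -/
noncomputable def mm (i : E) (k : ℕ) : ℝ := ∑ F ∈ M.fl (fun F => i ∉ F ∧ M.rk F = k), M.w F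

theorem mm_nonneg (i : E) (k : ℕ) : 0 ≤ M.mm i k :=
  Finset.sum_nonneg fun F hF => (M.w_pos _ F rfl (M.mem_fl.1 hF).1).le

theorem mm_pos (i : E) (k : ℕ) (hk : k < M.rk Finset.univ) : 0 < M.mm i k := by
  refine Finset.sum_pos (fun F hF => M.w_pos _ F rfl (M.mem_fl.1 hF).1) ?_
  obtain ⟨H, h2, _, h3, h4, h5⟩ := M.avoid M.empty_flat M.univ_flat (by simp) (by simp)
    (Finset.mem_univ i) k (by rw [M.rk_empty]; omega) hk
  exact ⟨H, M.mem_fl.2 ⟨h2, h5, h4⟩⟩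

theorem mm_zero_of_ge (i : E) (k : ℕ) (hk : M.rk Finset.univ ≤ k) : M.mm i k = 0 := by
  refine Finset.sum_eq_zero fun F hF => ?_
  rw [mem_fl] at hF
  have := M.rk_lt hF.1 M.univ_flat (Finset.ssubset_univ_iff.2 (by rintro rfl; simp at hF))
  omega

theorem mm_zero (i : E) : M.mm i 0 = 1 := by
  have : M.fl (fun F => i ∉ F ∧ M.rk F = 0) = {∅} := by
    ext H
    rw [mem_fl, Finset.mem_singleton]
    constructor
    · rintro ⟨h1, h2, h3⟩
      exact (M.eq_of_rk M.empty_flat h1 (by simp) (by rw [M.rk_empty]; omega)).symm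
    · rintro rfl
      exact ⟨M.empty_flat, by simp, M.rk_empty⟩
  rw [mm, this, Finset.sum_singleton, w_empty]

theorem rk_univ_pos (i : E) : 0 < M.rk Finset.univ := by
  have := M.rk_lt M.empty_flat M.univ_flat (Finset.empty_ssubset.2 ⟨i, Finset.mem_univ i⟩)
  omega

theorem deg_mm [Nonempty E] (i : E) (a b : ℕ) (h : a + b = M.fan.d) :
    M.fan.deg (List.replicate a (al i) ++ List.replicate b (be i)) ∅ = M.mm i b := by
  classical
  have hd := M.d_eq
  have hpos := M.rk_univ_pos i
  have hlink : ∀ F, F ∈ M.fan.link ∅ ↔ M.IsFlat F ∧ F ≠ ∅ ∧ F ≠ Finset.univ := by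
    intro F
    rw [M.fan.mem_link]
    have h0 : M.Face ∅ := ⟨by simp, by simp⟩
    have := h0.insert_iff (F := F)
    simp only [Finset.notMem_empty, not_false_eq_true, true_and, false_implies, implies_true,
      and_true] at this ⊢
    exact this
  have hform : ∀ a b, a + b + 1 = M.fan.d → ∀ F ∈ M.fan.link ∅,
      M.fan.deg (List.replicate a (al i) ++ List.replicate b (be i)) (insert F ∅) =
      if M.rk F = b + 1 then M.w F else 0 := by
    intro a b h F hF
    rw [M.deg_formula i b a (insert F ∅) F (M.fan.face_of_link hF) (by simp) (by simp)
      (by simp; omega)]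
    congr 1
    rw [eq_iff_iff]
    simp
    omega
  cases b with
  | succ b =>
    have hp : (List.replicate a (al i) ++ List.replicate (b + 1) (be i)).Perm
        (be i :: (List.replicate a (al i) ++ List.replicate b (be i))) := by
      rw [List.replicate_succ]; exact List.perm_middle
    rw [M.fan.deg_perm hp M.face_empty (by simp; omega), M.fan.deg_vanish (by simp)]
    rw [Finset.sum_congr rfl fun F hF => by rw [hform a b (by omega) F hF], mm]
    have : M.fl (fun F => i ∉ F ∧ M.rk F = b + 1) =
        (M.fan.link ∅).filter fun F => i ∉ F ∧ M.rk F = b + 1 := by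
      ext F
      simp only [mem_fl, Finset.mem_filter, hlink]
      constructor
      · rintro ⟨h1, h2, h3⟩
        refine ⟨⟨h1, ?_, ?_⟩, h2, h3⟩
        · rintro rfl; rw [M.rk_empty] at h3; omega
        · rintro rfl; simp at h2
      · rintro ⟨⟨h1, _⟩, h2⟩
        exact ⟨h1, h2⟩
    rw [this, Finset.sum_filter]
    refine Finset.sum_congr rfl fun F _ => ?_
    by_cases h1 : i ∈ F <;> by_cases h2 : M.rk F = b + 1 <;> simp [be, h1, h2]
  | zero =>
    rw [mm_zero]
    cases a with
    | zero => rfl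
    | succ a =>
      rw [List.replicate_succ, List.cons_append, M.fan.deg_vanish (by simp)]
      rw [Finset.sum_congr rfl fun F hF => by rw [hform a 0 (by omega) F hF]]
      obtain ⟨C, hC, c1, c2, c3⟩ := M.cover M.empty_flat i (by simp)
      rw [M.rk_empty] at c3
      rw [Finset.sum_eq_single C]
      · simp [al, c2, c3, M.w_one hC]
      · intro F hF hne
        by_cases h1 : i ∈ F <;> by_cases h2 : M.rk F = 1 <;> simp [al, h1, h2]
        exact absurd (M.cover_unique M.empty_flat ((hlink F).1 hF).1 hC (by simp)
          (by rw [M.rk_empty, h2]) (by simp) h1 c1 (by rw [M.rk_empty, c3]) c2) hne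
      · intro hn
        refine absurd ((hlink C).2 ⟨hC, ?_, ?_⟩) hn
        · rintro rfl; simp at c2
        · rintro rfl; omega

theorem mm_lc [Nonempty E] (i : E) (k : ℕ) : M.mm i k * M.mm i (k + 2) ≤ M.mm i (k + 1) ^ 2 := by
  by_cases h : M.rk Finset.univ ≤ k + 2
  · rw [M.mm_zero_of_ge i (k + 2) h, mul_zero]; positivity
  have hd := M.d_eq
  obtain ⟨a, ha⟩ : ∃ a, a + k + 2 = M.fan.d := ⟨M.fan.d - k - 2, by omega⟩
  have := M.log_concave_aux i a k ha
  have e1 := M.deg_mm i (a + 2) k (by omega)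
  have e2 := M.deg_mm i (a + 1) (k + 1) (by omega)
  have e3 := M.deg_mm i a (k + 2) (by omega)
  have p2 : (List.replicate (a + 1) (al i) ++ List.replicate (k + 1) (be i)).Perm
      (al i :: be i :: (List.replicate a (al i) ++ List.replicate k (be i))) := by
    rw [List.replicate_succ, List.replicate_succ, List.cons_append]
    exact List.Perm.cons _ List.perm_middle
  have p3 : (List.replicate a (al i) ++ List.replicate (k + 2) (be i)).Perm
      (be i :: be i :: (List.replicate a (al i) ++ List.replicate k (be i))) := by
    rw [List.replicate_succ, List.replicate_succ]
    exact List.perm_middle.trans (List.Perm.cons _ List.perm_middle)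
  rw [M.fan.deg_perm p2 M.face_empty (by simp; omega)] at e2
  rw [M.fan.deg_perm p3 M.face_empty (by simp; omega)] at e3
  rw [← e1, ← e2, ← e3]
  exact this

/-- Whitney numbers -/
noncomputable def W (k : ℕ) : ℝ := ∑ F ∈ M.fl (fun F => M.rk F = k), M.w F

theorem W_zero : M.W 0 = 1 := by
  have : M.fl (fun F => M.rk F = 0) = {∅} := by
    ext H
    rw [mem_fl, Finset.mem_singleton]
    constructor
    · rintro ⟨h1, h3⟩
      exact (M.eq_of_rk M.empty_flat h1 (by simp) (by rw [M.rk_empty]; omega)).symm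
    · rintro rfl
      exact ⟨M.empty_flat, M.rk_empty⟩
  rw [W, this, Finset.sum_singleton, w_empty]

theorem W_succ (i : E) (k : ℕ) : M.W (k + 1) = M.mm i (k + 1) + M.mm i k := by
  classical
  have hQ : ∑ K ∈ M.fl (fun F => i ∈ F ∧ M.rk F = k + 1), M.w K = M.mm i k := by
    rw [Finset.sum_congr rfl fun K hK => M.w_eq (M.mem_fl.1 hK).1 (M.mem_fl.1 hK).2.1,
      ← Finset.sum_biUnion]
    · refine Finset.sum_congr ?_ fun _ _ => rfl
      ext G
      simp only [Finset.mem_biUnion, low, mem_fl]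
      constructor
      · rintro ⟨K, ⟨_, k1, k2⟩, g1, g2, g3, g4⟩
        exact ⟨g1, g3, by omega⟩
      · rintro ⟨g1, g2, g3⟩
        obtain ⟨K, hK, k1, k2, k3⟩ := M.cover g1 i g2
        exact ⟨K, ⟨hK, k2, by omega⟩, g1, k1, g2, k3.symm⟩
    · intro K hK L hL hne
      rw [Function.onFun, Finset.disjoint_left]
      intro G hG hG'
      simp only [Finset.mem_coe, low, mem_fl] at hK hL hG hG'
      exact hne (M.cover_unique hG.1 hK.1 hL.1 hG.2.1 hG.2.2.2.symm hG.2.2.1 hK.2.1 hG'.2.1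
        hG'.2.2.2.symm hL.2.1)
  rw [← hQ, W, mm, ← Finset.sum_filter_add_sum_filter_not _ (fun G => i ∉ G)]
  congr 1
  · refine Finset.sum_congr ?_ fun _ _ => rfl
    ext G; simp only [mem_fl, Finset.mem_filter]; tauto
  · refine Finset.sum_congr ?_ fun _ _ => rfl
    ext G; simp only [mem_fl, Finset.mem_filter]; tauto

theorem W_pos (k : ℕ) (hk : k ≤ M.rk Finset.univ) : 0 < M.W k := by
  refine Finset.sum_pos (fun F hF => M.w_pos _ F rfl (M.mem_fl.1 hF).1) ?_
  obtain ⟨H, h2, _, h3, h4⟩ := M.between M.empty_flat M.univ_flat (by simp) k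
    (by rw [M.rk_empty]; omega) hk
  exact ⟨H, M.mem_fl.2 ⟨h2, h4⟩⟩

theorem W_gt (k : ℕ) (hk : M.rk Finset.univ < k) : M.W k = 0 := by
  refine Finset.sum_eq_zero fun F hF => ?_
  rw [mem_fl] at hF
  have := M.rk_le hF.1 M.univ_flat (by simp)
  omega

theorem mm_lc' [Nonempty E] (i : E) (k : ℕ) :
    M.mm i k * M.mm i (k + 3) ≤ M.mm i (k + 1) * M.mm i (k + 2) := by
  by_cases h : M.rk Finset.univ ≤ k + 3
  · rw [M.mm_zero_of_ge i (k + 3) h, mul_zero]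
    exact mul_nonneg (M.mm_nonneg _ _) (M.mm_nonneg _ _)
  have h1 := M.mm_lc i k
  have h2 := M.mm_lc i (k + 1)
  have p0 := M.mm_pos i k (by omega)
  have p1 := M.mm_pos i (k + 1) (by omega)
  have p2 := M.mm_pos i (k + 2) (by omega)
  have p3 := M.mm_pos i (k + 3) (by omega)
  have : k + 1 + 2 = k + 3 := rfl
  rw [this] at h2
  have : k + 1 + 1 = k + 2 := rfl
  rw [this] at h2
  refine le_of_mul_le_mul_right ?_ (mul_pos p1 p2)
  calc M.mm i k * M.mm i (k + 3) * (M.mm i (k + 1) * M.mm i (k + 2))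
      = (M.mm i k * M.mm i (k + 2)) * (M.mm i (k + 1) * M.mm i (k + 3)) := by ring
    _ ≤ (M.mm i (k + 1) ^ 2) * (M.mm i (k + 2) ^ 2) :=
        mul_le_mul h1 h2 (by positivity) (by positivity)
    _ = _ := by ring

theorem W_lc (k : ℕ) : M.W k * M.W (k + 2) ≤ M.W (k + 1) ^ 2 := by
  rcases isEmpty_or_nonempty E with hE | hE
  · rw [M.W_gt (k + 2), mul_zero]
    · positivity
    · rw [Finset.univ_eq_empty, M.rk_empty]; omega
  obtain ⟨i⟩ := hE
  haveI : Nonempty E := ⟨i⟩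
  rw [M.W_succ i (k + 1), M.W_succ i k]
  cases k with
  | zero =>
    rw [W_zero]
    have h1 := M.mm_lc i 0
    rw [M.mm_zero] at h1 ⊢
    have := M.mm_nonneg i 1
    simp only [zero_add] at h1 ⊢
    norm_num at h1 ⊢
    nlinarith
  | succ k =>
    rw [M.W_succ i k]
    have h1 := M.mm_lc i k
    have h2 := M.mm_lc i (k + 1)
    have h3 := M.mm_lc' i k
    have e1 : k + 1 + 1 = k + 2 := rfl
    have e2 : k + 1 + 2 = k + 3 := rfl
    have e3 : k + 2 + 1 = k + 3 := rfl
    simp only [e1, e2, e3] at h1 h2 h3 ⊢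
    nlinarith

/-- integral Whitney numbers -/
noncomputable def Wz (k : ℕ) : ℤ := ∑ F ∈ M.fl (fun F => M.rk F = k), M.mu F

theorem Wz_cast (k : ℕ) : (((-1) ^ k * M.Wz k : ℤ) : ℝ) = M.W k := by
  rw [Wz, W]
  push_cast
  rw [Finset.mul_sum]
  refine Finset.sum_congr rfl fun F hF => ?_
  rw [w, (M.mem_fl.1 hF).2]

theorem Wz_abs (k : ℕ) : ((|M.Wz k| : ℤ) : ℝ) = M.W k := by
  have h := M.Wz_cast k
  have h0 : 0 ≤ M.W k := Finset.sum_nonneg fun F hF => (M.w_pos _ F rfl (M.mem_fl.1 hF).1).le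
  have : |M.Wz k| = |(-1) ^ k * M.Wz k| := by rw [abs_mul]; simp
  rw [this, Int.cast_abs, h, abs_of_nonneg h0]

theorem Wz_lc (k : ℕ) : |M.Wz k| * |M.Wz (k + 2)| ≤ |M.Wz (k + 1)| ^ 2 := by
  have h := M.W_lc k
  rw [← Wz_abs, ← Wz_abs, ← Wz_abs] at h
  exact_mod_cast h

theorem Wz_pos (k : ℕ) (hk : k ≤ M.rk Finset.univ) : 0 < |M.Wz k| := by
  have h := M.W_pos k hk
  rw [← Wz_abs] at h
  exact_mod_cast h

end Flats
end HRW

namespace HRW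

theorem unimodal_of_lc (a : ℕ → ℤ) (N : ℕ) (h0 : ∀ k, 0 ≤ a k) (hN : 0 < a N)
    (hup : ∀ j k, j ≤ k → k ≤ N → 0 < a j → 0 < a k)
    (hlc : ∀ k, k + 2 ≤ N → a k * a (k + 2) ≤ a (k + 1) ^ 2) :
    ∃ i ≤ N, (∀ j k, j ≤ k → k ≤ i → a j ≤ a k) ∧
      (∀ j k, i ≤ j → j ≤ k → k ≤ N → a k ≤ a j) := by
  obtain ⟨i, hi, hmax⟩ := Finset.exists_max_image (Finset.range (N + 1)) a ⟨0, by simp⟩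
  simp only [Finset.mem_range] at hi hmax
  have hipos : 0 < a i := hN.trans_le (hmax N (by omega))
  have hdec : ∀ k, i ≤ k → k + 1 ≤ N → a (k + 1) ≤ a k := by
    intro k hk
    induction k, hk using Nat.le_induction with
    | base => intro h; exact hmax _ (by omega)
    | succ k hk ih =>
      intro h
      have h1 := ih (by omega)
      have h2 := hlc k (by omega)
      have h3 := hup i (k + 1) (by omega) (by omega) hipos
      by_contra hc
      push Not at hc
      have e : k + 1 + 1 = k + 2 := rfl
      rw [e] at hc
      nlinarith
  have hinc : ∀ m k, k + 1 + m = i → a k ≤ a (k + 1) := by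
    intro m
    induction m with
    | zero => intro k hk; obtain rfl : k + 1 = i := hk; exact hmax k (by omega)
    | succ m ih =>
      intro k hk
      have h1 := ih (k + 1) (by omega)
      have h2 := hlc k (by omega)
      by_contra hc
      push Not at hc
      have h3 := hup k (k + 1) (by omega) (by omega) ((h0 _).trans_lt hc)
      have e : k + 1 + 1 = k + 2 := rfl
      rw [e] at h1
      nlinarith
  refine ⟨i, by omega, fun j k hjk => ?_, fun j k hij hjk => ?_⟩
  · induction k, hjk using Nat.le_induction with
    | base => intro; exact le_rfl
    | succ k hk ih =>
      intro h
      exact (ih (by omega)).trans (hinc (i - k - 1) k (by omega))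
  · induction k, hjk using Nat.le_induction with
    | base => intro; exact le_rfl
    | succ k hk ih =>
      intro h
      exact (hdec k (by omega) h).trans (ih (by omega))

section graph
variable {V E : Type*} [Fintype V] [Fintype E] [DecidableEq E] (s t : E → V)

/-- connectivity by the edges of `F` -/
def conS (F : Finset E) : Setoid V := Relation.EqvGen.setoid fun v w => ∃ e ∈ F, s e = v ∧ t e = w

theorem conS_le {F : Finset E} {r : Setoid V} : conS s t F ≤ r ↔ ∀ e ∈ F, r (s e) (t e) := by
  constructor
  · intro h e he
    exact h (Relation.EqvGen.rel _ _ ⟨e, he, rfl, rfl⟩)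
  · intro h
    refine Setoid.eqvGen_le ?_
    rintro v w ⟨e, he, rfl, rfl⟩
    exact h e he

theorem conS_edge {F : Finset E} {e : E} (he : e ∈ F) : conS s t F (s e) (t e) :=
  (conS_le s t).1 le_rfl e he

theorem conS_mono {F G : Finset E} (h : F ⊆ G) : conS s t F ≤ conS s t G :=
  (conS_le s t).2 fun _ he => conS_edge s t (h he)

theorem conS_empty : conS s t ∅ = ⊥ := le_bot_iff.1 ((conS_le s t).2 (by simp))

noncomputable def comp (F : Finset E) : ℕ := Nat.card (Quotient (conS s t F))

theorem comp_empty : comp s t ∅ = Fintype.card V := by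
  rw [comp, conS_empty, ← Nat.card_eq_fintype_card]
  refine (Nat.card_eq_of_bijective (Quotient.mk (⊥ : Setoid V)) ⟨fun x y h => ?_, Quotient.mk_surjective⟩).symm
  exact Quotient.exact h

theorem comp_le (F : Finset E) : comp s t F ≤ Fintype.card V := by
  classical
  rw [comp, Nat.card_eq_fintype_card]
  exact Fintype.card_le_of_surjective _ (Quotient.mk_surjective (s := conS s t F))

theorem comp_lt {F G : Finset E} (h : F ⊆ G) {e : E} (he : e ∈ G)
    (hn : ¬ conS s t F (s e) (t e)) : comp s t G < comp s t F := by
  classical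
  let f : Quotient (conS s t F) → Quotient (conS s t G) :=
    Quotient.map' id fun x y hxy => conS_mono s t h hxy
  rw [comp, comp, Nat.card_eq_fintype_card, Nat.card_eq_fintype_card]
  refine Fintype.card_lt_of_surjective_not_injective f ?_ ?_
  · intro q
    induction q using Quotient.inductionOn with
    | _ x => exact ⟨Quotient.mk _ x, rfl⟩
  · intro hinj
    have : f (Quotient.mk _ (s e)) = f (Quotient.mk _ (t e)) :=
      Quotient.sound (conS_edge s t he)
    exact hn (Quotient.exact (hinj this))

theorem comp_cover {F : Finset E} {e : E} (hn : ¬ conS s t F (s e) (t e)) :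
    ∃ G, (∀ x, conS s t G (s x) (t x) → x ∈ G) ∧ F ⊆ G ∧ e ∈ G ∧
      comp s t F = comp s t G + 1 := by
  classical
  let Q := Quotient (conS s t F)
  let mk : V → Q := Quotient.mk _
  let h : V → Q := fun x => if mk x = mk (t e) then mk (s e) else mk x
  have hne : mk (s e) ≠ mk (t e) := fun hc => hn (Quotient.exact hc)
  let G : Finset E := Finset.univ.filter fun x => h (s x) = h (t x)
  have hFG : F ⊆ G := by
    intro x hx
    have : mk (s x) = mk (t x) := Quotient.sound (conS_edge s t hx)
    simp [G, h, this]
  have heG : e ∈ G := by simp [G, h]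
  have hle : conS s t G ≤ Setoid.ker h := (conS_le s t).2 fun x hx => by
    simpa [G, Setoid.ker_def] using hx
  have hm : ∀ x y, mk x = mk y → conS s t G x y := fun x y hxy =>
    conS_mono s t hFG (Quotient.exact hxy)
  have hrep : ∀ x, ∃ y, mk y = h x ∧ conS s t G x y := by
    intro x
    by_cases hx : mk x = mk (t e)
    · refine ⟨s e, by simp [h, hx], ?_⟩
      exact (conS s t G).trans (hm _ _ hx) ((conS s t G).symm (conS_edge s t heG))
    · exact ⟨x, by simp [h, hx], (conS s t G).refl x⟩
  have hge : ∀ x y, h x = h y → conS s t G x y := by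
    intro x y hxy
    obtain ⟨x', h1, h2⟩ := hrep x
    obtain ⟨y', h3, h4⟩ := hrep y
    exact (conS s t G).trans h2 ((conS s t G).trans (hm _ _ (by rw [h1, h3, hxy]))
      ((conS s t G).symm h4))
  refine ⟨G, ?_, hFG, heG, ?_⟩
  · intro x hx
    have := hle hx
    rw [Setoid.ker_def] at this
    simpa [G] using this
  · have hv : ∀ x, h x ≠ mk (t e) := by
      intro x
      by_cases hx : mk x = mk (t e) <;> simp [h, hx, hne]
    let g : Quotient (conS s t G) → {q : Q // q ≠ mk (t e)} :=
      Quotient.lift (fun x => ⟨h x, hv x⟩) fun x y hxy => Subtype.ext (hle hxy)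
    have hg : Function.Bijective g := by
      constructor
      · intro p q
        induction p using Quotient.inductionOn with
        | _ x =>
        induction q using Quotient.inductionOn with
        | _ y =>
        intro hxy
        exact Quotient.sound (hge x y (congrArg Subtype.val hxy))
      · rintro ⟨q, hq⟩
        induction q using Quotient.inductionOn with
        | _ x =>
        refine ⟨Quotient.mk _ x, Subtype.ext ?_⟩
        change h x = mk x
        exact if_neg hq
    rw [comp, comp, Nat.card_eq_of_bijective g hg, Nat.card_eq_fintype_card,
      Nat.card_eq_fintype_card, Fintype.card_subtype_compl, Fintype.card_subtype_eq]
    have : 0 < Fintype.card Q := Fintype.card_pos_iff.2 ⟨mk (t e)⟩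
    change Fintype.card Q = _
    omega

/-- The flats of a graph. -/
noncomputable def gflats (hst : ∀ e, s e ≠ t e) : Flats E where
  IsFlat F := ∀ e, conS s t F (s e) (t e) → e ∈ F
  rk F := Fintype.card V - comp s t F
  empty_flat := by
    intro e he
    rw [conS_empty] at he
    exact absurd he (hst e)
  univ_flat := fun e _ => Finset.mem_univ e
  inter := by
    intro F G hF hG e he
    exact Finset.mem_inter.2 ⟨hF e (conS_mono s t Finset.inter_subset_left he),
      hG e (conS_mono s t Finset.inter_subset_right he)⟩
  rk_empty := by rw [comp_empty]; simp
  rk_lt := by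
    intro F G hF hG h
    obtain ⟨e, he, hn⟩ := Finset.exists_of_ssubset h
    have := comp_lt s t h.1 he fun hc => hn (hF e hc)
    have := comp_le s t F
    omega
  cover := by
    intro F hF e he
    obtain ⟨G, h1, h2, h3, h4⟩ := comp_cover s t fun hc => he (hF e hc)
    have := comp_le s t F
    exact ⟨G, h1, h2, h3, by omega⟩

theorem card_const (F : Finset E) (n : ℕ) :
    Nat.card {f : V → Fin n // ∀ e ∈ F, f (s e) = f (t e)} = n ^ comp s t F := by
  classical
  have : Nat.card (Quotient (conS s t F) → Fin n) = n ^ comp s t F := by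
    rw [Nat.card_fun, Nat.card_eq_fintype_card (α := Fin n), Fintype.card_fin, comp]
  rw [← this]
  symm
  let φ : (Quotient (conS s t F) → Fin n) → {f : V → Fin n // ∀ e ∈ F, f (s e) = f (t e)} :=
    fun g => ⟨fun v => g (Quotient.mk _ v), fun e he =>
      congrArg g (Quotient.sound (conS_edge s t he))⟩
  refine Nat.card_eq_of_bijective φ ⟨fun g g' h => ?_, fun f => ?_⟩
  · funext q
    induction q using Quotient.inductionOn with
    | _ x => exact congrFun (congrArg Subtype.val h) x
  · have hle : conS s t F ≤ Setoid.ker f.1 := (conS_le s t).2 fun e he => f.2 e he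
    exact ⟨Quotient.lift f.1 fun x y hxy => hle hxy, rfl⟩

open Polynomial in
noncomputable def chi (hst : ∀ e, s e ≠ t e) : Polynomial ℤ :=
  ∑ F ∈ (gflats s t hst).fl (fun _ => True), C ((gflats s t hst).mu F) * X ^ comp s t F

theorem chi_eval (hst : ∀ e, s e ≠ t e) (n : ℕ) : (chi s t hst).eval (n : ℤ) =
    Nat.card {f : V → Fin n // ∀ e, f (s e) ≠ f (t e)} := by
  classical
  set M := gflats s t hst with hM
  let K : (V → Fin n) → Finset E := fun f => Finset.univ.filter fun e => f (s e) = f (t e)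
  have hK : ∀ f, M.IsFlat (K f) := by
    intro f e he
    have hle : conS s t (K f) ≤ Setoid.ker f := (conS_le s t).2 fun e he => by
      simpa [K, Setoid.ker_def] using he
    simpa [K, Setoid.ker_def] using hle he
  have hcount : ∀ F : Finset E, ((n : ℤ) ^ comp s t F) = ∑ f : V → Fin n, if F ⊆ K f then 1 else 0 := by
    intro F
    have := card_const s t F n
    rw [Nat.card_eq_fintype_card, Fintype.card_subtype] at this
    rw [Finset.sum_boole]
    have e : ((n : ℤ) ^ comp s t F) = ((n ^ comp s t F : ℕ) : ℤ) := by push_cast; rfl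
    rw [e, ← this]
    congr 2
    ext f
    simp [K, Finset.subset_iff]
  rw [chi, Polynomial.eval_finsetSum]
  simp only [Polynomial.eval_mul, Polynomial.eval_C, Polynomial.eval_pow, Polynomial.eval_X,
    hcount, Finset.mul_sum]
  rw [Finset.sum_comm, Nat.card_eq_fintype_card, Fintype.card_subtype, Finset.card_filter]
  push_cast
  refine Finset.sum_congr rfl fun f _ => ?_
  have h1 := M.mu_sum (hK f)
  have h2 : (K f = ∅) ↔ ∀ e, f (s e) ≠ f (t e) := by
    simp [K, Finset.filter_eq_empty_iff]
  simp only [h2] at h1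
  rw [← h1]
  simp only [mul_ite, mul_one, mul_zero]
  rw [← Finset.sum_filter]
  refine Finset.sum_congr ?_ fun _ _ => rfl
  ext F
  simp [Flats.mem_fl, hM]

theorem chi_coeff (hst : ∀ e, s e ≠ t e) (m : ℕ) (hm : m ≤ Fintype.card V) :
    (chi s t hst).coeff m = (gflats s t hst).Wz (Fintype.card V - m) := by
  classical
  rw [chi, Polynomial.finsetSum_coeff, Flats.Wz]
  simp only [Polynomial.coeff_C_mul_X_pow]
  rw [← Finset.sum_filter]
  refine Finset.sum_congr ?_ fun _ _ => rfl
  ext F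
  have := comp_le s t F
  simp only [Finset.mem_filter, Flats.mem_fl, and_true]
  refine and_congr_right fun _ => ?_
  change _ ↔ Fintype.card V - comp s t F = _
  omega

theorem chi_coeff_gt (hst : ∀ e, s e ≠ t e) (m : ℕ) (hm : Fintype.card V < m) :
    (chi s t hst).coeff m = 0 := by
  rw [chi, Polynomial.finsetSum_coeff]
  refine Finset.sum_eq_zero fun F _ => ?_
  have := comp_le s t F
  rw [Polynomial.coeff_C_mul_X_pow, if_neg (by omega)]

theorem chi_natDegree (hst : ∀ e, s e ≠ t e) : (chi s t hst).natDegree = Fintype.card V := by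
  refine le_antisymm ?_ ?_
  · exact Polynomial.natDegree_le_iff_coeff_eq_zero.2 fun m hm => chi_coeff_gt s t hst m hm
  · refine Polynomial.le_natDegree_of_ne_zero ?_
    rw [chi_coeff s t hst _ le_rfl]
    exact abs_pos.1 ((gflats s t hst).Wz_pos _ (by simp))

theorem chi_lc (hst : ∀ e, s e ≠ t e) (k : ℕ) (hk : k + 2 ≤ Fintype.card V) :
    |(chi s t hst).coeff k| * |(chi s t hst).coeff (k + 2)| ≤ |(chi s t hst).coeff (k + 1)| ^ 2 := by
  rw [chi_coeff s t hst _ (by omega), chi_coeff s t hst _ (by omega), chi_coeff s t hst _ (by omega)]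
  have := (gflats s t hst).Wz_lc (Fintype.card V - (k + 2))
  rw [mul_comm]
  convert this using 5 <;> omega

theorem chi_up (hst : ∀ e, s e ≠ t e) (j k : ℕ) (hjk : j ≤ k) (hk : k ≤ Fintype.card V)
    (h : 0 < |(chi s t hst).coeff j|) : 0 < |(chi s t hst).coeff k| := by
  rw [chi_coeff s t hst _ (by omega)] at h ⊢
  refine (gflats s t hst).Wz_pos _ ?_
  by_contra hc
  have h1 := (gflats s t hst).Wz_abs (Fintype.card V - j)
  rw [(gflats s t hst).W_gt _ (by omega)] at h1
  have : |(gflats s t hst).Wz (Fintype.card V - j)| = 0 := by exact_mod_cast h1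
  omega

end graph
end HRW

theorem chromatic_log_concave {V : Type*} [Fintype V] (G : SimpleGraph V) :
    ∃ χ : Polynomial ℤ,
      (∀ n : ℕ, χ.eval (n : ℤ) =
        Nat.card {f : V → Fin n // ∀ v w : V, G.Adj v w → f v ≠ f w}) ∧
      (∀ χ' : Polynomial ℤ, (∀ n : ℕ, χ'.eval (n : ℤ) =
        Nat.card {f : V → Fin n // ∀ v w : V, G.Adj v w → f v ≠ f w}) → χ' = χ) ∧
      (∀ k : ℕ, 0 < k → k < χ.natDegree →
        |χ.coeff (k - 1)| * |χ.coeff (k + 1)| ≤ |χ.coeff k| ^ 2) ∧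
      (∃ i ≤ χ.natDegree, (∀ j k, j ≤ k → k ≤ i → |χ.coeff j| ≤ |χ.coeff k|) ∧
        (∀ j k, i ≤ j → j ≤ k → k ≤ χ.natDegree → |χ.coeff k| ≤ |χ.coeff j|)) := by
  classical
  let E := {p : V × V // G.Adj p.1 p.2}
  let s : E → V := fun e => e.1.1
  let t : E → V := fun e => e.1.2
  have hst : ∀ e, s e ≠ t e := fun e => e.2.ne
  have hev : ∀ n : ℕ, (HRW.chi s t hst).eval (n : ℤ) =
        Nat.card {f : V → Fin n // ∀ v w : V, G.Adj v w → f v ≠ f w} := by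
    intro n
    rw [HRW.chi_eval]
    congr 1
    refine Nat.card_congr (Equiv.subtypeEquivRight fun f => ?_)
    exact ⟨fun h v w hvw => h ⟨(v, w), hvw⟩, fun h e => h _ _ e.2⟩
  refine ⟨HRW.chi s t hst, hev, ?_, ?_, ?_⟩
  · intro χ' h'
    refine Polynomial.eq_of_infinite_eval_eq _ _ ?_
    refine (Set.infinite_range_of_injective (Nat.cast_injective (R := ℤ))).mono ?_
    rintro _ ⟨n, rfl⟩
    rw [Set.mem_ofPred_eq, h', hev]
  · intro k h0 hk
    rw [HRW.chi_natDegree] at hk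
    obtain ⟨k, rfl⟩ : ∃ m, k = m + 1 := ⟨k - 1, by omega⟩
    exact HRW.chi_lc s t hst k (by omega)
  · rw [HRW.chi_natDegree]
    refine HRW.unimodal_of_lc (fun k => |(HRW.chi s t hst).coeff k|) _ (fun k => abs_nonneg _) ?_
      (HRW.chi_up s t hst) (HRW.chi_lc s t hst)
    have h := HRW.chi_coeff s t hst _ le_rfl
    rw [h]
    exact (HRW.gflats s t hst).Wz_pos _ (by simp)
end

section
/- (Welsh's conjecture, proved by Huh–Katz) Let k be a field, let V be a vector space over k, and let A be a finite subset of V. For each i ≥ 0, let f_i(A) be the number of i-element subsets of A that are linearly independent over k. Then the sequence f_0(A), f_1(A), f_2(A), … is log-concave: f_i(A)² ≥ f_{i−1}(A)·f_{i+1}(A) for all i ≥ 1. -/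
open Classical in
/-- The number of `i`-element subsets of the finite set `A` of vectors that are linearly
independent over `k`. -/
noncomputable def numLinIndep (k : Type*) {V : Type*} [Field k] [AddCommGroup V] [Module k V]
    (A : Finset V) (i : ℕ) : ℕ :=
  (A.powerset.filter fun S : Finset V =>
    S.card = i ∧ LinearIndependent k (fun v : (S : Set V) => (v : V))).card

namespace WelshAux

open Finset Matrix

/-- A symmetric real matrix is non-positive on `u` when `u` is orthogonal to every
eigenvector with positive eigenvalue. -/
lemma spec {ι : Type*} [Fintype ι] [DecidableEq ι] (B : Matrix ι ι ℝ)
    (hB : ∀ x y, B x y = B y x) (u : ι → ℝ)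
    (h : ∀ l : ℝ, 0 < l → ∀ b : ι → ℝ, (∀ x, ∑ y, B x y * b y = l * b x) → ∑ x, u x * b x = 0) :
    ∑ x, u x * ∑ y, B x y * u y ≤ 0 := by
  have hH : B.IsHermitian := by
    ext x y
    simp [Matrix.conjTranspose_apply, hB x y]
  have heig : ∀ i x, ∑ y, B x y * (hH.eigenvectorBasis i) y
      = hH.eigenvalues i * (hH.eigenvectorBasis i) x := by
    intro i x
    have := congrFun (hH.mulVec_eigenvectorBasis i) x
    simpa [Matrix.mulVec, dotProduct] using this
  let U : EuclideanSpace ℝ ι := WithLp.toLp 2 u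
  let BU : EuclideanSpace ℝ ι := WithLp.toLp 2 (fun x => ∑ y, B x y * u y)
  have h1 : ∑ x, u x * ∑ y, B x y * u y = inner ℝ U BU := by
    simp [U, BU, PiLp.inner_apply, mul_comm]
  rw [h1, ← hH.eigenvectorBasis.sum_inner_mul_inner U BU]
  apply Finset.sum_nonpos
  intro i _
  have h2 : inner ℝ U (hH.eigenvectorBasis i) = ∑ x, u x * (hH.eigenvectorBasis i) x := by
    simp [U, PiLp.inner_apply, mul_comm]
  have h3 : inner ℝ (hH.eigenvectorBasis i) BU
      = hH.eigenvalues i * ∑ x, u x * (hH.eigenvectorBasis i) x := by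
    have : inner ℝ (hH.eigenvectorBasis i) BU
        = ∑ x, (hH.eigenvectorBasis i) x * ∑ y, B x y * u y := by
      simp [BU, PiLp.inner_apply, mul_comm]
    rw [this]
    simp_rw [Finset.mul_sum]
    rw [Finset.sum_comm]
    refine Finset.sum_congr rfl fun y _ => ?_
    rw [show hH.eigenvalues i * (u y * (hH.eigenvectorBasis i) y)
      = u y * (hH.eigenvalues i * (hH.eigenvectorBasis i) y) by ring, ← heig, Finset.mul_sum]
    refine Finset.sum_congr rfl fun x _ => ?_
    rw [hB x y]; ring
  rw [h2, h3]
  by_cases hl : 0 < hH.eigenvalues i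
  · rw [h _ hl _ (heig i)]; simp
  · nlinarith [sq_nonneg (∑ x, u x * (hH.eigenvectorBasis i) x)]

/-- The local-to-global principle. -/
lemma key {ι : Type*} [Fintype ι] [DecidableEq ι] (M : ι → ι → ℝ)
    (hM : ∀ x y, M x y = M y x) (h0 : ∀ x y, 0 ≤ M x y) (w : ι → ℝ) (hw : ∀ x, 0 < w x)
    (hQ : ∀ v : ι → ℝ, ∑ x, v x * ∑ y, M x y * v y
      ≤ ∑ x, w x / (∑ y, M x y * w y) * (∑ y, M x y * v y) ^ 2)
    (o : ι) (ho : ∀ x y, 0 < M x y → 0 < M o x) (v : ι → ℝ)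
    (hv : ∑ x, v x * ∑ y, M x y * w y = 0) :
    ∑ x, v x * ∑ y, M x y * v y ≤ 0 := by
  set m : ι → ℝ := fun x => ∑ y, M x y * w y with hm
  have hm0 : ∀ x, 0 ≤ m x := fun x =>
    Finset.sum_nonneg fun y _ => mul_nonneg (h0 x y) (hw y).le
  have hrow : ∀ x, m x = 0 → ∀ y, M x y = 0 := by
    intro x hx y
    have := (Finset.sum_eq_zero_iff_of_nonneg
      (fun y _ => mul_nonneg (h0 x y) (hw y).le)).1 hx y (Finset.mem_univ y)
    exact (mul_eq_zero.1 this).resolve_right (hw y).ne'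
  have hmo : ∀ x, m x ≠ 0 → 0 < M o x := by
    intro x hx
    by_contra hcon
    apply hx
    refine Finset.sum_eq_zero fun y _ => ?_
    have : M x y = 0 := le_antisymm (not_lt.1 fun h => hcon (ho x y h)) (h0 x y)
    simp [this]
  set r : ι → ℝ := fun x => Real.sqrt (w x / m x) with hr
  have hr2 : ∀ x, r x ^ 2 = w x / m x := fun x =>
    Real.sq_sqrt (div_nonneg (hw x).le (hm0 x))
  have hrz : ∀ x, r x = 0 → m x = 0 := by
    intro x hx
    have := hr2 x
    rw [hx] at this
    by_contra hne
    have h2 : 0 < w x / m x := div_pos (hw x) (lt_of_le_of_ne (hm0 x) (Ne.symm hne))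
    rw [← this] at h2
    simp at h2
  have hrz' : ∀ x, m x = 0 → r x = 0 := by
    intro x hx; simp [hr, hx]
  have hu : ∀ x y, r x * (v x / r x) * M x y = v x * M x y := by
    intro x y
    by_cases hx : r x = 0
    · rw [hrow x (hrz x hx)]; simp
    · field_simp
  have main := spec (fun x y => r x * M x y * r y) (fun x y => by rw [hM x y]; ring)
    (fun x => v x / r x) ?_
  · refine le_of_eq_of_le ?_ main
    refine Finset.sum_congr rfl fun x _ => ?_
    rw [Finset.mul_sum, Finset.mul_sum]
    refine Finset.sum_congr rfl fun y _ => ?_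
    have e1 := hu x y
    have e2 := hu y x
    rw [hM y x] at e2
    calc v x * (M x y * v y) = (v x * M x y) * v y := by ring
      _ = r x * (v x / r x) * M x y * v y := by rw [e1]
      _ = r x * (v x / r x) * (v y * M x y) := by ring
      _ = r x * (v x / r x) * (r y * (v y / r y) * M x y) := by rw [e2]
      _ = _ := by ring
  · intro l hl b hb
    set a : ι → ℝ := fun x => r x * b x with ha
    have hb' : ∀ x, r x * ∑ y, M x y * a y = l * b x := by
      intro x
      rw [← hb x, Finset.mul_sum]
      exact Finset.sum_congr rfl fun y _ => by simp only [ha]; ring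
    have hbz : ∀ x, r x = 0 → b x = 0 := by
      intro x hx
      have := hb' x
      rw [hx, zero_mul] at this
      exact (mul_eq_zero.1 this.symm).resolve_left hl.ne'
    have hQa : ∑ x, a x * ∑ y, M x y * a y = l * ∑ x, b x ^ 2 := by
      rw [Finset.mul_sum]
      refine Finset.sum_congr rfl fun x _ => ?_
      calc a x * ∑ y, M x y * a y = b x * (r x * ∑ y, M x y * a y) := by simp only [ha]; ring
        _ = _ := by rw [hb' x]; ring
    have hQb : ∑ x, w x / m x * (∑ y, M x y * a y) ^ 2 = l ^ 2 * ∑ x, b x ^ 2 := by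
      rw [Finset.mul_sum]
      refine Finset.sum_congr rfl fun x _ => ?_
      rw [← hr2, ← mul_pow, hb' x]; ring
    have hle := hQ a
    rw [hQa, hQb] at hle
    have hle2 : ∑ x, b x ^ 2 ≤ ∑ x, a x * ∑ y, M x y * a y := by
      rw [hQa]
      refine le_of_mul_le_mul_left ?_ hl
      nlinarith
    -- the Laplacian identity
    have hlap : ∑ x, ∑ y, M x y * w x * w y * (a x / w x - a y / w y) ^ 2
        = 2 * ∑ x, b x ^ 2 - 2 * ∑ x, a x * ∑ y, M x y * a y := by
      have t1 : ∀ x, b x ^ 2 = ∑ y, M x y * w y * (a x ^ 2 / w x) := by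
        intro x
        rw [← Finset.sum_mul]
        change _ = m x * _
        by_cases hx : r x = 0
        · simp [ha, hx, hbz x hx]
        · have hmx : m x ≠ 0 := fun h => hx (hrz' x h)
          have := (hw x).ne'
          simp only [ha]
          rw [mul_pow, hr2]
          field_simp
      have t2 : ∑ x, b x ^ 2 = ∑ x, ∑ y, M x y * w x * (a y ^ 2 / w y) := by
        rw [Finset.sum_comm]
        refine Finset.sum_congr rfl fun x _ => ?_
        rw [t1 x]
        exact Finset.sum_congr rfl fun y _ => by rw [hM]
      rw [two_mul (∑ x, b x ^ 2)]
      nth_rewrite 2 [t2]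
      rw [Finset.sum_congr rfl fun x _ => t1 x]
      simp_rw [Finset.mul_sum]
      rw [← Finset.sum_add_distrib, ← Finset.sum_sub_distrib]
      refine Finset.sum_congr rfl fun x _ => ?_
      rw [← Finset.sum_add_distrib, ← Finset.sum_sub_distrib]
      refine Finset.sum_congr rfl fun y _ => ?_
      have := (hw x).ne'
      have := (hw y).ne'
      field_simp
      ring
    have hnn : ∀ x y, 0 ≤ M x y * w x * w y * (a x / w x - a y / w y) ^ 2 := fun x y =>
      mul_nonneg (mul_nonneg (mul_nonneg (h0 x y) (hw x).le) (hw y).le) (sq_nonneg _)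
    have hlap0 : ∑ x, ∑ y, M x y * w x * w y * (a x / w x - a y / w y) ^ 2 = 0 := by
      apply le_antisymm
      · rw [hlap]; linarith
      · exact Finset.sum_nonneg fun x _ => Finset.sum_nonneg fun y _ => hnn x y
    have hterm : ∀ y, M o y * w o * w y * (a o / w o - a y / w y) ^ 2 = 0 := by
      have h1 := (Finset.sum_eq_zero_iff_of_nonneg
        (fun x _ => Finset.sum_nonneg fun y _ => hnn x y)).1 hlap0 o (Finset.mem_univ o)
      intro y
      exact (Finset.sum_eq_zero_iff_of_nonneg (fun y _ => hnn o y)).1 h1 y (Finset.mem_univ y)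
    have hprop : ∀ y, m y ≠ 0 → a y = a o / w o * w y := by
      intro y hy
      have h1 := hmo y hy
      have h2 := hterm y
      have h3 : M o y * w o * w y ≠ 0 := (mul_pos (mul_pos h1 (hw o)) (hw y)).ne'
      have h4 := pow_eq_zero_iff (two_ne_zero) |>.1 ((mul_eq_zero.1 h2).resolve_left h3)
      have h5 : a o / w o = a y / w y := by linarith
      rw [h5]
      have := (hw y).ne'
      field_simp
    calc ∑ x, v x / r x * b x = ∑ x, a o / w o * (v x * m x) := by
          refine Finset.sum_congr rfl fun x _ => ?_
          by_cases hx : r x = 0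
          · simp [hx, hrz x hx]
          · have hmx : m x ≠ 0 := fun h => hx (hrz' x h)
            have h1 := hprop x hmx
            have h2 := hr2 x
            have h3 := (hw x).ne'
            have h4 : w x = r x ^ 2 * m x := by rw [h2]; field_simp
            have h5 : b x = a o / w o * (r x * m x) := by
              apply mul_left_cancel₀ hx
              change a x = _
              rw [h1]
              linear_combination (a o / w o) * h4
            rw [h5]
            field_simp
      _ = 0 := by rw [← Finset.mul_sum, hv, mul_zero]

/-- Iterated weighted sums. -/
noncomputable def Phi {X : Type*} [Fintype X] (w : X → ℝ) (f : Multiset X → ℝ) :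
    ℕ → Multiset X → ℝ
  | 0, s => f s
  | d + 1, s => ∑ x, w x * Phi w f d (x ::ₘ s)

section abstract_part
variable {X : Type*} [Fintype X] {w : X → ℝ} {f : Multiset X → ℝ}

lemma Phi_nonneg (hw : ∀ x, 0 ≤ w x) (hf : ∀ s, 0 ≤ f s) (d : ℕ) (s : Multiset X) :
    0 ≤ Phi w f d s := by
  induction d generalizing s with
  | zero => exact hf s
  | succ d ih => exact Finset.sum_nonneg fun x _ => mul_nonneg (hw x) (ih _)

lemma Phi_zero (hh : ∀ x s, f s = 0 → f (x ::ₘ s) = 0) (d : ℕ) (x : X) (s : Multiset X)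
    (h : Phi w f d s = 0) (hw : ∀ x, 0 < w x) (hf : ∀ s, 0 ≤ f s) :
    Phi w f d (x ::ₘ s) = 0 := by
  induction d generalizing s x with
  | zero => exact hh x s h
  | succ d ih =>
    refine Finset.sum_eq_zero fun y _ => ?_
    have := (Finset.sum_eq_zero_iff_of_nonneg (fun y _ => mul_nonneg (hw y).le
      (Phi_nonneg (fun x => (hw x).le) hf d _))).1 h y (Finset.mem_univ y)
    have := (mul_eq_zero.1 this).resolve_left (hw y).ne'
    rw [Multiset.cons_swap, ih _ _ this, mul_zero]

lemma Phi_zero' (hh : ∀ x s, f s = 0 → f (x ::ₘ s) = 0) (d : ℕ) (s : Multiset X)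
    (h : f s = 0) : Phi w f d s = 0 := by
  induction d generalizing s with
  | zero => exact h
  | succ d ih =>
    refine Finset.sum_eq_zero fun y _ => ?_
    rw [ih _ (hh y s h), mul_zero]

lemma Phi_o (o : X) (ho : ∀ s, f (o ::ₘ s) = f s) (d : ℕ) (s : Multiset X) :
    Phi w f d (o ::ₘ s) = Phi w f d s := by
  induction d generalizing s with
  | zero => exact ho s
  | succ d ih =>
    refine Finset.sum_congr rfl fun y _ => ?_
    rw [Multiset.cons_swap, ih]

/-- From non-positivity at some `v - c w` to the reverse Cauchy-Schwarz inequality. -/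
lemma reverse_cs (M : X → X → ℝ) (hM : ∀ x y, M x y = M y x) (v : X → ℝ) (c : ℝ)
    (hww : 0 ≤ ∑ x, w x * ∑ y, M x y * w y)
    (h : ∑ x, (v x - c * w x) * ∑ y, M x y * (v y - c * w y) ≤ 0) :
    (∑ x, v x * ∑ y, M x y * v y) * (∑ x, w x * ∑ y, M x y * w y)
      ≤ (∑ x, v x * ∑ y, M x y * w y) ^ 2 := by
  have hsym : ∑ x, w x * ∑ y, M x y * v y = ∑ x, v x * ∑ y, M x y * w y := by
    simp_rw [Finset.mul_sum]
    rw [Finset.sum_comm]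
    refine Finset.sum_congr rfl fun x _ => Finset.sum_congr rfl fun y _ => ?_
    rw [hM]; ring
  have e : ∑ x, (v x - c * w x) * ∑ y, M x y * (v y - c * w y)
      = (∑ x, v x * ∑ y, M x y * v y) - c * (∑ x, v x * ∑ y, M x y * w y)
        - c * (∑ x, w x * ∑ y, M x y * v y) + c ^ 2 * (∑ x, w x * ∑ y, M x y * w y) := by
    simp_rw [Finset.mul_sum]
    rw [← Finset.sum_sub_distrib, ← Finset.sum_sub_distrib, ← Finset.sum_add_distrib]
    refine Finset.sum_congr rfl fun x _ => ?_
    rw [← Finset.sum_sub_distrib, ← Finset.sum_sub_distrib, ← Finset.sum_add_distrib]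
    exact Finset.sum_congr rfl fun y _ => by ring
  rw [e, hsym] at h
  set p := ∑ x, v x * ∑ y, M x y * v y
  set q := ∑ x, v x * ∑ y, M x y * w y
  set z := ∑ x, w x * ∑ y, M x y * w y
  have h1 := mul_le_mul_of_nonneg_right h hww
  nlinarith [sq_nonneg (q - c * z)]

/-- The main induction. -/
lemma Phi_hyp (hw : ∀ x, 0 < w x) (hf : ∀ s, 0 ≤ f s)
    (hh : ∀ x s, f s = 0 → f (x ::ₘ s) = 0) (o : X) (ho : ∀ s, f (o ::ₘ s) = f s)
    (hbase : ∀ s (v : X → ℝ),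
      (∑ x, v x * ∑ y, f (x ::ₘ y ::ₘ s) * v y) * (∑ x, w x * ∑ y, f (x ::ₘ y ::ₘ s) * w y)
      ≤ (∑ x, v x * ∑ y, f (x ::ₘ y ::ₘ s) * w y) ^ 2)
    (d : ℕ) (s : Multiset X) (v : X → ℝ) :
      (∑ x, v x * ∑ y, Phi w f d (x ::ₘ y ::ₘ s) * v y)
        * (∑ x, w x * ∑ y, Phi w f d (x ::ₘ y ::ₘ s) * w y)
      ≤ (∑ x, v x * ∑ y, Phi w f d (x ::ₘ y ::ₘ s) * w y) ^ 2 := by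
  classical
  induction d generalizing s v with
  | zero => exact hbase s v
  | succ d ih =>
    have hnn := Phi_nonneg (f := f) (fun x => (hw x).le) hf
    set M : X → X → ℝ := fun x y => Phi w f (d + 1) (x ::ₘ y ::ₘ s) with hMdef
    have hM : ∀ x y, M x y = M y x := fun x y => by simp only [hMdef]; rw [Multiset.cons_swap]
    have h0 : ∀ x y, 0 ≤ M x y := fun x y => hnn _ _
    have hrow : ∀ x y, ∑ z, Phi w f d (y ::ₘ z ::ₘ x ::ₘ s) * w z = M x y := by
      intro x y
      refine Finset.sum_congr rfl fun z _ => ?_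
      rw [mul_comm, Multiset.cons_swap y z, Multiset.cons_swap y x]
    have hsum : ∀ (v : X → ℝ), ∑ x, v x * ∑ y, M x y * v y
        = ∑ z, w z * ∑ x, v x * ∑ y, Phi w f d (x ::ₘ y ::ₘ z ::ₘ s) * v y := by
      intro v
      simp_rw [Finset.mul_sum]
      rw [Finset.sum_comm (s := (Finset.univ : Finset X))]
      rw [Finset.sum_comm]
      conv_rhs => rw [Finset.sum_comm]
      refine Finset.sum_congr rfl fun x _ => ?_
      conv_rhs => rw [Finset.sum_comm]
      refine Finset.sum_congr rfl fun y _ => ?_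
      simp only [hMdef, Phi]
      rw [Finset.sum_mul, Finset.mul_sum]
      refine Finset.sum_congr rfl fun z _ => ?_
      rw [Multiset.cons_swap z x, Multiset.cons_swap z y]
      ring
    have hm0 : ∀ x, 0 ≤ ∑ y, M x y * w y := fun x =>
      Finset.sum_nonneg fun y _ => mul_nonneg (h0 x y) (hw y).le
    have hww : 0 ≤ ∑ x, w x * ∑ y, M x y * w y :=
      Finset.sum_nonneg fun x _ => mul_nonneg (hw x).le (hm0 x)
    have hkey := key M hM h0 w hw ?_ o ?_
    · by_cases hz : ∑ x, w x * ∑ y, M x y * w y = 0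
      · rw [hz, mul_zero]; exact sq_nonneg _
      · set c := (∑ x, v x * ∑ y, M x y * w y) / ∑ x, w x * ∑ y, M x y * w y with hc
        apply reverse_cs M hM v c hww
        apply hkey (fun x => v x - c * w x)
        simp only [sub_mul, Finset.sum_sub_distrib, mul_assoc]
        rw [← Finset.mul_sum, hc, div_mul_cancel₀ _ hz, sub_self]
    · intro v
      rw [hsum v]
      refine Finset.sum_le_sum fun z _ => ?_
      have hi := ih (z ::ₘ s) v
      simp_rw [hrow z] at hi
      have e1 : ∑ x, w x * M z x = ∑ y, M z y * w y :=
        Finset.sum_congr rfl fun y _ => mul_comm _ _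
      have e2 : ∑ x, v x * M z x = ∑ y, M z y * v y :=
        Finset.sum_congr rfl fun y _ => mul_comm _ _
      rw [e1, e2] at hi
      by_cases hz : ∑ y, M z y * w y = 0
      · rw [hz]
        have hMz : ∀ y, M z y = 0 := by
          intro y
          have := (Finset.sum_eq_zero_iff_of_nonneg
            (fun y _ => mul_nonneg (h0 z y) (hw y).le)).1 hz y (Finset.mem_univ y)
          exact (mul_eq_zero.1 this).resolve_right (hw y).ne'
        have hP : ∀ x y, Phi w f d (x ::ₘ y ::ₘ z ::ₘ s) = 0 := by
          intro x y
          have h1 := hMz x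
          rw [← hrow z x] at h1
          have := (Finset.sum_eq_zero_iff_of_nonneg
            (fun y _ => mul_nonneg (hnn d _) (hw y).le)).1 h1 y (Finset.mem_univ y)
          exact (mul_eq_zero.1 this).resolve_right (hw y).ne'
        simp [hP]
      · have hpos := lt_of_le_of_ne (hm0 z) (Ne.symm hz)
        rw [div_mul_eq_mul_div, mul_div_assoc]
        refine mul_le_mul_of_nonneg_left ?_ (hw z).le
        rw [le_div_iff₀ hpos]
        exact hi
    · intro x y hxy
      by_contra hcon
      have h1 : M o x = 0 := le_antisymm (not_lt.1 hcon) (h0 o x)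
      simp only [hMdef] at h1 hxy
      rw [Phi_o o ho] at h1
      rw [Multiset.cons_swap, Phi_zero hh _ _ _ h1 hw hf] at hxy
      exact lt_irrefl _ hxy

/-- Log-concavity of `Phi`. -/
lemma Phi_lc (hw : ∀ x, 0 < w x) (hf : ∀ s, 0 ≤ f s)
    (hh : ∀ x s, f s = 0 → f (x ::ₘ s) = 0) (o : X) (ho : ∀ s, f (o ::ₘ s) = f s)
    (hbase : ∀ s (v : X → ℝ),
      (∑ x, v x * ∑ y, f (x ::ₘ y ::ₘ s) * v y) * (∑ x, w x * ∑ y, f (x ::ₘ y ::ₘ s) * w y)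
      ≤ (∑ x, v x * ∑ y, f (x ::ₘ y ::ₘ s) * w y) ^ 2) (d : ℕ) :
    Phi w f d 0 * Phi w f (d + 2) 0 ≤ Phi w f (d + 1) 0 ^ 2 := by
  classical
  have h := Phi_hyp hw hf hh o ho hbase d 0 (Pi.single o 1)
  have e : ∀ g : X → ℝ, ∑ x, (Pi.single o 1 : X → ℝ) x * g x = g o := by
    intro g; simp [Pi.single_apply]
  have e' : ∀ g : X → ℝ, ∑ x, g x * (Pi.single o 1 : X → ℝ) x = g o := by
    intro g; simp [Pi.single_apply]
  rw [e, e, e'] at h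
  simp_rw [Phi_o o ho] at h
  have e1 : ∑ y, Phi w f d (y ::ₘ 0) * w y = Phi w f (d + 1) 0 :=
    Finset.sum_congr rfl fun y _ => mul_comm _ _
  have e2 : ∑ x, w x * ∑ y, Phi w f d (x ::ₘ y ::ₘ 0) * w y = Phi w f (d + 2) 0 := by
    refine Finset.sum_congr rfl fun x _ => ?_
    congr 1
    refine Finset.sum_congr rfl fun y _ => ?_
    rw [mul_comm, Multiset.cons_swap]
  rw [e1, e2] at h
  exact h

/-- The shape of the base case. -/
lemma base_shape {T : Type*} [DecidableEq T] (hw : ∀ x, 0 < w x) (M : X → X → ℝ)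
    (h0 : ∀ x y, 0 ≤ M x y) (l p : X → ℝ) (hl : ∀ x, 0 ≤ l x) (o : X) (hlo : 0 < l o)
    (c : X → T) (hM : ∀ x y, M x y = l x * l y - if c x = c y then p x * p y else 0)
    (v : X → ℝ) :
    (∑ x, v x * ∑ y, M x y * v y) * (∑ x, w x * ∑ y, M x y * w y)
      ≤ (∑ x, v x * ∑ y, M x y * w y) ^ 2 := by
  have hpos : 0 < ∑ x, l x * w x :=
    Finset.sum_pos' (fun x _ => mul_nonneg (hl x) (hw x).le)
      ⟨o, Finset.mem_univ o, mul_pos hlo (hw o)⟩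
  refine reverse_cs M ?_ v ((∑ x, l x * v x) / ∑ x, l x * w x) ?_ ?_
  · intro x y
    rw [hM, hM]
    by_cases h : c x = c y
    · rw [if_pos h, if_pos h.symm]; ring
    · rw [if_neg h, if_neg (Ne.symm h)]; ring
  · exact Finset.sum_nonneg fun x _ => mul_nonneg (hw x).le
      (Finset.sum_nonneg fun y _ => mul_nonneg (h0 x y) (hw y).le)
  · set a := (∑ x, l x * v x) / ∑ x, l x * w x with ha
    set z : X → ℝ := fun x => v x - a * w x with hz
    have hlz : ∑ x, l x * z x = 0 := by
      simp only [hz, mul_sub, Finset.sum_sub_distrib]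
      have : ∑ x, l x * (a * w x) = a * ∑ x, l x * w x := by
        rw [Finset.mul_sum]; exact Finset.sum_congr rfl fun x _ => by ring
      rw [this, ha, div_mul_cancel₀ _ hpos.ne', sub_self]
    have e : ∑ x, z x * ∑ y, M x y * z y
        = (∑ x, l x * z x) * (∑ x, l x * z x)
          - ∑ t ∈ Finset.univ.image c, (∑ x, if c x = t then p x * z x else 0) ^ 2 := by
      have e1 : ∑ t ∈ Finset.univ.image c, (∑ x, if c x = t then p x * z x else 0) ^ 2
          = ∑ x, ∑ y, if c x = c y then p x * p y * z x * z y else 0 := by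
        simp_rw [sq, Finset.sum_mul_sum]
        rw [Finset.sum_comm]
        refine Finset.sum_congr rfl fun x _ => ?_
        rw [Finset.sum_comm]
        refine Finset.sum_congr rfl fun y _ => ?_
        rw [Finset.sum_eq_single (c x)]
        · by_cases h : c x = c y
          · simp [h]; ring
          · simp [h, Ne.symm h]
        · intro t _ ht
          rw [if_neg (Ne.symm ht), zero_mul]
        · intro h
          exact absurd (Finset.mem_image_of_mem c (Finset.mem_univ x)) h
      rw [e1, Finset.sum_mul_sum, ← Finset.sum_sub_distrib]
      refine Finset.sum_congr rfl fun x _ => ?_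
      rw [Finset.mul_sum, ← Finset.sum_sub_distrib]
      refine Finset.sum_congr rfl fun y _ => ?_
      rw [hM]
      split_ifs <;> ring
    change ∑ x, z x * ∑ y, M x y * z y ≤ 0
    rw [e, hlz]
    have := Finset.sum_nonneg fun t (_ : t ∈ Finset.univ.image c) =>
      sq_nonneg (∑ x, if c x = t then p x * z x else 0)
    linarith

end abstract_part

section concrete
variable (k : Type*) {V : Type*} [Field k] [AddCommGroup V] [Module k V]

/-- Independence of a multiset of vectors. -/
def Ind (m : Multiset V) : Prop := m.Nodup ∧ LinearIndepOn k id {v : V | v ∈ m}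

lemma ind_cons (a : V) (m : Multiset V) :
    Ind k (a ::ₘ m) ↔ Ind k m ∧ a ∉ Submodule.span k {v : V | v ∈ m} := by
  have hset : {v : V | v ∈ a ::ₘ m} = insert a {v : V | v ∈ m} := by
    ext v; simp
  unfold Ind
  rw [hset, Multiset.nodup_cons]
  constructor
  · rintro ⟨⟨h1, h2⟩, h3⟩
    rw [linearIndepOn_id_insert (show a ∉ {v : V | v ∈ m} from h1)] at h3
    exact ⟨⟨h2, h3.1⟩, h3.2⟩
  · rintro ⟨⟨h1, h2⟩, h3⟩
    exact ⟨⟨fun h => h3 (Submodule.subset_span h), h1⟩, h2.id_insert h3⟩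

/-- The vectors occurring in a word. -/
def vecs {A : Finset V} (s : Multiset (Option {x // x ∈ A})) : Multiset V :=
  (s.filterMap id).map Subtype.val

@[simp] lemma vecs_none {A : Finset V} (s : Multiset (Option {x // x ∈ A})) :
    vecs (none ::ₘ s) = vecs s := by
  simp [vecs]

@[simp] lemma vecs_some {A : Finset V} (e : {x // x ∈ A})
    (s : Multiset (Option {x // x ∈ A})) :
    vecs (some e ::ₘ s) = (e : V) ::ₘ vecs s := by
  unfold vecs
  rw [Multiset.filterMap_cons_some id (some e) s (b := e) rfl, Multiset.map_cons]

open Classical in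
/-- Indicator of independence. -/
noncomputable def indF (A : Finset V) (s : Multiset (Option {x // x ∈ A})) : ℝ :=
  if Ind k (vecs s) then 1 else 0

lemma indF_nonneg (A : Finset V) (s) : 0 ≤ indF k A s := by
  unfold indF; split_ifs <;> norm_num

lemma indF_none (A : Finset V) (s) : indF k A (none ::ₘ s) = indF k A s := by
  unfold indF; rw [vecs_none]

lemma indF_hered (A : Finset V) (x s) (h : indF k A s = 0) : indF k A (x ::ₘ s) = 0 := by
  cases x with
  | none => rwa [indF_none]
  | some e =>
    unfold indF at h ⊢
    have h1 : ¬ Ind k (vecs s) := by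
      intro h2; rw [if_pos h2] at h; exact one_ne_zero h
    rw [vecs_some, if_neg]
    intro h2
    exact h1 ((ind_cons k _ _).1 h2).1

lemma indF_base (A : Finset V) (w : Option {x // x ∈ A} → ℝ) (hw : ∀ x, 0 < w x)
    (s : Multiset (Option {x // x ∈ A})) (v : Option {x // x ∈ A} → ℝ) :
    (∑ x, v x * ∑ y, indF k A (x ::ₘ y ::ₘ s) * v y)
        * (∑ x, w x * ∑ y, indF k A (x ::ₘ y ::ₘ s) * w y)
      ≤ (∑ x, v x * ∑ y, indF k A (x ::ₘ y ::ₘ s) * w y) ^ 2 := by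
  classical
  by_cases hs : Ind k (vecs s)
  swap
  · have h0 : indF k A s = 0 := by simp [indF, hs]
    have h1 : ∀ x y, indF k A (x ::ₘ y ::ₘ s) = 0 := fun x y =>
      indF_hered k A _ _ (indF_hered k A _ _ h0)
    simp [h1]
  set S : Set V := {v : V | v ∈ vecs s} with hS
  let c : Option {x // x ∈ A} → Submodule k V := fun x =>
    x.elim ⊥ (fun e => Submodule.span k (insert (e : V) S))
  let l : Option {x // x ∈ A} → ℝ := fun x => indF k A (x ::ₘ s)
  let p : Option {x // x ∈ A} → ℝ := fun x => x.elim 0 (fun e => indF k A (some e ::ₘ s))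
  have hone : indF k A s = 1 := by simp [indF, hs]
  have hsome : ∀ e : {x // x ∈ A}, indF k A (some e ::ₘ s)
      = if (e : V) ∈ Submodule.span k S then 0 else 1 := by
    intro e
    unfold indF
    rw [vecs_some]
    simp only [ind_cons, hs, true_and]
    by_cases h : (e : V) ∈ Submodule.span k S
    · rw [if_pos h, if_neg (not_not.2 h)]
    · rw [if_neg h, if_pos h]
  refine base_shape hw (fun x y => indF k A (x ::ₘ y ::ₘ s)) (fun x y => indF_nonneg k A _)
    l p (fun x => indF_nonneg k A _) none ?_ c ?_ v
  · simp only [l]; rw [indF_none, hone]; exact one_pos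
  · intro x y
    cases x with
    | none => simp [l, p, indF_none, hone]
    | some e =>
      cases y with
      | none =>
        simp only [l, p]
        rw [Multiset.cons_swap, indF_none, indF_none, hone]
        simp
      | some f =>
        simp only [l, p, Option.elim]
        by_cases he : (e : V) ∈ Submodule.span k S
        · have h1 : indF k A (some e ::ₘ s) = 0 := by rw [hsome, if_pos he]
          rw [Multiset.cons_swap, indF_hered k A _ _ h1, h1]; simp
        by_cases hf : (f : V) ∈ Submodule.span k S
        · have h1 : indF k A (some f ::ₘ s) = 0 := by rw [hsome, if_pos hf]
          rw [indF_hered k A _ _ h1, h1]; simp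
        rw [hsome, hsome, if_neg he, if_neg hf]
        have hiff : Ind k (vecs (some e ::ₘ some f ::ₘ s)) ↔
            ¬ (Submodule.span k (insert (e : V) S) = Submodule.span k (insert (f : V) S)) := by
          have hset : {v : V | v ∈ (f : V) ::ₘ vecs s} = insert (f : V) S := by
            ext v; simp [hS]
          rw [vecs_some, vecs_some, ind_cons, ind_cons, hset]
          simp only [hs, true_and]
          rw [and_iff_right (show (f : V) ∉ Submodule.span k {v | v ∈ vecs s} from hf), not_iff_not]
          constructor
          · intro h
            have h' := mem_span_insert_exchange h he
            apply le_antisymm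
            · rw [Submodule.span_le]
              refine Set.insert_subset h ?_
              exact (Set.subset_insert _ _).trans Submodule.subset_span
            · rw [Submodule.span_le]
              refine Set.insert_subset h' ?_
              exact (Set.subset_insert _ _).trans Submodule.subset_span
          · intro h
            rw [← h]
            exact Submodule.subset_span (Set.mem_insert _ _)
        unfold indF
        by_cases hc : c (some e) = c (some f)
        · rw [if_neg (fun h => (hiff.1 h) hc), if_pos hc]; norm_num
        · rw [if_pos (hiff.2 hc), if_neg hc]; norm_num

/-- The weights. -/
noncomputable def wt (A : Finset V) (t : ℝ) : Option {x // x ∈ A} → ℝ :=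
  fun x => x.elim t (fun _ => 1)

lemma Phi_cont (A : Finset V) (d : ℕ) (s) :
    Continuous fun t : ℝ => Phi (wt A t) (indF k A) d s := by
  induction d generalizing s with
  | zero => exact continuous_const
  | succ d ih =>
    simp only [Phi]
    refine continuous_finsetSum _ fun x _ => Continuous.mul ?_ (ih _)
    cases x with
    | none => exact continuous_id
    | some e => exact continuous_const

lemma Phi_lc0 (A : Finset V) (d : ℕ) :
    Phi (wt A 0) (indF k A) d 0 * Phi (wt A 0) (indF k A) (d + 2) 0
      ≤ Phi (wt A 0) (indF k A) (d + 1) 0 ^ 2 := by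
  have h1 : Filter.Tendsto (fun t : ℝ => Phi (wt A t) (indF k A) d 0
      * Phi (wt A t) (indF k A) (d + 2) 0) (nhdsWithin 0 (Set.Ioi 0))
      (nhds (Phi (wt A 0) (indF k A) d 0 * Phi (wt A 0) (indF k A) (d + 2) 0)) :=
    (((Phi_cont k A d 0).mul (Phi_cont k A (d + 2) 0)).tendsto 0).mono_left nhdsWithin_le_nhds
  have h2 : Filter.Tendsto (fun t : ℝ => Phi (wt A t) (indF k A) (d + 1) 0 ^ 2)
      (nhdsWithin 0 (Set.Ioi 0)) (nhds (Phi (wt A 0) (indF k A) (d + 1) 0 ^ 2)) :=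
    (((Phi_cont k A (d + 1) 0).pow 2).tendsto 0).mono_left nhdsWithin_le_nhds
  refine le_of_tendsto_of_tendsto h1 h2 ?_
  filter_upwards [self_mem_nhdsWithin] with t ht
  have hw : ∀ x, 0 < wt A t x := by
    intro x
    cases x with
    | none => exact ht
    | some e => exact one_pos
  exact Phi_lc hw (indF_nonneg k A) (indF_hered k A) none (indF_none k A)
    (fun s v => indF_base k A _ hw s v) d

open Classical in
/-- Independent subsets of `A` of size `n` which contain `S`. -/
noncomputable def cnt (A S : Finset V) (n : ℕ) : Finset (Finset V) :=
  A.powerset.filter fun I : Finset V => S ⊆ I ∧ I.card = n ∧ Ind k I.val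

lemma Phi_cnt (A : Finset V) (d : ℕ) (s : Multiset (Option {x // x ∈ A})) (S : Finset V)
    (hSA : S ⊆ A) (hS : vecs s = S.val) :
    Phi (wt A 0) (indF k A) d s = (d.factorial : ℝ) * ((cnt k A S (S.card + d)).card : ℝ) := by
  classical
  induction d generalizing s S with
  | zero =>
    have : cnt k A S (S.card + 0) = if Ind k S.val then {S} else ∅ := by
      ext I
      simp only [cnt, Finset.mem_filter, Finset.mem_powerset, add_zero]
      constructor
      · rintro ⟨h1, h2, h3, h4⟩
        have := Finset.eq_of_subset_of_card_le h2 h3.le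
        subst this
        rw [if_pos h4]; simp
      · intro h
        by_cases hi : Ind k S.val
        · rw [if_pos hi, Finset.mem_singleton] at h
          subst h
          exact ⟨hSA, Finset.Subset.refl _, rfl, hi⟩
        · rw [if_neg hi] at h; simp at h
    rw [this]
    simp only [Phi, indF, hS]
    split_ifs <;> simp
  | succ d ih =>
    have hstep : ∀ e : {x // x ∈ A}, Phi (wt A 0) (indF k A) d (some e ::ₘ s)
        = if (e : V) ∈ S then 0
          else (d.factorial : ℝ) * ((cnt k A (insert (e : V) S) (S.card + (d + 1))).card : ℝ) := by
      intro e
      by_cases he : (e : V) ∈ S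
      · rw [if_pos he]
        apply Phi_zero' (indF_hered k A)
        unfold indF
        rw [if_neg]
        rintro ⟨h1, -⟩
        rw [vecs_some, hS, Multiset.nodup_cons] at h1
        exact h1.1 he
      · rw [if_neg he, ih (some e ::ₘ s) (insert (e : V) S)
          (Finset.insert_subset e.2 hSA)
          (by rw [vecs_some, hS, Finset.insert_val_of_notMem he]),
          Finset.card_insert_of_notMem he, show S.card + 1 + d = S.card + (d + 1) by ring]
    have hsum : Phi (wt A 0) (indF k A) (d + 1) s = ∑ e ∈ A, if e ∈ S then (0 : ℝ)
          else (d.factorial : ℝ) * ((cnt k A (insert e S) (S.card + (d + 1))).card : ℝ) := by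
      simp only [Phi]
      rw [Fintype.sum_option]
      simp only [wt, Option.elim, zero_mul, zero_add, one_mul, hstep]
      exact Finset.sum_coe_sort A (fun e => if e ∈ S then (0 : ℝ)
          else (d.factorial : ℝ) * ((cnt k A (insert e S) (S.card + (d + 1))).card : ℝ))
    have hdc : ∑ e ∈ A, (if e ∈ S then 0 else (cnt k A (insert e S) (S.card + (d + 1))).card)
        = (d + 1) * (cnt k A S (S.card + (d + 1))).card := by
      have h1 : ∀ e ∈ A, (if e ∈ S then 0 else (cnt k A (insert e S) (S.card + (d + 1))).card)
          = ∑ I ∈ cnt k A S (S.card + (d + 1)), if e ∈ I \ S then 1 else 0 := by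
        intro e _
        rw [← Finset.card_filter]
        split_ifs with he
        · symm
          rw [Finset.card_eq_zero, Finset.filter_eq_empty_iff]
          intro I _ h
          exact (Finset.mem_sdiff.1 h).2 he
        · congr 1
          ext I
          simp only [cnt, Finset.mem_filter, Finset.mem_powerset, Finset.insert_subset_iff,
            Finset.mem_sdiff]
          tauto
      rw [Finset.sum_congr rfl h1, Finset.sum_comm]
      rw [Finset.sum_congr rfl (g := fun _ => d + 1), Finset.sum_const, smul_eq_mul, mul_comm]
      intro I hI
      simp only [cnt, Finset.mem_filter, Finset.mem_powerset] at hI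
      rw [← Finset.card_filter]
      have : A.filter (fun e => e ∈ I \ S) = I \ S := by
        ext e
        simp only [Finset.mem_filter, Finset.mem_sdiff]
        exact ⟨fun h => h.2, fun h => ⟨hI.1 h.1, h⟩⟩
      rw [this, Finset.card_sdiff_of_subset hI.2.1, hI.2.2.1]
      omega
    rw [hsum]
    have : ∑ e ∈ A, (if e ∈ S then (0 : ℝ)
          else (d.factorial : ℝ) * ((cnt k A (insert e S) (S.card + (d + 1))).card : ℝ))
        = (d.factorial : ℝ) * ((∑ e ∈ A, (if e ∈ S then 0
          else (cnt k A (insert e S) (S.card + (d + 1))).card) : ℕ) : ℝ) := by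
      push_cast
      rw [Finset.mul_sum]
      refine Finset.sum_congr rfl fun e _ => ?_
      split_ifs <;> simp
    rw [this, hdc, Nat.factorial_succ]
    push_cast
    ring

lemma cnt_eq (A : Finset V) (n : ℕ) : (cnt k A ∅ n).card = numLinIndep k A n := by
  unfold cnt numLinIndep
  congr 1
  ext I
  simp only [Finset.mem_filter]
  constructor
  · rintro ⟨h1, -, h2, h3⟩
    exact ⟨h1, h2, h3.2⟩
  · rintro ⟨h1, h2, h3⟩
    exact ⟨h1, Finset.empty_subset _, h2, I.nodup, h3⟩

lemma Phi_num (A : Finset V) (d : ℕ) :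
    Phi (wt A 0) (indF k A) d 0 = (d.factorial : ℝ) * (numLinIndep k A d : ℝ) := by
  rw [Phi_cnt k A d 0 ∅ (Finset.empty_subset _) (by simp [vecs]), ← cnt_eq]
  simp

end concrete

end WelshAux

/-- **Welsh's conjecture (proved by Huh–Katz).** For a finite subset `A` of a vector space
over a field `k`, the numbers `f_i(A)` of `i`-element linearly independent subsets of `A`
form a log-concave sequence. -/
theorem welsh_log_concave {k V : Type*} [Field k] [AddCommGroup V] [Module k V]
    (A : Finset V) :
    ∀ i : ℕ, 1 ≤ i →
      numLinIndep k A (i - 1) * numLinIndep k A (i + 1) ≤ numLinIndep k A i ^ 2 := by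
  intro i hi
  obtain ⟨d, rfl⟩ : ∃ d, i = d + 1 := ⟨i - 1, by omega⟩
  have h := WelshAux.Phi_lc0 k A d
  rw [WelshAux.Phi_num, WelshAux.Phi_num, WelshAux.Phi_num] at h
  rw [Nat.add_sub_cancel]
  have h' : (d.factorial * numLinIndep k A d) * ((d + 2).factorial * numLinIndep k A (d + 2))
      ≤ ((d + 1).factorial * numLinIndep k A (d + 1)) ^ 2 := by exact_mod_cast h
  have e2 : (d + 2).factorial = (d + 2) * (d + 1).factorial := Nat.factorial_succ _
  have e1 : (d + 1).factorial = (d + 1) * d.factorial := Nat.factorial_succ _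
  have hpos : 0 < (d + 1) * d.factorial * d.factorial * (d + 1) := by positivity
  refine le_of_mul_le_mul_left ?_ hpos
  calc _ ≤ (d.factorial * numLinIndep k A d) * ((d + 2).factorial * numLinIndep k A (d + 2)) := by
        rw [e2, e1]
        have : (d + 1) * d.factorial * d.factorial * (d + 1)
            ≤ d.factorial * ((d + 2) * ((d + 1) * d.factorial)) := by
          have := Nat.zero_le ((d + 1) * d.factorial * d.factorial)
          nlinarith
        calc _ ≤ d.factorial * ((d + 2) * ((d + 1) * d.factorial))
              * (numLinIndep k A d * numLinIndep k A (d + 1 + 1)) := Nat.mul_le_mul_right _ this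
          _ = _ := by ring
    _ ≤ _ := h'
    _ = _ := by rw [e1]; ring
end
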